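/- arXiv:2201.11334 — 4 statements merged into one kernel-verified Lean document; each statement's English description precedes it below -/
import Mathlib

section
/- Let n be an integer with 7 <= n <= 13 and let q be a prime power such that gcd(q, n) ≠ 1. Then there always exists an element α in F_{q^n}* such that both α and α^{-1} are simultaneously primitive and 1-normal over F_q. -/
open Polynomial

noncomputable section

/-- The action `h ∘ β = Σ_i a_i β^{q^i}` of a polynomial `h = Σ_i a_i x^i` over `F_q`
on an element `β` of an extension field. -/
def polyAct {Fq F : Type*} [Field Fq] [Field F] [Algebra Fq F]
    (q : ℕ) (h : Fq[X]) (β : F) : F :=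
  h.sum fun i a => algebraMap Fq F a * β ^ q ^ i

/-- `h` is the `F_q`-order of `β`: the monic divisor of `x^n - 1` of least degree
annihilating `β`. -/
def IsFqOrder {Fq F : Type*} [Field Fq] [Field F] [Algebra Fq F]
    (q n : ℕ) (h : Fq[X]) (β : F) : Prop :=
  h.Monic ∧ h ∣ (X ^ n - 1 : Fq[X]) ∧ polyAct q h β = 0 ∧
    ∀ h' : Fq[X], h'.Monic → h' ∣ (X ^ n - 1 : Fq[X]) → polyAct q h' β = 0 →
      h.natDegree ≤ h'.natDegree

/-- `α` is `k`-normal over `F_q`: its `F_q`-order has degree `n - k`. -/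
def IsKNormal (Fq : Type*) {F : Type*} [Field Fq] [Field F] [Algebra Fq F]
    (q n k : ℕ) (α : F) : Prop :=
  ∃ h : Fq[X], IsFqOrder q n h α ∧ h.natDegree = n - k

/-- Bivariate polynomials all of whose monomials `X ^ i * Y ^ j` satisfy `p * i + D * j < k`. -/
def weightLT (F : Type*) [Field F] (p D k : ℕ) : Submodule F F[X][X] where
  carrier := {H | ∀ i j, k ≤ p * i + D * j → (H.coeff j).coeff i = 0}
  add_mem' := by
    intro a b ha hb i j h
    simp [ha i j h, hb i j h]
  zero_mem' := by intro i j _; simp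
  smul_mem' := by
    intro c a ha i j h
    simp [ha i j h]

lemma weightLT_mono {F : Type*} [Field F] {p D k l : ℕ} (hkl : k ≤ l) :
    weightLT F p D k ≤ weightLT F p D l :=
  fun _ h i j hij => h i j (hkl.trans hij)

lemma C_smul_mem_weightLT {F : Type*} [Field F] {p D k : ℕ} (a : F) {H : F[X][X]}
    (hH : H ∈ weightLT F p D k) : (C a : F[X]) • H ∈ weightLT F p D k := by
  intro i j h
  simp [hH i j h]

/-- The polynomial `Y ^ p - X ^ e * Y - g(X)` defining an Artin–Schreier curve. -/
def curvePoly {F : Type*} [Field F] (p e : ℕ) (g : F[X]) : F[X][X] :=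
  X ^ p - (C (X ^ e) * X + C g)

lemma curvePoly_degree_aux {F : Type*} [Field F] {p e : ℕ} (hp : 2 ≤ p) (g : F[X]) :
    (C (X ^ e) * X + C g : F[X][X]).degree < p := by
  calc _ ≤ (1 : WithBot ℕ) := degree_linear_le
    _ < p := by exact_mod_cast hp

lemma curvePoly_monic {F : Type*} [Field F] {p e : ℕ} (hp : 2 ≤ p) (g : F[X]) :
    (curvePoly p e g).Monic :=
  monic_X_pow_sub (by
    have := curvePoly_degree_aux (e := e) hp g
    obtain ⟨m, rfl⟩ : ∃ m, p = m + 1 := ⟨p - 1, by omega⟩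
    exact this)

lemma curvePoly_degree {F : Type*} [Field F] {p e : ℕ} (hp : 2 ≤ p) (g : F[X]) :
    (curvePoly p e g).degree = p := by
  rw [curvePoly, degree_sub_eq_left_of_degree_lt, degree_X_pow]
  rw [degree_X_pow]
  exact curvePoly_degree_aux hp g

lemma sum_modByMonic {R ι : Type*} [CommRing R] (s : Finset ι) (f : ι → R[X]) (q : R[X]) :
    (∑ i ∈ s, f i) %ₘ q = ∑ i ∈ s, f i %ₘ q :=
  map_sum (modByMonicHom q) f s

lemma mem_weightLT_of_sub_smul_monomial_mem {F : Type*} [Field F] {p D k i j : ℕ} {κ : F}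
    {H : F[X][X]} (hw : p * i + D * j = k)
    (h : H - (C κ : F[X]) • monomial j (X ^ i) ∈ weightLT F p D k) :
    H ∈ weightLT F p D (k + 1) := by
  have h1 : (C κ : F[X]) • monomial j (X ^ i : F[X]) ∈ weightLT F p D (k + 1) := by
    refine C_smul_mem_weightLT _ ?_
    intro i' j' h
    rw [coeff_monomial]
    split_ifs with hj
    · subst hj
      rw [coeff_X_pow, if_neg]
      rintro rfl
      omega
    · simp
  simpa using Submodule.add_mem _ (weightLT_mono (Nat.le_succ _) h) h1

lemma monomial_modByMonic_mem_weightLT {F : Type*} [Field F] {p D J : ℕ} {Φ : F[X][X]}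
    (hJ : ∀ I, monomial J (X ^ I) %ₘ Φ ∈ weightLT F p D (p * I + D * J + 1)) (hp : 1 ≤ p)
    (u : F[X]) {m : ℕ} (hu : u.degree < m) :
    monomial J u %ₘ Φ ∈ weightLT F p D (p * m + D * J) := by
  have hsum : u = ∑ i ∈ Finset.range m, C (u.coeff i) * X ^ i := by
    rcases eq_or_ne u 0 with rfl | h0
    · simp
    · exact as_sum_range_C_mul_X_pow' _ ((natDegree_lt_iff_degree_lt h0).2 hu)
  rw [hsum, map_sum, sum_modByMonic]
  refine Submodule.sum_mem _ fun i hi => ?_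
  rw [show monomial J (C (u.coeff i) * X ^ i) =
      (C (u.coeff i) : F[X]) • monomial J (X ^ i : F[X]) by
    rw [smul_monomial, smul_eq_mul], smul_modByMonic]
  refine C_smul_mem_weightLT _ (weightLT_mono ?_ (hJ i))
  have : i + 1 ≤ m := Finset.mem_range.1 hi
  nlinarith

/-- Modulo the curve, a monomial is a nonzero multiple of the reduced monomial of the same weight,
up to terms of smaller weight. -/
lemma monomial_modByMonic_curvePoly {F : Type*} [Field F] {p D e : ℕ} (hp : 2 ≤ p)
    (he : p * e + D + 1 ≤ p * D) {g : F[X]} (hg : g.degree = D) (J : ℕ) :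
    ∀ I, ∃ κ : F, κ ≠ 0 ∧ ∃ i j, j < p ∧ p * i + D * j = p * I + D * J ∧
      monomial J (X ^ I) %ₘ curvePoly p e g - (C κ : F[X]) • monomial j (X ^ i) ∈
        weightLT F p D (p * I + D * J) := by
  induction J using Nat.strong_induction_on with
  | _ J ih =>
  have ih' : ∀ J' < J, ∀ I, monomial J' (X ^ I) %ₘ curvePoly p e g ∈
      weightLT F p D (p * I + D * J' + 1) := by
    intro J' hJ' I
    obtain ⟨κ, -, i, j, -, hw, hmem⟩ := ih J' hJ' I
    exact mem_weightLT_of_sub_smul_monomial_mem hw hmem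
  intro I
  rcases lt_or_ge J p with hJ | hJ
  · refine ⟨1, one_ne_zero, I, J, hJ, rfl, ?_⟩
    rw [(modByMonic_eq_self_iff (curvePoly_monic hp g)).2]
    · simp
    · rw [curvePoly_degree hp]
      exact (degree_monomial_le _ _).trans_lt (by exact_mod_cast hJ)
  obtain ⟨J', rfl⟩ := Nat.exists_eq_add_of_le' hJ
  have hg0 : g ≠ 0 := by rintro rfl; simp at hg
  have hred : (monomial (J' + p) (X ^ I) : F[X][X]) %ₘ curvePoly p e g =
      monomial (J' + 1) (X ^ (I + e)) %ₘ curvePoly p e g +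
        ((C g.leadingCoeff : F[X]) • (monomial J' (X ^ (I + D)) %ₘ curvePoly p e g) +
          monomial J' (X ^ I * g.eraseLead) %ₘ curvePoly p e g) := by
    rw [← smul_modByMonic, ← add_modByMonic, ← add_modByMonic]
    refine modByMonic_eq_of_dvd_sub (curvePoly_monic hp g) ⟨monomial J' (X ^ I), ?_⟩
    have hgl : g = C g.leadingCoeff * X ^ D + g.eraseLead := by
      conv_lhs => rw [← eraseLead_add_C_mul_X_pow g, natDegree_eq_of_degree_eq_some hg]
      ring
    rw [curvePoly]
    conv_rhs => rw [hgl]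
    simp only [← C_mul_X_pow_eq_monomial, smul_eq_C_mul, map_mul, map_add, map_pow]
    ring
  have hJ'1 : J' + 1 < J' + p := by omega
  obtain ⟨κ, hκ, i, j, hj, hw, hmem⟩ := ih J' (by omega) (I + D)
  refine ⟨g.leadingCoeff * κ, mul_ne_zero (leadingCoeff_ne_zero.2 hg0) hκ, i, j, hj,
    by rw [hw]; ring, ?_⟩
  rw [hred]
  have e1 := weightLT_mono (show p * (I + e) + D * (J' + 1) + 1 ≤ p * I + D * (J' + p) by
    nlinarith) (ih' _ hJ'1 (I + e))
  have e3 := weightLT_mono (show p * (I + D) + D * J' ≤ p * I + D * (J' + p) by nlinarith)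
    (monomial_modByMonic_mem_weightLT (ih' J' (by omega)) (by omega) (X ^ I * g.eraseLead)
      (m := I + D) (by
        rw [degree_mul, degree_X_pow, Nat.cast_add]
        exact WithBot.add_lt_add_left (by simp) (hg ▸ degree_eraseLead_lt hg0)))
  have e2 := weightLT_mono (show p * (I + D) + D * J' ≤ p * I + D * (J' + p) by nlinarith)
    (C_smul_mem_weightLT g.leadingCoeff hmem)
  have := Submodule.add_mem _ e1 (Submodule.add_mem _ e2 e3)
  convert this using 1
  rw [smul_sub, smul_smul, ← C_mul]
  ring

lemma monomial_modByMonic_curvePoly_mem {F : Type*} [Field F] {p D e : ℕ} (hp : 2 ≤ p)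
    (he : p * e + D + 1 ≤ p * D) {g : F[X]} (hg : g.degree = D) (I J : ℕ) :
    monomial J (X ^ I) %ₘ curvePoly p e g ∈ weightLT F p D (p * I + D * J + 1) := by
  obtain ⟨κ, -, i, j, -, hw, hmem⟩ := monomial_modByMonic_curvePoly hp he hg J I
  exact mem_weightLT_of_sub_smul_monomial_mem hw hmem

lemma weight_injective {p D i j i' j' : ℕ} (hpD : Nat.Coprime p D) (hj : j < p) (hj' : j' < p)
    (h : p * i + D * j = p * i' + D * j') : i = i' ∧ j = j' := by
  have hp : 0 < p := by omega
  have h1 : D * j ≡ D * j' [MOD p] := by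
    have : (p * i + D * j) % p = (p * i' + D * j') % p := by rw [h]
    simpa [Nat.ModEq, Nat.add_mod] using this
  have h2 : j = j' := (Nat.ModEq.cancel_left_of_coprime hpD h1).eq_of_lt_of_lt hj hj'
  subst h2
  exact ⟨Nat.eq_of_mul_eq_mul_left hp (by omega), rfl⟩

lemma exists_weight_eq {p D k : ℕ} (hp : 0 < p) (hpD : Nat.Coprime p D) (hk : D * p ≤ k) :
    ∃ i j, j < p ∧ p * i + D * j = k := by
  obtain ⟨m, -, hm⟩ := Nat.exists_mul_mod_eq_of_coprime (n := D) (k := p) k hpD.symm hp.ne'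
  have hlt := Nat.mod_lt m hp
  have hle : D * (m % p) ≤ k := (Nat.mul_le_mul_left _ hlt.le).trans hk
  have hmod : D * (m % p) ≡ k [MOD p] := by
    have : D * (m % p) ≡ D * m [MOD p] := (Nat.mod_modEq m p).mul_left D
    exact this.trans hm
  obtain ⟨i, hi⟩ := (Nat.modEq_iff_dvd' hle).1 hmod
  exact ⟨i, m % p, hlt, by omega⟩

/-- Monomials of pairwise distinct weights are linearly independent modulo the curve. -/
lemma sum_modByMonic_ne_zero_of_weights_injective {F ι : Type*} [Field F] [Fintype ι] {p D e : ℕ}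
    (hp : 2 ≤ p) (he : p * e + D + 1 ≤ p * D) {g : F[X]}
    (hg : g.degree = D) (I J : ι → ℕ) (hinj : Function.Injective fun t => p * I t + D * J t)
    (c : ι → F) (hc : c ≠ 0) :
    (∑ t, (C (c t) : F[X]) • monomial (J t) (X ^ I t)) %ₘ curvePoly p e g ≠ 0 := by
  classical
  obtain ⟨t₁, ht₁⟩ := Function.ne_iff.1 hc
  obtain ⟨t₀, ht₀, hmax⟩ := Finset.exists_max_image
    (Finset.univ.filter fun t => c t ≠ 0) (fun t => p * I t + D * J t) ⟨t₁, by simpa using ht₁⟩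
  simp only [Finset.mem_filter, Finset.mem_univ, true_and] at ht₀ hmax
  obtain ⟨κ, hκ, i, j, hj, hw, hmem⟩ := monomial_modByMonic_curvePoly hp he hg (J t₀) (I t₀)
  intro h0
  rw [sum_modByMonic, ← Finset.add_sum_erase _ _ (Finset.mem_univ t₀)] at h0
  have hrest : ∑ t ∈ Finset.univ.erase t₀,
      ((C (c t) : F[X]) • monomial (J t) (X ^ I t : F[X])) %ₘ curvePoly p e g ∈
      weightLT F p D (p * I t₀ + D * J t₀) := by
    refine Submodule.sum_mem _ fun t ht => ?_
    rw [smul_modByMonic]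
    by_cases hct : c t = 0
    · simp [hct]
    · refine C_smul_mem_weightLT _ (weightLT_mono ?_
        (monomial_modByMonic_curvePoly_mem hp he hg (I t) (J t)))
      exact lt_of_le_of_ne (hmax t hct) fun h => (Finset.ne_of_mem_erase ht) (hinj h)
  simp only [smul_modByMonic] at hrest
  have h2 := hrest i j hw.ge
  have h3 := hmem i j hw.ge
  have h4 := congrArg (fun H : F[X][X] => (H.coeff j).coeff i) h0
  simp only [coeff_add, h2, smul_modByMonic, coeff_smul, coeff_sub, coeff_zero,
    coeff_monomial, smul_eq_mul, coeff_C_mul, if_true, coeff_X_pow, mul_one, add_zero] at h3 h4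
  rw [sub_eq_zero] at h3
  rw [h3] at h4
  exact mul_ne_zero ht₀ hκ h4

lemma evalEval_modByMonic_curvePoly {F : Type*} [Field F] {p e : ℕ} {g : F[X]}
    {y w : F} (h : w ^ p = y ^ e * w + g.eval y) (H : F[X][X]) :
    (H %ₘ curvePoly p e g).evalEval y w = H.evalEval y w := by
  have hΦ : (curvePoly p e g).evalEval y w = 0 := by
    simp only [curvePoly, evalEval_sub, evalEval_add, evalEval_mul, evalEval_pow, evalEval_C,
      evalEval_X, eval_pow, eval_X, h, sub_self]
  conv_rhs => rw [← modByMonic_add_div H (curvePoly p e g)]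
  rw [evalEval_add, evalEval_mul, hΦ, zero_mul, add_zero]

/-- A nontrivial relation between reductions of more monomials of bounded weight than there are
weights. -/
lemma exists_relation_of_weights_le {F ι : Type*} [Field F] [Fintype ι] {p D e M : ℕ}
    (hp : 2 ≤ p) (hpD : Nat.Coprime p D) (he : p * e + D + 1 ≤ p * D) {g : F[X]}
    (hg : g.degree = D) (I J : ι → ℕ) (hM : ∀ t, p * I t + D * J t ≤ M)
    (hcard : M + 1 < Fintype.card ι) :
    ∃ c : ι → F, c ≠ 0 ∧
      (∑ t, (C (c t) : F[X]) • monomial (J t) (X ^ I t)) %ₘ curvePoly p e g = 0 := by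
  classical
  let P := (Finset.range (M + 1) ×ˢ Finset.range p).filter fun x => p * x.1 + D * x.2 ≤ M
  have hP : P.card ≤ M + 1 := by
    rw [← Finset.card_range (M + 1)]
    refine Finset.card_le_card_of_injOn (fun x => p * x.1 + D * x.2) ?_ ?_
    · intro x hx
      have := (Finset.mem_filter.1 hx).2
      simp only [Finset.coe_range, Set.mem_Iio]
      omega
    · rintro ⟨i, j⟩ hx ⟨i', j'⟩ hx' h
      simp only [P, Finset.coe_filter, Finset.mem_product, Finset.mem_range,
        Set.mem_ofPred_eq] at hx hx'
      obtain ⟨rfl, rfl⟩ := weight_injective hpD hx.1.2 hx'.1.2 h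
      rfl
  let T : Matrix P ι F := Matrix.of fun x t =>
    ((monomial (J t) (X ^ I t) %ₘ curvePoly p e g).coeff x.1.2).coeff x.1.1
  have hker : T.mulVecLin.ker ≠ ⊥ := by
    apply LinearMap.ker_ne_bot_of_finrank_lt
    simp only [Module.finrank_fintype_fun_eq_card, Fintype.card_coe]
    omega
  obtain ⟨c, hc, hc0⟩ := Submodule.exists_mem_ne_zero_of_ne_bot hker
  refine ⟨c, hc0, ?_⟩
  have hmem : (∑ t, (C (c t) : F[X]) • monomial (J t) (X ^ I t)) %ₘ curvePoly p e g ∈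
      weightLT F p D (M + 1) := by
    rw [sum_modByMonic]
    refine Submodule.sum_mem _ fun t _ => ?_
    rw [smul_modByMonic]
    exact C_smul_mem_weightLT _ (weightLT_mono (Nat.succ_le_succ (hM t))
      (monomial_modByMonic_curvePoly_mem hp he hg (I t) (J t)))
  have hdeg := degree_modByMonic_lt
    (∑ t, (C (c t) : F[X]) • monomial (J t) (X ^ I t)) (curvePoly_monic (e := e) hp g)
  rw [curvePoly_degree hp] at hdeg
  ext j i
  rw [coeff_zero, coeff_zero]
  by_cases hj : p ≤ j
  · rw [coeff_eq_zero_of_degree_lt (hdeg.trans_le (by exact_mod_cast hj)), coeff_zero]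
  by_cases hi : M + 1 ≤ p * i + D * j
  · exact hmem i j hi
  have hx : (i, j) ∈ P := by
    simp only [P, Finset.mem_filter, Finset.mem_product, Finset.mem_range]
    refine ⟨⟨?_, by omega⟩, by omega⟩
    nlinarith
  have := congrFun (LinearMap.mem_ker.1 hc) ⟨(i, j), hx⟩
  simp only [Matrix.mulVecLin_apply, Matrix.mulVec, dotProduct, T, Matrix.of_apply,
    Pi.zero_apply] at this
  rw [sum_modByMonic, finsetSum_coeff, finsetSum_coeff, ← this]
  refine Finset.sum_congr rfl fun t _ => ?_
  rw [smul_modByMonic, coeff_smul, smul_eq_mul, coeff_C_mul, mul_comm]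

/-- Stepanov's bound: the number of abscissae over which the curve `w ^ p = y ^ e * w + g(y)` has
`p` rational points. -/
theorem mul_card_le_of_curve {F : Type*} [Field F] [Fintype F] [DecidableEq F] {p s D e : ℕ}
    [Fact p.Prime] [CharP F p] (hs : s ≠ 0) (hcard : Fintype.card F = (p ^ s) ^ 2)
    (hpD : Nat.Coprime p D) (he : p * e + D + 1 ≤ p * D) {g : F[X]} (hg : g.degree = D)
    (S : Finset F)
    (hS : ∀ y ∈ S, p ≤ (Finset.univ.filter fun w : F => w ^ p = y ^ e * w + g.eval y).card) :
    p * S.card ≤ (p ^ s) ^ 2 + (5 * (D * p) + 1) * p ^ s := by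
  have hp : 2 ≤ p := (Fact.out : p.Prime).two_le
  set r := p ^ s with hr
  set A := D * p with hA
  have hr2 : 2 ≤ r := hp.trans (Nat.le_self_pow hs p)
  choose it jt hjt hwt using fun k : ℕ =>
    exists_weight_eq (k := D * p + k) (by omega) hpD (Nat.le_add_right _ _)
  let ι := Fin r × Fin (r + (3 * A + 1))
  have hcι : Fintype.card ι = r * (r + (3 * A + 1)) := by simp [ι]
  have hbase : ∀ t : ι, (t.1 : ℕ) < r ∧ (t.2 : ℕ) < r + (3 * A + 1) := fun t => ⟨t.1.2, t.2.2⟩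
  obtain ⟨c, hc0, hc⟩ := exists_relation_of_weights_le (ι := ι) (F := F)
    (M := r * A + r ^ 2 + A + 3 * A) hp hpD he hg
    (fun t => r * it t.1 + it t.2) (fun t => r * jt t.1 + jt t.2) (by
      intro t
      have h1 : p * it t.1 + D * jt t.1 = A + t.1 := hwt t.1
      have h2 : p * it t.2 + D * jt t.2 = A + t.2 := hwt t.2
      obtain ⟨h3, h4⟩ := hbase t
      have : p * (r * it t.1 + it t.2) + D * (r * jt t.1 + jt t.2) =
        r * (A + t.1) + (A + t.2) := by rw [← h1, ← h2]; ring
      rw [this]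
      nlinarith) (by rw [hcι]; nlinarith)
  have hcr : (fun t => c t ^ r) ≠ 0 := by
    intro h
    apply hc0
    funext t
    exact eq_zero_of_pow_eq_zero (congrFun h t)
  have hwH : ∀ t : ι, p * (it t.1 + r * it t.2) + D * (jt t.1 + r * jt t.2) =
      (A + t.1) + r * (A + t.2) := by
    intro t
    have h1 : p * it t.1 + D * jt t.1 = A + t.1 := hwt t.1
    have h2 : p * it t.2 + D * jt t.2 = A + t.2 := hwt t.2
    rw [← h1, ← h2]; ring
  have hne := sum_modByMonic_ne_zero_of_weights_injective (ι := ι) hp he hg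
    (fun t => it t.1 + r * it t.2) (fun t => jt t.1 + r * jt t.2) (by
      intro t t' h
      simp only [hwH] at h
      have h3 := (hbase t).1
      have h3' := (hbase t').1
      have h5 : (t.1 : ℕ) + r * t.2 = t'.1 + r * t'.2 := by linarith
      have h6 : (t.1 : ℕ) = t'.1 := by
        have := congrArg (· % r) h5
        simpa [Nat.add_mul_mod_self_left, Nat.mod_eq_of_lt h3, Nat.mod_eq_of_lt h3'] using this
      have h7 : (t.2 : ℕ) = t'.2 := Nat.eq_of_mul_eq_mul_left (by omega : 0 < r) (by omega)
      exact Prod.ext (Fin.ext h6) (Fin.ext h7)) _ hcr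
  set H : F[X][X] := ∑ t : ι, (C (c t ^ r) : F[X]) •
    monomial (jt t.1 + r * jt t.2) (X ^ (it t.1 + r * it t.2)) with hH
  have hmem : H %ₘ curvePoly p e g ∈ weightLT F p D (r ^ 2 + (5 * A + 1) * r + 1) := by
    rw [hH, sum_modByMonic]
    refine Submodule.sum_mem _ fun t _ => ?_
    rw [smul_modByMonic]
    refine C_smul_mem_weightLT _ (weightLT_mono ?_
      (monomial_modByMonic_curvePoly_mem hp he hg _ _))
    rw [hwH]
    obtain ⟨h3, h4⟩ := hbase t
    nlinarith
  have hdeg := degree_modByMonic_lt H (curvePoly_monic (e := e) hp g)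
  rw [curvePoly_degree hp] at hdeg
  obtain ⟨j, hj⟩ : ∃ j, (H %ₘ curvePoly p e g).coeff j ≠ 0 := by
    by_contra! h
    exact hne (Polynomial.ext fun j => by simpa using h j)
  have hR : ∀ x : F, x ^ (r * r) = x := fun x => by
    rw [← pow_two, ← hcard, FiniteField.pow_card]
  have hexp : ∀ (x : F) (a b : ℕ), x ^ ((a + r * b) * r) = x ^ (r * a + b) := fun x a b => by
    rw [show (a + r * b) * r = r * a + r * r * b by ring, pow_add, pow_add, pow_mul x (r * r), hR]
  have hsum : ∀ f : ι → F, (∑ t, f t) ^ r = ∑ t, f t ^ r := fun f => sum_pow_char_pow p s _ f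
  have hvanish : ∀ y w : F, w ^ p = y ^ e * w + g.eval y → H.evalEval y w = 0 := by
    intro y w h
    have h1 := evalEval_modByMonic_curvePoly h
      (∑ t : ι, (C (c t) : F[X]) • monomial (r * jt t.1 + jt t.2) (X ^ (r * it t.1 + it t.2)))
    rw [hc] at h1
    apply eq_zero_of_pow_eq_zero (n := r)
    rw [hH, ← coe_evalEvalRingHom, map_sum, hsum]
    rw [evalEval_zero, ← coe_evalEvalRingHom, map_sum] at h1
    rw [h1]
    refine Finset.sum_congr rfl fun t _ => ?_
    simp only [← C_mul_X_pow_eq_monomial, smul_eq_C_mul, map_mul, map_pow, coe_evalEvalRingHom,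
      evalEval_C, evalEval_X, eval_C, eval_X]
    rw [mul_pow, mul_pow, ← pow_mul, hR, ← pow_mul, ← pow_mul, hexp, hexp]
  have hroot : ∀ y ∈ S, ((H %ₘ curvePoly p e g).coeff j).eval y = 0 := by
    intro y hy
    have hz : (H %ₘ curvePoly p e g).map (evalRingHom y) = 0 := by
      refine eq_zero_of_degree_lt_of_eval_finset_eq_zero
        (Finset.univ.filter fun w : F => w ^ p = y ^ e * w + g.eval y) ?_ ?_
      · exact (degree_map_le.trans_lt hdeg).trans_le (by exact_mod_cast hS y hy)
      · intro w hw
        have hw' := (Finset.mem_filter.1 hw).2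
        rw [← hvanish y w hw', ← evalEval_modByMonic_curvePoly hw',
          map_evalRingHom_eval]
    have := congrArg (fun f => coeff f j) hz
    simpa using this
  have hSj : S.card ≤ ((H %ₘ curvePoly p e g).coeff j).natDegree := by
    refine card_le_degree_of_subset_roots fun y hy => ?_
    exact (mem_roots hj).2 (hroot y hy)
  by_contra! hlt
  have h1 := hmem ((H %ₘ curvePoly p e g).coeff j).natDegree j (by nlinarith)
  exact hj (leadingCoeff_eq_zero.1 h1)

/-- If every fibre of `f` has at most `M` elements, a nontrivial additive character sum along `f`
is bounded by the total defect of the fibres. -/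
lemma norm_sum_addChar_le_of_card_fiber_le {A ι : Type*} [AddCommGroup A] [Fintype A]
    [DecidableEq A] {ψ : AddChar A ℂ} (hψ : ψ ≠ 1) (T : Finset ι) (f : ι → A) (M : ℝ)
    (hM : ∀ c, ((T.filter fun i => f i = c).card : ℝ) ≤ M) :
    ‖∑ i ∈ T, ψ (f i)‖ ≤ Fintype.card A * M - T.card := by
  have h1 : ∑ i ∈ T, ψ (f i) = ∑ c, (((T.filter fun i => f i = c).card : ℂ) - M) * ψ c := by
    simp only [sub_mul, Finset.sum_sub_distrib, ← Finset.mul_sum,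
      AddChar.sum_eq_zero_of_ne_one hψ, mul_zero, sub_zero]
    rw [← Finset.sum_fiberwise T f]
    refine Finset.sum_congr rfl fun c _ => ?_
    rw [Finset.sum_congr rfl fun i hi => by rw [(Finset.mem_filter.mp hi).2],
      Finset.sum_const, nsmul_eq_mul]
  have h2 : (T.card : ℝ) = ∑ c, ((T.filter fun i => f i = c).card : ℝ) := by
    exact_mod_cast Finset.card_eq_sum_card_fiberwise (f := f) (s := T) (t := Finset.univ)
      fun _ _ => Finset.mem_coe.2 (Finset.mem_univ _)
  rw [h1]
  refine (norm_sum_le _ _).trans ?_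
  have h3 : ∀ c ∈ (Finset.univ : Finset A),
      ‖(((T.filter fun i => f i = c).card : ℂ) - M) * ψ c‖
        ≤ M - ((T.filter fun i => f i = c).card : ℝ) := by
    intro c _
    rw [norm_mul, AddChar.norm_apply, mul_one]
    have : (((T.filter fun i => f i = c).card : ℂ) - M)
        = (((T.filter fun i => f i = c).card - M : ℝ) : ℂ) := by push_cast; ring
    rw [this, Complex.norm_real, Real.norm_eq_abs, abs_of_nonpos (by linarith [hM c])]
    linarith
  refine (Finset.sum_le_sum h3).trans ?_
  rw [Finset.sum_sub_distrib, ← h2, Finset.sum_const, nsmul_eq_mul, Finset.card_univ]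

section ArtinSchreier

variable {F : Type*} [Field F] [Fintype F] [DecidableEq F] {p : ℕ} [Fact p.Prime]

lemma card_filter_artinSchreier_le (u : F) :
    (Finset.univ.filter fun z : F => z ^ p - z = u).card ≤ p := by
  have hp1 : 1 < p := (Fact.out : p.Prime).one_lt
  have hdeg : (X ^ p - X - C u : F[X]).natDegree = p := by
    rw [natDegree_sub_C, FiniteField.X_pow_card_sub_X_natDegree_eq F hp1]
  have hne : (X ^ p - X - C u : F[X]) ≠ 0 := by
    intro h
    rw [h, natDegree_zero] at hdeg
    omega
  calc (Finset.univ.filter fun z : F => z ^ p - z = u).card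
      ≤ (X ^ p - X - C u : F[X]).roots.toFinset.card := by
        refine Finset.card_le_card fun z hz => ?_
        simp only [Finset.mem_filter, Finset.mem_univ, true_and] at hz
        simp [hne, hz]
    _ ≤ (X ^ p - X - C u : F[X]).roots.card := Multiset.toFinset_card_le _
    _ ≤ p := by
      have := card_roots' (X ^ p - X - C u : F[X])
      omega

variable [CharP F p]

lemma le_card_filter_artinSchreier {u z₀ : F} (hz : z₀ ^ p - z₀ = u) :
    p ≤ (Finset.univ.filter fun z : F => z ^ p - z = u).card := by
  let := ZMod.algebra F p
  have hinj : Function.Injective fun c : ZMod p => z₀ + algebraMap (ZMod p) F c :=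
    (add_right_injective z₀).comp (algebraMap (ZMod p) F).injective
  calc p = (Finset.univ.image fun c : ZMod p => z₀ + algebraMap (ZMod p) F c).card := by
        rw [Finset.card_image_of_injective _ hinj, Finset.card_univ, ZMod.card]
    _ ≤ _ := by
      refine Finset.card_le_card fun z hz' => ?_
      obtain ⟨c, -, rfl⟩ := Finset.mem_image.mp hz'
      simp only [Finset.mem_filter, Finset.mem_univ, true_and]
      rw [add_pow_char, ← map_pow, ZMod.pow_card, ← hz]
      ring

/-- Stepanov's bound, in the form of a point count on the Artin–Schreier curve
`z ^ p - z = a y ^ d + b y ^ (-d) - c`. -/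
lemma card_artinSchreier_kloosterman_le {s d : ℕ} (hs : s ≠ 0)
    (hcard : Fintype.card F = (p ^ s) ^ 2) (hd : Nat.Coprime p d) {a : F} (b c : F) (ha : a ≠ 0) :
    (((Finset.univ.filter fun y : F => y ≠ 0) ×ˢ Finset.univ).filter fun t : F × F =>
      a * t.1 ^ d + b * (t.1 ^ d)⁻¹ - (t.2 ^ p - t.2) = c).card
      ≤ (p ^ s) ^ 2 + (5 * (d * (p + 1) * p) + 1) * p ^ s := by
  have hp2 : 2 ≤ p := (Fact.out : p.Prime).two_le
  have hd0 : 0 < d := by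
    rcases Nat.eq_zero_or_pos d with rfl | h
    · simp only [Nat.coprime_zero_right] at hd
      omega
    · exact h
  set v : F → F := fun y => a * y ^ d + b * (y ^ d)⁻¹ with hv
  set S : Finset F := Finset.univ.filter fun y => y ≠ 0 ∧ ∃ z : F, z ^ p - z = v y - c with hSdef
  set g : F[X] := C a * X ^ (d * (p + 1)) + (C b * X ^ (d * (p - 1)) - C c * X ^ (d * p)) with hg
  have hgdeg : g.degree = (d * (p + 1) : ℕ) := by
    have h1 : (C a * X ^ (d * (p + 1)) : F[X]).degree = (d * (p + 1) : ℕ) :=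
      degree_C_mul_X_pow _ ha
    rw [hg, degree_add_eq_left_of_degree_lt, h1]
    rw [h1]
    refine (degree_sub_le _ _).trans_lt (max_lt ?_ ?_)
    · refine (degree_C_mul_X_pow_le _ _).trans_lt ?_
      exact_mod_cast Nat.mul_lt_mul_of_pos_left (by omega) hd0
    · refine (degree_C_mul_X_pow_le _ _).trans_lt ?_
      exact_mod_cast Nat.mul_lt_mul_of_pos_left (by omega) hd0
  have hcop : Nat.Coprime p (d * (p + 1)) := hd.mul_right (by simp)
  have he : p * (d * (p - 1)) + d * (p + 1) + 1 ≤ p * (d * (p + 1)) := by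
    obtain ⟨k, rfl⟩ := Nat.exists_eq_add_of_le hp2
    have : 2 + k - 1 = k + 1 := by omega
    rw [this]
    nlinarith [Nat.mul_pos hd0 hd0]
  have hS : ∀ y ∈ S, p ≤ (Finset.univ.filter fun w : F =>
      w ^ p = y ^ (d * (p - 1)) * w + g.eval y).card := by
    intro y hy
    simp only [hSdef, Finset.mem_filter, Finset.mem_univ, true_and] at hy
    obtain ⟨hy0, z₀, hz₀⟩ := hy
    have hyd : y ^ d ≠ 0 := pow_ne_zero _ hy0
    refine (le_card_filter_artinSchreier hz₀).trans ?_
    refine Finset.card_le_card_of_injOn (fun z => y ^ d * z) ?_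
      ((mul_right_injective₀ hyd).injOn)
    intro z hz
    simp only [Finset.coe_filter, Finset.mem_univ, true_and, Set.mem_ofPred_eq] at hz ⊢
    have hzp : z ^ p = z + (v y - c) := by rw [← hz]; ring
    obtain ⟨k, rfl⟩ := Nat.exists_eq_add_of_le' (show 1 ≤ p by omega)
    simp only [hg, eval_add, eval_sub, eval_mul, eval_C, eval_pow, eval_X, mul_pow, hzp, hv,
      Nat.add_sub_cancel, pow_mul]
    field_simp
    ring
  have hmain := mul_card_le_of_curve hs hcard hcop he hgdeg S hS
  refine le_trans ?_ hmain
  rw [mul_comm p]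
  have hmaps : Set.MapsTo Prod.fst
      ((((Finset.univ.filter fun y : F => y ≠ 0) ×ˢ Finset.univ).filter fun t : F × F =>
      v t.1 - (t.2 ^ p - t.2) = c : Finset (F × F)) : Set (F × F)) (S : Set F) := by
    intro t ht
    simp only [Finset.coe_filter, Finset.mem_product, Finset.mem_filter, Finset.mem_univ,
      true_and, and_true, Set.mem_ofPred_eq, hSdef] at ht ⊢
    exact ⟨ht.1, t.2, by rw [← ht.2]; ring⟩
  rw [Finset.card_eq_sum_card_fiberwise hmaps, ← smul_eq_mul]
  refine Finset.sum_le_card_nsmul _ _ _ fun y _ => ?_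
  refine le_trans ?_ (card_filter_artinSchreier_le (v y - c))
  refine Finset.card_le_card_of_injOn Prod.snd ?_ ?_
  · intro t ht
    simp only [Finset.coe_filter, Finset.mem_product, Finset.mem_filter, Finset.mem_univ,
      true_and, and_true, Set.mem_ofPred_eq] at ht ⊢
    rw [← ht.2, ← ht.1.2]
    ring
  · intro t ht t' ht' h
    simp only [Finset.coe_filter, Set.mem_ofPred_eq] at ht ht'
    exact Prod.ext (ht.2.trans ht'.2.symm) h

lemma norm_sum_addChar_pow_le {s d : ℕ} (hs : s ≠ 0)
    (hcard : Fintype.card F = (p ^ s) ^ 2) (hd : Nat.Coprime p d) {ψ : AddChar F ℂ} (hψ : ψ ≠ 1)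
    (hfrob : ∀ z, ψ (z ^ p) = ψ z) {a : F} (b : F) (ha : a ≠ 0) :
    ‖∑ y ∈ Finset.univ.filter fun y : F => y ≠ 0, ψ (a * y ^ d + b * (y ^ d)⁻¹)‖
      ≤ (5 * (d * (p + 1) * p) + 1) * p ^ s + 1 := by
  set Y := Finset.univ.filter fun y : F => y ≠ 0 with hY
  have hYcard : (Y.card : ℝ) = (p ^ s) ^ 2 - 1 := by
    rw [hY, Finset.filter_ne' Finset.univ (0 : F), Finset.card_erase_of_mem (Finset.mem_univ _),
      Finset.card_univ, hcard, Nat.cast_sub (Nat.one_le_pow _ _ (pow_pos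
        (Fact.out : p.Prime).pos _))]
    push_cast
    ring
  have h := norm_sum_addChar_le_of_card_fiber_le hψ (Y ×ˢ (Finset.univ : Finset F))
    (fun t => a * t.1 ^ d + b * (t.1 ^ d)⁻¹ - (t.2 ^ p - t.2))
    (((p ^ s) ^ 2 + (5 * (d * (p + 1) * p) + 1) * p ^ s : ℕ) : ℝ)
    (fun c => by exact_mod_cast card_artinSchreier_kloosterman_le hs hcard hd b c ha)
  have hsum : ∑ t ∈ Y ×ˢ (Finset.univ : Finset F),
      ψ (a * t.1 ^ d + b * (t.1 ^ d)⁻¹ - (t.2 ^ p - t.2))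
      = ((p : ℂ) ^ s) ^ 2 * ∑ y ∈ Y, ψ (a * y ^ d + b * (y ^ d)⁻¹) := by
    rw [Finset.sum_product, Finset.mul_sum]
    refine Finset.sum_congr rfl fun y _ => ?_
    have : ∀ z : F, ψ (a * y ^ d + b * (y ^ d)⁻¹ - (z ^ p - z))
        = ψ (a * y ^ d + b * (y ^ d)⁻¹) := by
      intro z
      have h1 : ψ (z ^ p - z) = 1 := by
        rw [AddChar.map_sub_eq_div, hfrob,
          div_self (norm_ne_zero_iff.mp (by rw [AddChar.norm_apply]; exact one_ne_zero))]
      rw [AddChar.map_sub_eq_div, h1, div_one]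
    simp only [this, Finset.sum_const, Finset.card_univ, hcard, nsmul_eq_mul]
    push_cast
    ring
  rw [hsum, norm_mul, Finset.card_product, Nat.cast_mul, hYcard, Finset.card_univ, hcard] at h
  have hpos : (0 : ℝ) < ((p : ℝ) ^ s) ^ 2 :=
    pow_pos (pow_pos (by exact_mod_cast (Fact.out : p.Prime).pos) _) _
  have hnorm : ‖((p : ℂ) ^ s) ^ 2‖ = ((p : ℝ) ^ s) ^ 2 := by simp
  rw [hnorm] at h
  push_cast at h
  refine le_of_mul_le_mul_left (h.trans (le_of_eq ?_)) hpos
  ring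

end ArtinSchreier

/-- The twisted Kloosterman sum `∑ χ(x) ψ(a x + b / x)`. -/
def kloostermanSum {F : Type*} [Field F] [Fintype F] (χ : F →* ℂ) (ψ : AddChar F ℂ) (a b : F) : ℂ :=
  ∑ x : F, χ x * ψ (a * x + b * x⁻¹)

lemma norm_monoidHom_le_one {F : Type*} [Field F] [Fintype F] {χ : F →* ℂ} (hχ : χ 0 = 0)
    (x : F) : ‖χ x‖ ≤ 1 := by
  rcases eq_or_ne x 0 with rfl | hx
  · simp [hχ]
  · have h : χ x ^ (Fintype.card F - 1) = 1 := by
      rw [← map_pow, FiniteField.pow_card_sub_one_eq_one x hx, map_one]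
    exact (Complex.norm_eq_one_of_pow_eq_one h
      (Nat.sub_ne_zero_of_lt Fintype.one_lt_card)).le

lemma norm_kloostermanSum_le_of_card_eq_sq {F : Type*} [Field F] [Fintype F] {p : ℕ}
    [Fact p.Prime] [CharP F p] {s d : ℕ} (hs : s ≠ 0)
    (hcard : Fintype.card F = (p ^ s) ^ 2) (hd : Nat.Coprime p d) {ψ : AddChar F ℂ} (hψ : ψ ≠ 1)
    (hfrob : ∀ z, ψ (z ^ p) = ψ z) {χ : F →* ℂ} (hχ : χ 0 = 0)
    (hχd : ∀ x, x ≠ 0 → χ x ^ d = 1) {a : F} (b : F) (ha : a ≠ 0) :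
    ‖kloostermanSum χ ψ a b‖ ≤ (5 * (d * (p + 1) * p) + 1) * p ^ s + 1 := by
  classical
  set Y := Finset.univ.filter fun y : F => y ≠ 0 with hY
  have hYpos : (0 : ℝ) < Y.card := by
    exact_mod_cast Finset.card_pos.mpr ⟨1, by simp [hY]⟩
  have hswap : ∑ g ∈ Y, χ g * ∑ y ∈ Y, ψ (a * g * y ^ d + b * g⁻¹ * (y ^ d)⁻¹)
      = Y.card * kloostermanSum χ ψ a b := by
    simp only [Finset.mul_sum]
    rw [Finset.sum_comm, ← nsmul_eq_mul]
    refine Finset.sum_eq_card_nsmul fun y hy => ?_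
    have hy0 : y ≠ 0 := (Finset.mem_filter.mp hy).2
    have hyd : y ^ d ≠ 0 := pow_ne_zero d hy0
    have hK : kloostermanSum χ ψ a b = ∑ x ∈ Y, χ x * ψ (a * x + b * x⁻¹) := by
      refine (Finset.sum_subset (Finset.subset_univ _) fun x _ hx => ?_).symm
      have : x = 0 := by simpa [hY] using hx
      simp [this, hχ]
    rw [hK]
    refine Finset.sum_bij' (fun g _ => g * y ^ d) (fun x _ => x * (y ^ d)⁻¹) ?_ ?_ ?_ ?_ ?_
    · intro g hg
      simp only [hY, Finset.mem_filter, Finset.mem_univ, true_and] at hg ⊢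
      exact mul_ne_zero hg hyd
    · intro g hg
      simp only [hY, Finset.mem_filter, Finset.mem_univ, true_and] at hg ⊢
      exact mul_ne_zero hg (inv_ne_zero hyd)
    · intro g _
      exact mul_inv_cancel_right₀ hyd g
    · intro g _
      exact inv_mul_cancel_right₀ hyd g
    · intro g _
      rw [map_mul, map_pow, hχd y hy0, mul_one, mul_inv]
      congr 2
      ring
  have hbound : ‖∑ g ∈ Y, χ g * ∑ y ∈ Y, ψ (a * g * y ^ d + b * g⁻¹ * (y ^ d)⁻¹)‖
      ≤ Y.card * ((5 * (d * (p + 1) * p) + 1) * p ^ s + 1) := by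
    rw [← nsmul_eq_mul]
    refine (norm_sum_le _ _).trans (Finset.sum_le_card_nsmul _ _ _ fun g hg => ?_)
    rw [norm_mul]
    have hg0 : g ≠ 0 := (Finset.mem_filter.mp hg).2
    calc _ ≤ 1 * ‖∑ y ∈ Y, ψ (a * g * y ^ d + b * g⁻¹ * (y ^ d)⁻¹)‖ :=
          mul_le_mul_of_nonneg_right (norm_monoidHom_le_one hχ g) (norm_nonneg _)
      _ ≤ _ := by
        rw [one_mul]
        exact norm_sum_addChar_pow_le hs hcard hd hψ hfrob _ (mul_ne_zero ha hg0)
  rw [hswap, norm_mul, Complex.norm_natCast] at hbound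
  exact le_of_mul_le_mul_left hbound hYpos

section Quadratic

variable {F E : Type*} [Field F] [Field E] [Fintype F] [Fintype E] [Algebra F E]

lemma algebraMap_trace_of_finrank_two (h2 : Module.finrank F E = 2) (z : E) :
    algebraMap F E (Algebra.trace F E z) = z + z ^ Fintype.card F := by
  rw [FiniteField.algebraMap_trace_eq_sum_pow, h2]
  simp [Finset.sum_range_succ]

lemma algebraMap_norm_of_finrank_two (h2 : Module.finrank F E = 2) (z : E) :
    algebraMap F E (Algebra.norm F z) = z * z ^ Fintype.card F := by
  rw [FiniteField.algebraMap_norm_eq_prod_pow, h2]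
  simp [Finset.prod_range_succ]

lemma trace_inv_of_finrank_two (h2 : Module.finrank F E = 2) {z : E} (hz : z ≠ 0) :
    Algebra.trace F E z⁻¹ = Algebra.trace F E z * (Algebra.norm F z)⁻¹ := by
  apply (algebraMap F E).injective
  rw [map_mul, map_inv₀ (algebraMap F E), algebraMap_trace_of_finrank_two h2,
      algebraMap_trace_of_finrank_two h2,
    algebraMap_norm_of_finrank_two h2, inv_pow]
  have : z ^ Fintype.card F ≠ 0 := pow_ne_zero _ hz
  field_simp
  ring

lemma eq_or_eq_of_add_eq_of_mul_eq {R : Type*} [Field R] {x y z s t : R} (hs : x + y = s)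
    (ht : x * y = t) (hz : z ^ 2 - s * z + t = 0) : z = x ∨ z = y := by
  have : (z - x) * (z - y) = 0 := by rw [← hz, ← hs, ← ht]; ring
  rcases mul_eq_zero.mp this with h | h
  · exact Or.inl (sub_eq_zero.mp h)
  · exact Or.inr (sub_eq_zero.mp h)

/-- Pairs in the split quadratic algebra and elements of the quadratic field with prescribed trace
and norm number at most two together. -/
lemma card_trace_norm_le_two [DecidableEq F] (h2 : Module.finrank F E = 2) (s t : F) :
    (Finset.univ.filter fun x : F × F => (x.1 + x.2, x.1 * x.2) = (s, t)).card
      + (Finset.univ.filter fun z : E => (Algebra.trace F E z, Algebra.norm F z) = (s, t)).card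
      ≤ 2 := by
  classical
  set N₁ := Finset.univ.filter fun x : F × F => (x.1 + x.2, x.1 * x.2) = (s, t) with hN₁
  set N₂ := Finset.univ.filter fun z : E => (Algebra.trace F E z, Algebra.norm F z) = (s, t)
    with hN₂
  have hroot : ∀ z ∈ N₂, z + z ^ Fintype.card F = algebraMap F E s ∧
      z * z ^ Fintype.card F = algebraMap F E t := by
    intro z hz
    simp only [hN₂, Finset.mem_filter, Finset.mem_univ, true_and, Prod.mk.injEq] at hz
    rw [← algebraMap_trace_of_finrank_two h2, ← algebraMap_norm_of_finrank_two h2, hz.1, hz.2]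
    exact ⟨rfl, rfl⟩
  have hquad : ∀ z ∈ N₂, z ^ 2 - algebraMap F E s * z + algebraMap F E t = 0 := by
    intro z hz
    rw [← (hroot z hz).1, ← (hroot z hz).2]
    ring
  rcases N₁.eq_empty_or_nonempty with h0 | ⟨⟨x, y⟩, hxy⟩
  · rw [h0, Finset.card_empty, zero_add]
    rcases N₂.eq_empty_or_nonempty with h0' | ⟨z, hz⟩
    · simp [h0']
    · have hsub : N₂ ⊆ {z, z ^ Fintype.card F} := by
        intro w hw
        rw [Finset.mem_insert, Finset.mem_singleton]
        exact eq_or_eq_of_add_eq_of_mul_eq (hroot z hz).1 (hroot z hz).2 (hquad w hw)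
      exact (Finset.card_le_card hsub).trans Finset.card_le_two
  · simp only [hN₁, Finset.mem_filter, Finset.mem_univ, true_and, Prod.mk.injEq] at hxy
    have hsub₁ : N₁ ⊆ {(x, y), (y, x)} := by
      rintro ⟨x', y'⟩ h
      simp only [hN₁, Finset.mem_filter, Finset.mem_univ, true_and, Prod.mk.injEq] at h
      have hq : x' ^ 2 - s * x' + t = 0 := by rw [← h.1, ← h.2]; ring
      rw [Finset.mem_insert, Finset.mem_singleton, Prod.mk.injEq, Prod.mk.injEq]
      rcases eq_or_eq_of_add_eq_of_mul_eq hxy.1 hxy.2 hq with rfl | rfl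
      · exact Or.inl ⟨rfl, add_left_cancel (h.1.trans hxy.1.symm)⟩
      · refine Or.inr ⟨rfl, ?_⟩
        have := h.1.trans hxy.1.symm
        linear_combination this
    have hsub₂ : ∀ z ∈ N₂, x = y ∧ z = algebraMap F E x := by
      intro z hz
      have hfix : ∀ w : F, z = algebraMap F E w → w + w = s := by
        rintro w rfl
        have := (hroot _ hz).1
        rw [← map_pow, FiniteField.pow_card, ← map_add] at this
        exact (algebraMap F E).injective this
      have hx : algebraMap F E x + algebraMap F E y = algebraMap F E s := by
        rw [← map_add, hxy.1]
      have hy : algebraMap F E x * algebraMap F E y = algebraMap F E t := by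
        rw [← map_mul, hxy.2]
      rcases eq_or_eq_of_add_eq_of_mul_eq hx hy (hquad z hz) with h | h
      · have hw := hfix x h
        exact ⟨add_left_cancel (hw.trans hxy.1.symm), h⟩
      · have hw := hfix y h
        have hxy' : x = y := by linear_combination hxy.1 - hw
        exact ⟨hxy', by rw [hxy', h]⟩
    by_cases hxy' : x = y
    · have h1 : N₁.card ≤ 1 := by
        refine (Finset.card_le_card hsub₁).trans ?_
        simp [hxy']
      have h2 : N₂.card ≤ 1 := by
        refine Finset.card_le_one.mpr fun z hz w hw => ?_
        rw [(hsub₂ z hz).2, (hsub₂ w hw).2]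
      omega
    · have h2 : N₂ = ∅ := Finset.eq_empty_of_forall_notMem fun z hz => hxy' (hsub₂ z hz).1
      rw [h2, Finset.card_empty, add_zero]
      exact (Finset.card_le_card hsub₁).trans Finset.card_le_two

lemma card_trace_norm_eq_two [DecidableEq F] (h2 : Module.finrank F E = 2) (s t : F) :
    (Finset.univ.filter fun x : F × F => (x.1 + x.2, x.1 * x.2) = (s, t)).card
      + (Finset.univ.filter fun z : E => (Algebra.trace F E z, Algebra.norm F z) = (s, t)).card
      = 2 := by
  have h1 : ∑ u : F × F, (Finset.univ.filter fun x : F × F => (x.1 + x.2, x.1 * x.2) = u).card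
      = Fintype.card F ^ 2 := by
    rw [← Finset.card_eq_sum_card_fiberwise (fun _ _ => by simp), Finset.card_univ,
      Fintype.card_prod, sq]
  have h2' : ∑ u : F × F, (Finset.univ.filter fun z : E =>
      (Algebra.trace F E z, Algebra.norm F z) = u).card = Fintype.card F ^ 2 := by
    rw [← Finset.card_eq_sum_card_fiberwise (fun _ _ => by simp), Finset.card_univ,
      ← h2, Module.card_eq_pow_finrank (K := F) (V := E)]
  have hsum : ∑ u : F × F,
      ((Finset.univ.filter fun x : F × F => (x.1 + x.2, x.1 * x.2) = u).card
      + (Finset.univ.filter fun z : E => (Algebra.trace F E z, Algebra.norm F z) = u).card)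
      = ∑ _u : F × F, 2 := by
    rw [Finset.sum_add_distrib, h1, h2', Finset.sum_const, Finset.card_univ, Fintype.card_prod,
      smul_eq_mul]
    ring
  exact (Finset.sum_eq_sum_iff_of_le fun u _ => card_trace_norm_le_two h2 u.1 u.2).mp hsum (s, t)
    (Finset.mem_univ _)

theorem norm_kloostermanSum_sq_le (h2 : Module.finrank F E = 2) {ψ : AddChar F ℂ} (hψ : ψ ≠ 1)
    {χ : F →* ℂ} (hχ : χ 0 = 0) {a b : F} (ha : a ≠ 0) :
    ‖kloostermanSum χ ψ a b‖ ^ 2 ≤ ‖kloostermanSum (χ.comp (Algebra.norm F))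
      (ψ.compAddMonoidHom (Algebra.trace F E).toAddMonoidHom) (algebraMap F E a)
        (algebraMap F E b)‖ + 2 * Fintype.card F := by
  classical
  set f : F × F → ℂ := fun u => χ u.2 * ψ (a * u.1 + b * (u.1 * u.2⁻¹)) with hf
  have hK : kloostermanSum χ ψ a b ^ 2 = ∑ x : F × F, f (x.1 + x.2, x.1 * x.2) := by
    rw [sq, kloostermanSum, Finset.sum_mul_sum, Fintype.sum_prod_type]
    refine Finset.sum_congr rfl fun x _ => Finset.sum_congr rfl fun y _ => ?_
    rcases eq_or_ne x 0 with rfl | hx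
    · simp [hf, hχ]
    rcases eq_or_ne y 0 with rfl | hy
    · simp [hf, hχ]
    simp only [hf]
    rw [map_mul, mul_mul_mul_comm, ← AddChar.map_add_eq_mul]
    congr 2
    field_simp
    ring
  have hKE : kloostermanSum (χ.comp (Algebra.norm F))
      (ψ.compAddMonoidHom (Algebra.trace F E).toAddMonoidHom) (algebraMap F E a)
        (algebraMap F E b) = ∑ z : E, f (Algebra.trace F E z, Algebra.norm F z) := by
    refine Finset.sum_congr rfl fun z _ => ?_
    have : FiniteDimensional F E := Module.finite_of_finrank_eq_succ h2
    rcases eq_or_ne z 0 with rfl | hz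
    · simp [hf, hχ, Algebra.norm_zero]
    simp only [hf, MonoidHom.comp_apply, AddChar.compAddMonoidHom_apply,
      LinearMap.toAddMonoidHom_coe, map_add]
    rw [← Algebra.smul_def, ← Algebra.smul_def, map_smul, map_smul, smul_eq_mul, smul_eq_mul,
      trace_inv_of_finrank_two h2 hz]
  have htotal : ∑ x : F × F, f (x.1 + x.2, x.1 * x.2)
      + ∑ z : E, f (Algebra.trace F E z, Algebra.norm F z) = 2 * ∑ u, f u := by
    rw [← Finset.sum_fiberwise Finset.univ (fun x : F × F => (x.1 + x.2, x.1 * x.2)),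
      ← Finset.sum_fiberwise Finset.univ (fun z : E => (Algebra.trace F E z, Algebra.norm F z)),
      ← Finset.sum_add_distrib, Finset.mul_sum]
    refine Finset.sum_congr rfl fun u _ => ?_
    rw [Finset.sum_congr rfl fun i hi => by rw [(Finset.mem_filter.mp hi).2],
      Finset.sum_congr (s₁ := Finset.univ.filter fun z : E => _) rfl
        fun i hi => by rw [(Finset.mem_filter.mp hi).2],
      Finset.sum_const, Finset.sum_const, ← add_smul, card_trace_norm_eq_two h2 u.1 u.2]
    simp
  have hf_sum : ‖∑ u, f u‖ ≤ Fintype.card F := by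
    rw [Fintype.sum_prod_type_right]
    have hprim := AddChar.IsPrimitive.of_ne_one hψ
    have hin : ∀ t : F, ∑ s : F, f (s, t) = if t = -b / a then χ t * Fintype.card F else 0 := by
      intro t
      rcases eq_or_ne t 0 with rfl | ht
      · simp [hf, hχ]
      have h1 : ∀ s : F, f (s, t) = χ t * ψ (s * (a + b * t⁻¹)) := by
        intro s
        simp only [hf]
        congr 2
        ring
      simp only [h1, ← Finset.mul_sum]
      rw [AddChar.sum_mulShift _ hprim]
      have h3 : a + b * t⁻¹ = 0 ↔ t = -b / a := by
        constructor
        · intro h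
          field_simp at h ⊢
          linear_combination h
        · rintro rfl
          have hb : b ≠ 0 := by
            rintro rfl
            simp at ht
          field_simp
          ring
      simp only [h3]
      split_ifs <;> simp
    simp only [hin, Finset.sum_ite_eq', Finset.mem_univ, if_true]
    rw [norm_mul, Complex.norm_natCast]
    exact mul_le_of_le_one_left (Nat.cast_nonneg _) (norm_monoidHom_le_one hχ _)
  rw [← hK, ← hKE] at htotal
  rw [← norm_pow, eq_sub_of_add_eq htotal]
  refine (norm_sub_le _ _).trans ?_
  rw [norm_mul, Complex.norm_ofNat]
  linarith

end Quadratic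

/-- The data of a twisted Kloosterman sum can be lifted to the quadratic extension. -/
lemma exists_quadratic_lift_kloostermanSum {F : Type*} [Field F] [Fintype F] {p : ℕ}
    [Fact p.Prime] [CharP F p] {d : ℕ} {ψ : AddChar F ℂ} (hψ : ψ ≠ 1)
    (hfrob : ∀ z, ψ (z ^ p) = ψ z) {χ : F →* ℂ} (hχ : χ 0 = 0)
    (hχd : ∀ x, x ≠ 0 → χ x ^ d = 1) {a : F} (b : F) (ha : a ≠ 0) :
    ∃ (E : Type) (_ : Field E) (_ : Fintype E) (_ : CharP E p) (ψ' : AddChar E ℂ) (χ' : E →* ℂ)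
      (a' b' : E), Fintype.card E = Fintype.card F ^ 2 ∧ ψ' ≠ 1 ∧ (∀ z, ψ' (z ^ p) = ψ' z) ∧
      χ' 0 = 0 ∧ (∀ x, x ≠ 0 → χ' x ^ d = 1) ∧ a' ≠ 0 ∧
      ‖kloostermanSum χ ψ a b‖ ^ 2 ≤ ‖kloostermanSum χ' ψ' a' b'‖ + 2 * Fintype.card F := by
  let E := FiniteField.Extension F p 2
  let _ : Fintype E := Fintype.ofFinite E
  have h2 : Module.finrank F E = 2 := FiniteField.finrank_extension F p 2
  have hchar : CharP E p := charP_of_injective_algebraMap (algebraMap F E).injective p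
  refine ⟨E, inferInstance, inferInstance, hchar,
    ψ.compAddMonoidHom (Algebra.trace F E).toAddMonoidHom, χ.comp (Algebra.norm F),
    algebraMap F E a, algebraMap F E b, ?_, ?_, ?_, ?_, ?_, ?_,
    norm_kloostermanSum_sq_le h2 hψ hχ ha⟩
  · rw [Module.card_eq_pow_finrank (K := F) (V := E), h2]
  · intro h
    apply hψ
    ext x
    obtain ⟨z, rfl⟩ := Algebra.trace_surjective F E x
    exact DFunLike.congr_fun h z
  · intro z
    have : Algebra.trace F E (z ^ p) = Algebra.trace F E z ^ p := by
      apply (algebraMap F E).injective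
      rw [map_pow (algebraMap F E), algebraMap_trace_of_finrank_two h2,
      algebraMap_trace_of_finrank_two h2,
        add_pow_char, pow_right_comm]
    simp only [AddChar.compAddMonoidHom_apply, LinearMap.toAddMonoidHom_coe, this, hfrob]
  · simp [Algebra.norm_zero, hχ]
  · intro x hx
    exact hχd _ (Algebra.norm_ne_zero_iff.mpr hx)
  · simpa using ha

lemma norm_kloostermanSum_le_add_div_four_pow {p d : ℕ} [Fact p.Prime] (hd : Nat.Coprime p d)
    (k : ℕ) : ∀ (F : Type) [Field F] [Fintype F] [CharP F p] (s : ℕ) (_ : s ≠ 0)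
    (_ : Fintype.card F = (p ^ s) ^ 2) (ψ : AddChar F ℂ) (_ : ψ ≠ 1)
    (_ : ∀ z, ψ (z ^ p) = ψ z) (χ : F →* ℂ) (_ : χ 0 = 0)
    (_ : ∀ x, x ≠ 0 → χ x ^ d = 1) (a b : F) (_ : a ≠ 0),
    ‖kloostermanSum χ ψ a b‖ ≤ (2 + (5 * (d * (p + 1) * p) + 1 + 1) / 4 ^ k) * p ^ s := by
  induction k with
  | zero =>
    intro F _ _ _ s hs hcard ψ hψ hfrob χ hχ hχd a b ha
    refine (norm_kloostermanSum_le_of_card_eq_sq hs hcard hd hψ hfrob hχ hχd b ha).trans ?_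
    have h1 : (1 : ℝ) ≤ (p : ℝ) ^ s :=
      one_le_pow₀ (by exact_mod_cast (Fact.out : p.Prime).one_le)
    rw [pow_zero, div_one]
    nlinarith
  | succ k ih =>
    intro F _ _ _ s hs hcard ψ hψ hfrob χ hχ hχd a b ha
    obtain ⟨E, _, _, _, ψ', χ', a', b', hcard', hψ', hfrob', hχ', hχd', ha', h⟩ :=
      exists_quadratic_lift_kloostermanSum hψ hfrob hχ hχd b ha
    have hE : Fintype.card E = (p ^ (2 * s)) ^ 2 := by
      rw [hcard', hcard, mul_comm, pow_mul]
    have h' := ih E (2 * s) (by omega) hE ψ' hψ' hfrob' χ' hχ' hχd' a' b' ha'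
    rw [hcard] at h
    refine le_of_sq_le_sq ?_ (by positivity)
    set c : ℝ := 5 * (d * (p + 1) * p) + 1 + 1 with hc
    have hps : (p : ℝ) ^ (2 * s) = ((p : ℝ) ^ s) ^ 2 := by rw [mul_comm, pow_mul]
    rw [hps] at h'
    push_cast at h
    have hexp : ((2 + c / 4 ^ (k + 1)) * (p : ℝ) ^ s) ^ 2
        = (4 + c / 4 ^ k + (c / 4 ^ (k + 1)) ^ 2) * ((p : ℝ) ^ s) ^ 2 := by
      rw [pow_succ (4 : ℝ) k]
      field_simp
      ring
    rw [hexp]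
    nlinarith [sq_nonneg (c / 4 ^ (k + 1) * (p : ℝ) ^ s)]

/-- **Weil's bound** for twisted Kloosterman sums and Gauss sums, for a Frobenius-invariant
additive character. -/
theorem norm_kloostermanSum_le {F : Type*} [Field F] [Fintype F] {p : ℕ} [Fact p.Prime]
    [CharP F p] {ψ : AddChar F ℂ} (hψ : ψ ≠ 1) (hfrob : ∀ z, ψ (z ^ p) = ψ z) {χ : F →* ℂ}
    (hχ : χ 0 = 0) {a : F} (b : F) (ha : a ≠ 0) :
    ‖kloostermanSum χ ψ a b‖ ≤ 2 * Real.sqrt (Fintype.card F) := by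
  set d := Fintype.card F - 1 with hdef
  obtain ⟨s, hp, hs⟩ := FiniteField.card F p
  have hd : Nat.Coprime p d := by
    rw [Nat.Prime.coprime_iff_not_dvd hp]
    intro hdvd
    have h1 : p ∣ Fintype.card F := hs ▸ dvd_pow_self p s.ne_zero
    have h2 : d + 1 = Fintype.card F := Nat.sub_add_cancel Fintype.card_pos
    exact hp.one_lt.ne' (Nat.dvd_one.mp ((Nat.dvd_add_right hdvd).mp (h2 ▸ h1)))
  have hχd : ∀ x, x ≠ 0 → χ x ^ d = 1 := by
    intro x hx
    rw [← map_pow, FiniteField.pow_card_sub_one_eq_one x hx, map_one]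
  obtain ⟨E, _, _, _, ψ', χ', a', b', hcard', hψ', hfrob', hχ', hχd', ha', h⟩ :=
    exists_quadratic_lift_kloostermanSum hψ hfrob hχ hχd b ha
  have hE : ‖kloostermanSum χ' ψ' a' b'‖ ≤ 2 * (Fintype.card F : ℝ) := by
    have hlim : Filter.Tendsto
        (fun k : ℕ => (2 + (5 * (d * (p + 1) * p) + 1 + 1) / 4 ^ k) * (p : ℝ) ^ (s : ℕ))
        Filter.atTop (nhds ((2 + 0) * (p : ℝ) ^ (s : ℕ))) := by
      refine Filter.Tendsto.mul_const _ (Filter.Tendsto.const_add _ ?_)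
      exact tendsto_const_nhds.div_atTop (tendsto_pow_atTop_atTop_of_one_lt (by norm_num))
    have := ge_of_tendsto' hlim fun k => norm_kloostermanSum_le_add_div_four_pow hd k E s
      s.ne_zero (hcard'.trans (by rw [hs])) ψ' hψ' hfrob' χ' hχ' hχd' a' b' ha'
    rw [hs]
    push_cast
    linarith
  refine le_of_sq_le_sq ?_ (by positivity)
  rw [mul_pow, Real.sq_sqrt (Nat.cast_nonneg _)]
  linarith

/-- The sum of a multiplicative character against additive characters of `x` and `1 / x`. -/
theorem norm_sum_monoidHom_addChar_addChar_inv_le {F : Type*} [Field F] [Fintype F]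
    {χ : F →* ℂ} (hχ : χ 0 = 0) (ψ₁ ψ₂ : AddChar F ℂ) (h : ψ₁ ≠ 1 ∨ ψ₂ ≠ 1) :
    ‖∑ x : F, χ x * ψ₁ x * ψ₂ x⁻¹‖ ≤ 2 * Real.sqrt (Fintype.card F) := by
  obtain ⟨p, hchar⟩ := CharP.exists F
  have hp : Fact p.Prime := ⟨CharP.char_is_prime F p⟩
  obtain ⟨ψ, hψ, hfrob⟩ : ∃ ψ : AddChar F ℂ, ψ ≠ 1 ∧ ∀ z, ψ (z ^ p) = ψ z := by
    let : Algebra (ZMod p) F := ZMod.algebra F p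
    obtain ⟨ψ₀, hψ₀⟩ : ∃ ψ₀ : AddChar (ZMod p) ℂ, ψ₀ 1 ≠ 1 :=
      AddChar.exists_apply_ne_zero.mpr one_ne_zero
    refine ⟨ψ₀.compAddMonoidHom (Algebra.trace (ZMod p) F).toAddMonoidHom, ?_, ?_⟩
    · intro h
      obtain ⟨z, hz⟩ := Algebra.trace_surjective (ZMod p) F 1
      have := DFunLike.congr_fun h z
      simp only [AddChar.compAddMonoidHom_apply, LinearMap.toAddMonoidHom_coe, hz] at this
      exact hψ₀ this
    · intro z
      have := Algebra.trace_eq_of_algEquiv (FiniteField.frobeniusAlgEquiv (ZMod p) F p) z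
      simp only [AddChar.compAddMonoidHom_apply, LinearMap.toAddMonoidHom_coe]
      rw [← this]
      simp
  have hprim := AddChar.IsPrimitive.of_ne_one hψ
  have hshift : ∀ ψ' : AddChar F ℂ, ∃ a, ψ' = AddChar.mulShift ψ a := by
    have hinj := AddChar.to_mulShift_inj_of_isPrimitive hprim
    have hbij := (Fintype.bijective_iff_injective_and_card (AddChar.mulShift ψ)).mpr
      ⟨hinj, (AddChar.card_eq (α := F)).symm⟩
    exact fun ψ' => (hbij.2 ψ').imp fun _ h => h.symm
  obtain ⟨a, rfl⟩ := hshift ψ₁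
  obtain ⟨b, rfl⟩ := hshift ψ₂
  have hsum : ∑ x : F, χ x * AddChar.mulShift ψ a x * AddChar.mulShift ψ b x⁻¹
      = kloostermanSum χ ψ a b := by
    refine Finset.sum_congr rfl fun x _ => ?_
    rw [AddChar.mulShift_apply, AddChar.mulShift_apply, mul_assoc, ← AddChar.map_add_eq_mul]
  rw [hsum]
  rcases eq_or_ne a 0 with rfl | ha
  · have hb : b ≠ 0 := by
      rintro rfl
      simp at h
    have hinv : kloostermanSum χ ψ 0 b
        = kloostermanSum (χ.comp (invMonoidWithZeroHom : F →*₀ F).toMonoidHom) ψ b 0 := by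
      refine Fintype.sum_equiv (Equiv.inv F) _ _ fun x => ?_
      simp [show invMonoidWithZeroHom x = x⁻¹ from rfl]
    rw [hinv]
    exact norm_kloostermanSum_le hψ hfrob (by simp [hχ]) 0 hb
  · exact norm_kloostermanSum_le hψ hfrob hχ b ha

/-- Character sums over the nonzero elements of an additive subgroup whose inverses lie in
another one. -/
theorem norm_sum_units_mem_subgroups_sub_le {F : Type*} [Field F] [Fintype F] [DecidableEq F]
    (V W : AddSubgroup F) [DecidablePred (· ∈ V)] [DecidablePred (· ∈ W)] (χ : Fˣ →* ℂ)
    [Decidable (χ = 1)] :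
    ‖∑ u ∈ Finset.univ.filter fun u : Fˣ => (u : F) ∈ V ∧ ((u⁻¹ : Fˣ) : F) ∈ W, χ u
      - (if χ = 1 then ((Fintype.card F / (V.index * W.index) : ℝ) : ℂ) else 0)‖
      ≤ 2 * Real.sqrt (Fintype.card F) := by
  classical
  let _ : Fintype (F ⧸ V) := Fintype.ofFinite _
  let _ : Fintype (F ⧸ W) := Fintype.ofFinite _
  set Q := Fintype.card F with hQ
  have hQ1 : (1 : ℝ) ≤ Real.sqrt Q := Real.one_le_sqrt.mpr (by exact_mod_cast Fintype.card_pos)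
  set χ' : F →* ℂ := (MulChar.ofUnitHom χ.toHomUnits).toMonoidHom with hχ'
  have hχ0 : χ' 0 = 0 := MulChar.map_zero _
  have hχu : ∀ u : Fˣ, χ' u = χ u := fun u => by simp [hχ']
  let π₁ : AddChar (F ⧸ V) ℂ → AddChar F ℂ := fun ψ => ψ.compAddMonoidHom (QuotientAddGroup.mk' V)
  let π₂ : AddChar (F ⧸ W) ℂ → AddChar F ℂ := fun ψ => ψ.compAddMonoidHom (QuotientAddGroup.mk' W)
  have hind₁ : ∀ x : F, ∑ ψ, π₁ ψ x = if x ∈ V then (V.index : ℂ) else 0 := by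
    intro x
    have := AddChar.sum_apply_eq_ite (α := F ⧸ V) (QuotientAddGroup.mk' V x)
    simp only [π₁, AddChar.compAddMonoidHom_apply]
    rw [this, AddSubgroup.index_eq_card, Nat.card_eq_fintype_card]
    simp
  have hind₂ : ∀ x : F, ∑ ψ, π₂ ψ x = if x ∈ W then (W.index : ℂ) else 0 := by
    intro x
    have := AddChar.sum_apply_eq_ite (α := F ⧸ W) (QuotientAddGroup.mk' W x)
    simp only [π₂, AddChar.compAddMonoidHom_apply]
    rw [this, AddSubgroup.index_eq_card, Nat.card_eq_fintype_card]
    simp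
  have hcard₁ : Fintype.card (AddChar (F ⧸ V) ℂ) = V.index := by
    rw [AddChar.card_eq, AddSubgroup.index_eq_card, Nat.card_eq_fintype_card]
  have hcard₂ : Fintype.card (AddChar (F ⧸ W) ℂ) = W.index := by
    rw [AddChar.card_eq, AddSubgroup.index_eq_card, Nat.card_eq_fintype_card]
  have hone₁ : ∀ ψ, ψ ≠ 1 → π₁ ψ ≠ 1 := by
    intro ψ hψ h
    apply hψ
    ext x
    obtain ⟨y, rfl⟩ := QuotientAddGroup.mk'_surjective V x
    exact DFunLike.congr_fun h y
  have hone₂ : ∀ ψ, ψ ≠ 1 → π₂ ψ ≠ 1 := by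
    intro ψ hψ h
    apply hψ
    ext x
    obtain ⟨y, rfl⟩ := QuotientAddGroup.mk'_surjective W x
    exact DFunLike.congr_fun h y
  have hunits : ∀ f : F → ℂ, ∑ x : F, χ' x * f x = ∑ u : Fˣ, χ u * f u := by
    intro f
    refine (Finset.sum_of_injOn Units.val Units.val_injective.injOn (fun _ _ => by simp) ?_
      fun u _ => by rw [hχu]).symm
    intro x _ hx
    have : x = 0 := by
      by_contra h
      exact hx ⟨Units.mk0 x h, by simp, rfl⟩
    rw [this, hχ0, zero_mul]
  set S := ∑ u ∈ Finset.univ.filter fun u : Fˣ => (u : F) ∈ V ∧ ((u⁻¹ : Fˣ) : F) ∈ W, χ u with hS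
  have hexp : ∑ t : AddChar (F ⧸ V) ℂ × AddChar (F ⧸ W) ℂ,
      ∑ x : F, χ' x * π₁ t.1 x * π₂ t.2 x⁻¹ = V.index * W.index * S := by
    rw [Finset.sum_comm]
    have : ∀ x : F, ∑ t : AddChar (F ⧸ V) ℂ × AddChar (F ⧸ W) ℂ, χ' x * π₁ t.1 x * π₂ t.2 x⁻¹
        = χ' x * ((∑ ψ, π₁ ψ x) * ∑ ψ, π₂ ψ x⁻¹) := by
      intro x
      rw [Finset.sum_mul_sum, Fintype.sum_prod_type, Finset.mul_sum]
      refine Finset.sum_congr rfl fun _ _ => ?_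
      rw [Finset.mul_sum]
      exact Finset.sum_congr rfl fun _ _ => mul_assoc _ _ _
    simp only [this]
    rw [hunits, hS, Finset.sum_filter, Finset.mul_sum]
    refine Finset.sum_congr rfl fun u _ => ?_
    rw [hind₁, hind₂, ← Units.val_inv_eq_inv_val]
    by_cases h1 : (u : F) ∈ V <;> by_cases h2 : ((u⁻¹ : Fˣ) : F) ∈ W <;>
      simp only [h1, h2, and_self, and_true, and_false, if_true, if_false] <;> ring
  have hmain : ‖∑ x : F, χ' x * π₁ 1 x * π₂ 1 x⁻¹ - (if χ = 1 then (Q : ℂ) else 0)‖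
      ≤ 2 * Real.sqrt Q := by
    have h1 : ∑ x : F, χ' x * π₁ 1 x * π₂ 1 x⁻¹ = ∑ u : Fˣ, χ u := by
      have := hunits fun _ => 1
      simpa [π₁, π₂] using this
    rw [h1]
    split_ifs with h
    · rw [h]
      have h2 : ((Fintype.card Fˣ : ℕ) : ℂ) = Q - 1 := by
        rw [Fintype.card_units, Nat.cast_sub Fintype.card_pos, Nat.cast_one]
      simp only [MonoidHom.one_apply, Finset.sum_const, Finset.card_univ, nsmul_eq_mul, mul_one, h2]
      rw [sub_sub_cancel_left, norm_neg, norm_one]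
      linarith
    · rw [sum_hom_units_eq_zero χ h, sub_zero, norm_zero]
      positivity
  have hrest : ‖V.index * W.index * S - (if χ = 1 then (Q : ℂ) else 0)‖
      ≤ V.index * W.index * (2 * Real.sqrt Q) := by
    rw [← hexp, ← Finset.add_sum_erase _ _ (Finset.mem_univ (1, 1)), add_sub_right_comm]
    have h3 : ∑ t ∈ (Finset.univ : Finset (AddChar (F ⧸ V) ℂ × AddChar (F ⧸ W) ℂ)),
        (2 * Real.sqrt Q) = V.index * W.index * (2 * Real.sqrt Q) := by
      rw [Finset.sum_const, Finset.card_univ, Fintype.card_prod, hcard₁, hcard₂, nsmul_eq_mul]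
      push_cast
      ring
    rw [← h3, ← Finset.add_sum_erase _ _ (Finset.mem_univ (1, 1))]
    refine (norm_add_le _ _).trans (add_le_add hmain ((norm_sum_le _ _).trans
      (Finset.sum_le_sum fun t ht => ?_)))
    refine norm_sum_monoidHom_addChar_addChar_inv_le hχ0 _ _ ?_
    by_contra! hcon
    refine (Finset.mem_erase.mp ht).1 (Prod.ext ?_ ?_)
    · by_contra h
      exact hone₁ _ h hcon.1
    · by_contra h
      exact hone₂ _ h hcon.2
  have hpos : (0 : ℝ) < V.index * W.index := by
    have h1 : V.index ≠ 0 := AddSubgroup.FiniteIndex.index_ne_zero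
    have h2 : W.index ≠ 0 := AddSubgroup.FiniteIndex.index_ne_zero
    positivity
  refine le_of_mul_le_mul_left (le_trans (le_of_eq ?_) hrest) hpos
  have hnorm : (V.index * W.index : ℝ) = ‖(V.index * W.index : ℂ)‖ := by simp
  nth_rewrite 1 [hnorm]
  rw [← norm_mul, mul_sub]
  congr 2
  split_ifs
  · have : (V.index * W.index : ℂ) ≠ 0 := by exact_mod_cast hpos.ne'
    push_cast
    rw [mul_div_cancel₀ _ this]
  · simp

lemma sum_range_pow_apply_eq_ite {G : Type*} [Group G] {ξ : G →* ℂ} {ℓ : ℕ} (hpow : ξ ^ ℓ = 1)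
    (x : G) [Decidable (ξ x = 1)] :
    ∑ j ∈ Finset.range ℓ, (ξ ^ j) x = if ξ x = 1 then (ℓ : ℂ) else 0 := by
  simp only [MonoidHom.pow_apply]
  split_ifs with h
  · simp [h]
  · have h1 : ξ x ^ ℓ = 1 := by rw [← MonoidHom.pow_apply, hpow, MonoidHom.one_apply]
    rw [geom_sum_eq h, h1, sub_self, zero_div]

/-- Sieving out the kernels of characters of distinct prime orders. -/
theorem norm_sum_filter_forall_ne_one_sub_le {G : Type*} [Group G] [DecidableEq (G →* ℂ)]
    (X : Finset G) {M E : ℝ}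
    (hX : ∀ χ : G →* ℂ, ‖∑ x ∈ X, χ x - (if χ = 1 then (M : ℂ) else 0)‖ ≤ E)
    (ξ : ℕ → (G →* ℂ)) (L : Finset ℕ) (hprime : ∀ ℓ ∈ L, ℓ.Prime) (hpow : ∀ ℓ ∈ L, ξ ℓ ^ ℓ = 1)
    (hne : ∀ ℓ ∈ L, ξ ℓ ≠ 1) (m : ℕ) (hm : ∀ ℓ ∈ L, Nat.Coprime ℓ m)
    (χ : G →* ℂ) (hχ : χ ^ m = 1) :
    ‖∑ x ∈ X.filter fun x => ∀ ℓ ∈ L, ξ ℓ x ≠ 1, χ x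
      - (if χ = 1 then (((∏ ℓ ∈ L, (1 - (ℓ : ℝ)⁻¹)) * M : ℝ) : ℂ) else 0)‖
      ≤ 2 ^ L.card * (∏ ℓ ∈ L, (1 - (ℓ : ℝ)⁻¹)) * E := by
  induction L using Finset.induction_on generalizing m χ with
  | empty => simpa using hX χ
  | insert ℓ L hℓ ih =>
    have hℓp : ℓ.Prime := hprime ℓ (Finset.mem_insert_self ℓ L)
    have hξpow : ξ ℓ ^ ℓ = 1 := hpow ℓ (Finset.mem_insert_self ℓ L)
    have hℓm : Nat.Coprime ℓ m := hm ℓ (Finset.mem_insert_self ℓ L)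
    have ih' := ih (fun k hk => hprime k (Finset.mem_insert_of_mem hk))
      (fun k hk => hpow k (Finset.mem_insert_of_mem hk))
      (fun k hk => hne k (Finset.mem_insert_of_mem hk))
    set Y := X.filter fun x => ∀ ℓ ∈ L, ξ ℓ x ≠ 1 with hY
    set θ := ∏ ℓ ∈ L, (1 - (ℓ : ℝ)⁻¹) with hθ
    have hℓ0 : (ℓ : ℂ) ≠ 0 := by exact_mod_cast hℓp.ne_zero
    have hℓ0' : (ℓ : ℝ) ≠ 0 := by exact_mod_cast hℓp.ne_zero
    have hfilter : X.filter (fun x => ∀ k ∈ insert ℓ L, ξ k x ≠ 1)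
        = Y.filter fun x => ξ ℓ x ≠ 1 := by
      rw [hY, Finset.filter_filter]
      refine Finset.filter_congr fun x _ => ?_
      rw [Finset.forall_mem_insert, and_comm]
    have hsplit : ∑ x ∈ X.filter (fun x => ∀ k ∈ insert ℓ L, ξ k x ≠ 1), χ x
        = (1 - (ℓ : ℂ)⁻¹) * ∑ x ∈ Y, χ x
          - (ℓ : ℂ)⁻¹ * ∑ j ∈ Finset.Ico 1 ℓ, ∑ x ∈ Y, (χ * ξ ℓ ^ j) x := by
      rw [hfilter, Finset.sum_filter, Finset.sum_comm, Finset.mul_sum, Finset.mul_sum,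
        ← Finset.sum_sub_distrib]
      refine Finset.sum_congr rfl fun x _ => ?_
      have h1 := sum_range_pow_apply_eq_ite hξpow x
      rw [Finset.range_eq_Ico, Finset.sum_eq_sum_Ico_succ_bot hℓp.pos, pow_zero,
        MonoidHom.one_apply] at h1
      simp only [MonoidHom.mul_apply, ← Finset.mul_sum]
      rw [eq_sub_of_add_eq' h1]
      by_cases h : ξ ℓ x = 1
      · simp only [h, ne_eq, not_true_eq_false, if_true, if_false]
        field_simp
        ring
      · simp only [h, ne_eq, not_false_eq_true, if_true, if_false]
        ring
    have hrest : ∀ j ∈ Finset.Ico 1 ℓ, ‖∑ x ∈ Y, (χ * ξ ℓ ^ j) x‖ ≤ 2 ^ L.card * θ * E := by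
      intro j hj
      rw [Finset.mem_Ico] at hj
      have hne1 : χ * ξ ℓ ^ j ≠ 1 := by
        intro h
        have h1 : ξ ℓ ^ (j * m) = 1 := by
          have := congrArg (· ^ m) h
          simpa only [mul_pow, hχ, one_mul, one_pow, ← pow_mul] using this
        have h2 : orderOf (ξ ℓ) = ℓ := by
          have : Fact ℓ.Prime := ⟨hℓp⟩
          exact orderOf_eq_prime hξpow (hne ℓ (Finset.mem_insert_self ℓ L))
        have h3 : ℓ ∣ j * m := h2 ▸ orderOf_dvd_of_pow_eq_one h1
        have h4 : ℓ ∣ j := hℓm.dvd_of_dvd_mul_right h3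
        exact absurd (Nat.le_of_dvd (by omega) h4) (by omega)
      have := ih' (m * ℓ) (fun k hk => Nat.Coprime.mul_right
        (hm k (Finset.mem_insert_of_mem hk))
        ((Nat.coprime_primes (hprime k (Finset.mem_insert_of_mem hk)) hℓp).mpr
          (fun h => hℓ (h ▸ hk)))) (χ * ξ ℓ ^ j) (by
          rw [mul_pow, pow_mul, hχ, one_pow, one_mul, mul_comm m ℓ, ← pow_mul, mul_comm j,
            mul_assoc, pow_mul, hξpow, one_pow])
      rwa [if_neg hne1, sub_zero] at this
    have hmain := ih' m (fun k hk => hm k (Finset.mem_insert_of_mem hk)) χ hχ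
    have hℓinv : (0 : ℝ) ≤ 1 - (ℓ : ℝ)⁻¹ := by
      have : (ℓ : ℝ)⁻¹ ≤ 1 := inv_le_one_of_one_le₀ (by exact_mod_cast hℓp.one_le)
      linarith
    have heq : ∑ x ∈ X.filter (fun x => ∀ k ∈ insert ℓ L, ξ k x ≠ 1), χ x
        - (if χ = 1 then (((∏ k ∈ insert ℓ L, (1 - (k : ℝ)⁻¹)) * M : ℝ) : ℂ) else 0)
        = ((1 - (ℓ : ℝ)⁻¹ : ℝ) : ℂ) * (∑ x ∈ Y, χ x - (if χ = 1 then ((θ * M : ℝ) : ℂ) else 0))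
          - (((ℓ : ℝ)⁻¹ : ℝ) : ℂ) * ∑ j ∈ Finset.Ico 1 ℓ, ∑ x ∈ Y, (χ * ξ ℓ ^ j) x := by
      rw [hsplit, Finset.prod_insert hℓ, ← hθ]
      split_ifs <;> push_cast <;> ring
    rw [heq]
    refine (norm_sub_le _ _).trans ?_
    rw [norm_mul, norm_mul, Complex.norm_real, Complex.norm_real, Real.norm_of_nonneg hℓinv,
      Real.norm_of_nonneg (inv_nonneg.mpr (Nat.cast_nonneg ℓ)), Finset.prod_insert hℓ, ← hθ,
      Finset.card_insert_of_notMem hℓ]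
    have hsum : ‖∑ j ∈ Finset.Ico 1 ℓ, ∑ x ∈ Y, (χ * ξ ℓ ^ j) x‖
        ≤ (ℓ - 1 : ℝ) * (2 ^ L.card * θ * E) := by
      refine (norm_sum_le _ _).trans ((Finset.sum_le_card_nsmul _ _ _ hrest).trans (le_of_eq ?_))
      rw [Nat.card_Ico, nsmul_eq_mul, Nat.cast_sub hℓp.one_le, Nat.cast_one]
    calc _ ≤ (1 - (ℓ : ℝ)⁻¹) * (2 ^ L.card * θ * E)
          + (ℓ : ℝ)⁻¹ * ((ℓ - 1 : ℝ) * (2 ^ L.card * θ * E)) :=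
          add_le_add (mul_le_mul_of_nonneg_left hmain hℓinv)
            (mul_le_mul_of_nonneg_left hsum (inv_nonneg.mpr (Nat.cast_nonneg ℓ)))
      _ = _ := by
        field_simp
        ring

section Count

variable {G : Type*} [Group G] (X : Finset G) {M E : ℝ} (ξ : ℕ → (G →* ℂ)) (L : Finset ℕ)

lemma abs_card_filter_forall_ne_one_sub_le [DecidableEq (G →* ℂ)]
    (hX : ∀ χ : G →* ℂ, ‖∑ x ∈ X, χ x - (if χ = 1 then (M : ℂ) else 0)‖ ≤ E)
    (hprime : ∀ ℓ ∈ L, ℓ.Prime) (hpow : ∀ ℓ ∈ L, ξ ℓ ^ ℓ = 1) (hne : ∀ ℓ ∈ L, ξ ℓ ≠ 1) :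
    |((X.filter fun x => ∀ ℓ ∈ L, ξ ℓ x ≠ 1).card : ℝ) - (∏ ℓ ∈ L, (1 - (ℓ : ℝ)⁻¹)) * M|
      ≤ 2 ^ L.card * (∏ ℓ ∈ L, (1 - (ℓ : ℝ)⁻¹)) * E := by
  have h := norm_sum_filter_forall_ne_one_sub_le X hX ξ L hprime hpow hne 1
    (fun ℓ _ => Nat.coprime_one_right ℓ) 1 (one_pow 1)
  rw [if_pos rfl] at h
  simp only [MonoidHom.one_apply, Finset.sum_const, nsmul_eq_mul, mul_one] at h
  rwa [← Complex.ofReal_natCast, ← Complex.ofReal_sub, Complex.norm_real, Real.norm_eq_abs] at h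

lemma card_filter_eq_one_le [DecidableEq (G →* ℂ)]
    (hX : ∀ χ : G →* ℂ, ‖∑ x ∈ X, χ x - (if χ = 1 then (M : ℂ) else 0)‖ ≤ E)
    (hprime : ∀ ℓ ∈ L, ℓ.Prime) (hpow : ∀ ℓ ∈ L, ξ ℓ ^ ℓ = 1) (hne : ∀ ℓ ∈ L, ξ ℓ ≠ 1)
    {r : ℕ} (hr : r.Prime) (hrL : r ∉ L) (hrpow : ξ r ^ r = 1) (hrne : ξ r ≠ 1) :
    (((X.filter fun x => ∀ ℓ ∈ L, ξ ℓ x ≠ 1).filter fun x => ξ r x = 1).card : ℝ)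
      ≤ (∏ ℓ ∈ L, (1 - (ℓ : ℝ)⁻¹)) * (M * (r : ℝ)⁻¹ + 2 ^ L.card * E) := by
  set Y := X.filter fun x => ∀ ℓ ∈ L, ξ ℓ x ≠ 1 with hY
  set θ := ∏ ℓ ∈ L, (1 - (ℓ : ℝ)⁻¹) with hθ
  have hr0 : (0 : ℝ) < r := by exact_mod_cast hr.pos
  have hr0' : (r : ℂ) ≠ 0 := by exact_mod_cast hr.ne_zero
  have hsum : (r : ℂ) * ((Y.filter fun x => ξ r x = 1).card : ℂ)
      = ∑ j ∈ Finset.range r, ∑ x ∈ Y, (ξ r ^ j) x := by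
    rw [Finset.sum_comm]
    simp only [sum_range_pow_apply_eq_ite hrpow]
    rw [← Finset.sum_filter, Finset.sum_const, nsmul_eq_mul, mul_comm]
  have hterm : ∀ j ∈ Finset.range r,
      ‖∑ x ∈ Y, (ξ r ^ j) x - (if j = 0 then ((θ * M : ℝ) : ℂ) else 0)‖
        ≤ 2 ^ L.card * θ * E := by
    intro j hj
    have hiff : ξ r ^ j = 1 ↔ j = 0 := by
      have : Fact r.Prime := ⟨hr⟩
      have h2 : orderOf (ξ r) = r := orderOf_eq_prime hrpow hrne
      rw [← orderOf_dvd_iff_pow_eq_one, h2]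
      refine ⟨fun h => Nat.eq_zero_of_dvd_of_lt h (Finset.mem_range.mp hj), ?_⟩
      rintro rfl
      exact dvd_zero _
    have := norm_sum_filter_forall_ne_one_sub_le X hX ξ L hprime hpow hne r
      (fun ℓ hℓ => (Nat.coprime_primes (hprime ℓ hℓ) hr).mpr fun h => hrL (h ▸ hℓ)) (ξ r ^ j)
      (by rw [← pow_mul, mul_comm, pow_mul, hrpow, one_pow])
    simpa only [hiff] using this
  have hdiff : ‖(r : ℂ) * ((Y.filter fun x => ξ r x = 1).card : ℂ) - ((θ * M : ℝ) : ℂ)‖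
      ≤ r * (2 ^ L.card * θ * E) := by
    have hM : ((θ * M : ℝ) : ℂ)
        = ∑ j ∈ Finset.range r, if j = 0 then ((θ * M : ℝ) : ℂ) else 0 := by
      rw [Finset.sum_ite_eq' , if_pos (Finset.mem_range.mpr hr.pos)]
    rw [hsum, hM, ← Finset.sum_sub_distrib]
    refine (norm_sum_le _ _).trans ((Finset.sum_le_card_nsmul _ _ _ hterm).trans (le_of_eq ?_))
    rw [Finset.card_range, nsmul_eq_mul]
  have hreal : (r : ℂ) * ((Y.filter fun x => ξ r x = 1).card : ℂ) - ((θ * M : ℝ) : ℂ)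
      = ((r * ((Y.filter fun x => ξ r x = 1).card : ℝ) - θ * M : ℝ) : ℂ) := by
    push_cast
    ring
  rw [hreal, Complex.norm_real, Real.norm_eq_abs] at hdiff
  have h := (abs_le.mp hdiff).2
  have h2 : (r : ℝ) * ((Y.filter fun x => ξ r x = 1).card : ℝ)
      ≤ r * (θ * (M * (r : ℝ)⁻¹ + 2 ^ L.card * E)) := by
    have h3 : (r : ℝ) * (θ * (M * (r : ℝ)⁻¹ + 2 ^ L.card * E))
        = θ * M + r * (2 ^ L.card * θ * E) := by
      field_simp
    linarith
  exact le_of_mul_le_mul_left h2 hr0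

end Count

lemma exists_monoidHom_units_prime_order {F : Type*} [Field F] [Fintype F] {ℓ : ℕ}
    (hℓ : ℓ.Prime) (hdvd : ℓ ∣ Fintype.card F - 1) : ∃ ξ : Fˣ →* ℂ, ξ ^ ℓ = 1 ∧ ξ ≠ 1 := by
  obtain ⟨χ, hχ⟩ := MulChar.exists_mulChar_orderOf F hdvd
    (Complex.isPrimitiveRoot_exp ℓ hℓ.ne_zero)
  refine ⟨χ.toMonoidHom.comp (Units.coeHom F), ?_, ?_⟩
  · ext u
    have h : χ ^ ℓ = 1 := hχ ▸ pow_orderOf_eq_one χ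
    have := DFunLike.congr_fun h (u : F)
    simpa [MulChar.pow_apply_coe] using this
  · intro h
    have : χ = 1 := by
      ext u
      have := DFunLike.congr_fun h u
      simpa using this
    rw [this, orderOf_one] at hχ
    exact hℓ.one_lt.ne hχ

/-- The sieve for elements `u` such that `u` and `u⁻¹` lie in an additive subgroup, avoid smaller
ones, and are not proper prime powers. -/
theorem exists_unit_of_sieve {F ι : Type*} [Field F] [Fintype F] {q : ℕ} (hq : 0 < q)
    (V : AddSubgroup F) (hV : V.index = q) (P : Finset ι) (W : ι → AddSubgroup F)
    (hW : ∀ i ∈ P, q ^ 2 ≤ (W i).index) (L₁ L₂ : Finset ℕ) (hdisj : Disjoint L₁ L₂)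
    (hL₁ : ∀ ℓ ∈ L₁, ℓ.Prime ∧ ℓ ∣ Fintype.card F - 1)
    (hL₂ : ∀ ℓ ∈ L₂, ℓ.Prime ∧ ℓ ∣ Fintype.card F - 1)
    (hineq : 2 ^ (L₁.card + 1) * (1 + L₂.card + 2 * P.card) * q ^ 2 * Real.sqrt (Fintype.card F)
      < Fintype.card F * (1 - ∑ ℓ ∈ L₂, (ℓ : ℝ)⁻¹ - 2 * P.card / q)) :
    ∃ u : Fˣ, (u : F) ∈ V ∧ ((u⁻¹ : Fˣ) : F) ∈ V ∧
      (∀ i ∈ P, (u : F) ∉ W i ∧ ((u⁻¹ : Fˣ) : F) ∉ W i) ∧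
      (∀ ℓ ∈ L₁, ∀ v : Fˣ, v ^ ℓ ≠ u) ∧ (∀ ℓ ∈ L₂, ∀ v : Fˣ, v ^ ℓ ≠ u) := by
  classical
  have hξ : ∀ ℓ, ∃ ξ : Fˣ →* ℂ, ℓ.Prime ∧ ℓ ∣ Fintype.card F - 1 → ξ ^ ℓ = 1 ∧ ξ ≠ 1 := by
    intro ℓ
    by_cases h : ℓ.Prime ∧ ℓ ∣ Fintype.card F - 1
    · exact (exists_monoidHom_units_prime_order h.1 h.2).imp fun _ h _ => h
    · exact ⟨1, fun h' => absurd h' h⟩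
  choose ξ hξ using hξ
  have hpow_ne : ∀ ℓ, ℓ.Prime ∧ ℓ ∣ Fintype.card F - 1 → ∀ u, ξ ℓ u ≠ 1 →
      ∀ v : Fˣ, v ^ ℓ ≠ u := by
    rintro ℓ hℓ u hu v rfl
    apply hu
    rw [map_pow, ← MonoidHom.pow_apply, (hξ ℓ hℓ).1, MonoidHom.one_apply]
  set Q : ℝ := (Fintype.card F : ℝ) with hQ
  have hQpos : 0 < Q := by rw [hQ]; exact_mod_cast Fintype.card_pos
  have hq0 : (0 : ℝ) < q := by exact_mod_cast hq
  set θ : ℝ := ∏ ℓ ∈ L₁, (1 - (ℓ : ℝ)⁻¹) with hθ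
  have hθpos : 0 < θ := by
    refine Finset.prod_pos fun ℓ hℓ => ?_
    have : (ℓ : ℝ)⁻¹ < 1 := inv_lt_one_of_one_lt₀ (by exact_mod_cast (hL₁ ℓ hℓ).1.one_lt)
    linarith
  set E : ℝ := 2 * Real.sqrt Q with hE
  let X : AddSubgroup F → AddSubgroup F → Finset Fˣ := fun A B =>
    Finset.univ.filter fun u : Fˣ => (u : F) ∈ A ∧ ((u⁻¹ : Fˣ) : F) ∈ B
  let Y : AddSubgroup F → AddSubgroup F → Finset Fˣ := fun A B =>
    (X A B).filter fun u => ∀ ℓ ∈ L₁, ξ ℓ u ≠ 1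
  have hX : ∀ A B : AddSubgroup F, ∀ χ : Fˣ →* ℂ, ‖∑ u ∈ X A B, χ u -
      (if χ = 1 then ((Q / (A.index * B.index) : ℝ) : ℂ) else 0)‖ ≤ E :=
    fun A B χ => norm_sum_units_mem_subgroups_sub_le A B χ
  have hYcard : ∀ A B : AddSubgroup F, |((Y A B).card : ℝ) - θ * (Q / (A.index * B.index))|
      ≤ 2 ^ L₁.card * θ * E := fun A B =>
    abs_card_filter_forall_ne_one_sub_le (X A B) ξ L₁ (hX A B) (fun ℓ hℓ => (hL₁ ℓ hℓ).1)
      (fun ℓ hℓ => (hξ ℓ (hL₁ ℓ hℓ)).1) fun ℓ hℓ => (hξ ℓ (hL₁ ℓ hℓ)).2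
  by_contra! hcon
  have hcover : Y V V ⊆ (L₂.biUnion fun r => (Y V V).filter fun u => ξ r u = 1) ∪
      ((P.biUnion fun i => Y (W i) V) ∪ P.biUnion fun i => Y V (W i)) := by
    intro u hu
    by_contra hnot
    simp only [Finset.mem_union, Finset.mem_biUnion, not_or, not_exists, not_and] at hnot
    obtain ⟨hn₁, hn₂, hn₃⟩ := hnot
    have hu' := hu
    simp only [Y, X, Finset.mem_filter, Finset.mem_univ, true_and] at hu' hn₁ hn₂ hn₃
    obtain ⟨⟨huV, huV'⟩, hugood⟩ := hu'
    obtain ⟨ℓ, hℓ, v, hv⟩ := hcon u huV huV'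
      (fun i hi => ⟨fun h => hn₂ i hi ⟨⟨h, huV'⟩, hugood⟩, fun h => hn₃ i hi ⟨⟨huV, h⟩, hugood⟩⟩)
      (fun ℓ hℓ => hpow_ne ℓ (hL₁ ℓ hℓ) u (hugood ℓ hℓ))
    exact hpow_ne ℓ (hL₂ ℓ hℓ) u (fun h => hn₁ ℓ hℓ ⟨⟨⟨huV, huV'⟩, hugood⟩, h⟩) v hv
  set e : ℝ := 2 ^ L₁.card * E with he
  have hlow : θ * (Q / q ^ 2 - e) ≤ ((Y V V).card : ℝ) := by
    have := (abs_le.mp (hYcard V V)).1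
    rw [hV] at this
    rw [sq, mul_sub]
    nlinarith
  have hup₁ : ∀ r ∈ L₂, (((Y V V).filter fun u => ξ r u = 1).card : ℝ)
      ≤ θ * (Q / q ^ 2 * (r : ℝ)⁻¹ + e) := by
    intro r hr
    have := card_filter_eq_one_le (X V V) ξ L₁ (hX V V) (fun ℓ hℓ => (hL₁ ℓ hℓ).1)
      (fun ℓ hℓ => (hξ ℓ (hL₁ ℓ hℓ)).1) (fun ℓ hℓ => (hξ ℓ (hL₁ ℓ hℓ)).2) (hL₂ r hr).1
      (fun h => Finset.disjoint_left.mp hdisj h hr) (hξ r (hL₂ r hr)).1 (hξ r (hL₂ r hr)).2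
    rwa [hV, ← sq] at this
  have hfrac : ∀ i ∈ P, Q / ((W i).index * q) ≤ Q / q ^ 2 * (q : ℝ)⁻¹ := by
    intro i hi
    rw [← div_eq_mul_inv, div_div]
    refine div_le_div_of_nonneg_left hQpos.le (by positivity) ?_
    exact mul_le_mul_of_nonneg_right (by exact_mod_cast hW i hi) hq0.le
  have hup₂ : ∀ i ∈ P, ((Y (W i) V).card : ℝ) ≤ θ * (Q / q ^ 2 * (q : ℝ)⁻¹ + e) := by
    intro i hi
    have h1 := (abs_le.mp (hYcard (W i) V)).2
    rw [hV] at h1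
    nlinarith [mul_le_mul_of_nonneg_left (hfrac i hi) hθpos.le]
  have hup₃ : ∀ i ∈ P, ((Y V (W i)).card : ℝ) ≤ θ * (Q / q ^ 2 * (q : ℝ)⁻¹ + e) := by
    intro i hi
    have h1 := (abs_le.mp (hYcard V (W i))).2
    rw [hV, mul_comm (q : ℝ)] at h1
    nlinarith [mul_le_mul_of_nonneg_left (hfrac i hi) hθpos.le]
  have hcount : ((Y V V).card : ℝ) ≤ ∑ r ∈ L₂, θ * (Q / q ^ 2 * (r : ℝ)⁻¹ + e)
      + (P.card * (θ * (Q / q ^ 2 * (q : ℝ)⁻¹ + e))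
        + P.card * (θ * (Q / q ^ 2 * (q : ℝ)⁻¹ + e))) := by
    have h1 := (Finset.card_le_card hcover).trans ((Finset.card_union_le _ _).trans
      (add_le_add Finset.card_biUnion_le ((Finset.card_union_le _ _).trans
        (add_le_add Finset.card_biUnion_le Finset.card_biUnion_le))))
    have h2 : ((Y V V).card : ℝ) ≤ ∑ r ∈ L₂, (((Y V V).filter fun u => ξ r u = 1).card : ℝ)
        + (∑ i ∈ P, ((Y (W i) V).card : ℝ) + ∑ i ∈ P, ((Y V (W i)).card : ℝ)) := by
      exact_mod_cast h1
    refine h2.trans (add_le_add (Finset.sum_le_sum hup₁) (add_le_add ?_ ?_))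
    · rw [← nsmul_eq_mul]
      exact Finset.sum_le_card_nsmul _ _ _ hup₂
    · rw [← nsmul_eq_mul]
      exact Finset.sum_le_card_nsmul _ _ _ hup₃
  have hfinal : Q / q ^ 2 - e ≤ ∑ r ∈ L₂, (Q / q ^ 2 * (r : ℝ)⁻¹ + e)
      + 2 * P.card * (Q / q ^ 2 * (q : ℝ)⁻¹ + e) := by
    refine le_of_mul_le_mul_left ((hlow.trans hcount).trans (le_of_eq ?_)) hθpos
    rw [← Finset.mul_sum]
    ring
  rw [Finset.sum_add_distrib, ← Finset.mul_sum, Finset.sum_const, nsmul_eq_mul] at hfinal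
  have hmul := mul_le_mul_of_nonneg_left hfinal (sq_nonneg (q : ℝ))
  have hq2 : (q : ℝ) ^ 2 * (Q / q ^ 2) = Q := by field_simp
  refine absurd hineq (not_lt.mpr ?_)
  rw [hE] at he
  rw [he] at hmul
  rw [pow_succ, div_eq_mul_inv (2 * (P.card : ℝ))]
  generalize ∑ r ∈ L₂, (r : ℝ)⁻¹ = σ at hmul ⊢
  generalize Q / (q : ℝ) ^ 2 = z at hmul hq2
  generalize Real.sqrt Q = R at hmul ⊢
  rw [← hq2]
  linarith

section FrobeniusModule

variable (Fq F : Type*) [Field Fq] [Field F] [Fintype Fq] [Algebra Fq F]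

/-- The `Fq`-linear Frobenius endomorphism of `F`. -/
def frobeniusEnd : Module.End Fq F := (FiniteField.frobeniusAlgHom Fq F).toLinearMap

lemma frobeniusEnd_pow_apply (i : ℕ) (β : F) :
    (frobeniusEnd Fq F ^ i) β = β ^ Fintype.card Fq ^ i := by
  induction i with
  | zero => simp
  | succ i ih =>
    rw [pow_succ', Module.End.mul_apply, ih, frobeniusEnd, AlgHom.toLinearMap_apply,
      FiniteField.frobeniusAlgHom_apply, ← pow_mul, pow_succ]

lemma aeval_frobeniusEnd_apply (h : Fq[X]) (β : F) :
    aeval (frobeniusEnd Fq F) h β = polyAct (Fintype.card Fq) h β := by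
  rw [aeval_eq_sum_range, polyAct, sum_over_range _ (by simp), LinearMap.sum_apply]
  refine Finset.sum_congr rfl fun i _ => ?_
  rw [LinearMap.smul_apply, frobeniusEnd_pow_apply, Algebra.smul_def]

variable {Fq F}

lemma aeval_frobeniusEnd_eq_zero_of_dvd {g h : Fq[X]} (hgh : g ∣ h) {β : F}
    (hg : aeval (frobeniusEnd Fq F) g β = 0) : aeval (frobeniusEnd Fq F) h β = 0 := by
  obtain ⟨k, rfl⟩ := hgh
  rw [mul_comm, map_mul, Module.End.mul_apply, hg, map_zero]

/-- If `f` annihilates `β` but no `f / P` does, then `f` has least degree among the annihilators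
of `β`. -/
lemma natDegree_le_of_annihilator {f : Fq[X]} {β : F}
    (hf : aeval (frobeniusEnd Fq F) f β = 0)
    (hP : ∀ P g : Fq[X], P.Monic → Irreducible P → f = P * g →
      aeval (frobeniusEnd Fq F) g β ≠ 0)
    {h : Fq[X]} (hh0 : h ≠ 0) (hh : aeval (frobeniusEnd Fq F) h β = 0) :
    f.natDegree ≤ h.natDegree := by
  classical
  set g := EuclideanDomain.gcd f h with hg
  have hgβ : aeval (frobeniusEnd Fq F) g β = 0 := by
    rw [hg, EuclideanDomain.gcd_eq_gcd_ab, map_add, LinearMap.add_apply,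
      aeval_frobeniusEnd_eq_zero_of_dvd (dvd_mul_right _ _) hf,
      aeval_frobeniusEnd_eq_zero_of_dvd (dvd_mul_right _ _) hh, add_zero]
  obtain ⟨k, hk⟩ : g ∣ f := EuclideanDomain.gcd_dvd_left f h
  have hgh : g ∣ h := EuclideanDomain.gcd_dvd_right f h
  have hunit : IsUnit k := by
    by_contra hk'
    obtain ⟨P, hPm, hPi, l, rfl⟩ := exists_monic_irreducible_factor k hk'
    exact hP P (g * l) hPm hPi (by rw [hk]; ring)
      (aeval_frobeniusEnd_eq_zero_of_dvd (dvd_mul_right _ _) hgβ)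
  have hfh : f ∣ h := by
    rw [hk]
    exact (hunit.mul_right_dvd).mpr hgh
  exact natDegree_le_of_dvd hfh hh0

/-- The polynomial `(X ^ n - 1) / (X - 1)`. -/
def geomPoly (R : Type*) [Semiring R] (n : ℕ) : R[X] := ∑ i ∈ Finset.range n, X ^ i

lemma geomPoly_mul (R : Type*) [CommRing R] (n : ℕ) :
    geomPoly R n * (X - 1) = X ^ n - 1 := geom_sum_mul X n

lemma monic_geomPoly {K : Type*} [Field K] {n : ℕ} (hn : n ≠ 0) : (geomPoly K n).Monic :=
  monic_geom_sum_X hn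

lemma natDegree_geomPoly {K : Type*} [Field K] {n : ℕ} (hn : n ≠ 0) :
    (geomPoly K n).natDegree = n - 1 := by
  have h1 := congrArg natDegree (geomPoly_mul K n)
  have hX : (X - 1 : K[X]).Monic := monic_X_sub_C 1
  have hXd : (X - 1 : K[X]).natDegree = 1 := natDegree_X_sub_C 1
  have hXn : (X ^ n - 1 : K[X]).natDegree = n := natDegree_X_pow_sub_C (r := 1)
  rw [(monic_geomPoly hn).natDegree_mul hX, hXd, hXn] at h1
  omega

theorem isKNormal_one_of_annihilator {n : ℕ} (hn : n ≠ 0) {β : F}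
    (hf : aeval (frobeniusEnd Fq F) (geomPoly Fq n) β = 0)
    (hP : ∀ P g : Fq[X], P.Monic → Irreducible P → geomPoly Fq n = P * g →
      aeval (frobeniusEnd Fq F) g β ≠ 0) :
    IsKNormal Fq (Fintype.card Fq) n 1 β := by
  refine ⟨geomPoly Fq n, ⟨monic_geomPoly hn, ⟨X - 1, (geomPoly_mul Fq n).symm⟩, ?_, ?_⟩,
    natDegree_geomPoly hn⟩
  · rw [← aeval_frobeniusEnd_apply, hf]
  · intro h hm _ hβ
    exact natDegree_le_of_annihilator hf hP hm.ne_zero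
      (by rw [aeval_frobeniusEnd_apply, hβ])

variable (Fq F) in
/-- The elements of `F` annihilated by `g`. -/
def frobeniusKer (g : Fq[X]) : AddSubgroup F :=
  (aeval (frobeniusEnd Fq F) g).toAddMonoidHom.ker

lemma mem_frobeniusKer {g : Fq[X]} {β : F} :
    β ∈ frobeniusKer Fq F g ↔ aeval (frobeniusEnd Fq F) g β = 0 := Iff.rfl

variable [Fintype F]

lemma index_frobeniusKer_geomPoly :
    (frobeniusKer Fq F (geomPoly Fq (Module.finrank Fq F))).index = Fintype.card Fq := by
  have hker : frobeniusKer Fq F (geomPoly Fq (Module.finrank Fq F))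
      = (Algebra.trace Fq F).toAddMonoidHom.ker := by
    ext β
    rw [mem_frobeniusKer, AddMonoidHom.mem_ker, LinearMap.toAddMonoidHom_coe,
      ← map_eq_zero_iff (algebraMap Fq F) (algebraMap Fq F).injective,
      FiniteField.algebraMap_trace_eq_sum_pow, geomPoly, map_sum, LinearMap.sum_apply]
    simp only [map_pow, aeval_X, frobeniusEnd_pow_apply, Nat.card_eq_fintype_card]
  rw [hker, AddSubgroup.index_ker, AddMonoidHom.range_eq_top.mpr
    (Algebra.trace_surjective Fq F), ← Nat.card_eq_fintype_card]
  exact Nat.card_congr AddSubgroup.topEquiv.toEquiv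

lemma card_frobeniusKer_le {g : Fq[X]} (hg : g ≠ 0) :
    Nat.card (frobeniusKer Fq F g) ≤ Fintype.card Fq ^ g.natDegree := by
  classical
  set q := Fintype.card Fq with hq
  have hq1 : 1 < q := Fintype.one_lt_card
  set G : F[X] := ∑ i ∈ Finset.range (g.natDegree + 1),
    C (algebraMap Fq F (g.coeff i)) * X ^ q ^ i with hG
  have hdeg : G.natDegree ≤ q ^ g.natDegree := by
    refine natDegree_sum_le_of_forall_le _ _ fun i hi => ?_
    refine (natDegree_C_mul_X_pow_le _ _).trans (Nat.pow_le_pow_right hq1.le ?_)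
    exact Nat.lt_succ_iff.mp (Finset.mem_range.mp hi)
  have hG0 : G ≠ 0 := by
    intro h
    have hc : G.coeff (q ^ g.natDegree) = algebraMap Fq F g.leadingCoeff := by
      rw [hG, finsetSum_coeff, Finset.sum_eq_single g.natDegree]
      · rw [coeff_C_mul_X_pow, if_pos rfl, coeff_natDegree]
      · intro i _ hi
        rw [coeff_C_mul_X_pow, if_neg]
        exact fun h' => hi (Nat.pow_right_injective hq1 h').symm
      · simp
    rw [h, coeff_zero] at hc
    exact hg (leadingCoeff_eq_zero.mp ((map_eq_zero (algebraMap Fq F)).mp hc.symm))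
  have hsub : (frobeniusKer Fq F g : Set F) ⊆ G.roots.toFinset := by
    intro β hβ
    have h1 : aeval (frobeniusEnd Fq F) g β = 0 := hβ
    rw [aeval_eq_sum_range, LinearMap.sum_apply] at h1
    rw [Finset.mem_coe, Multiset.mem_toFinset, mem_roots hG0, IsRoot.def, hG, eval_finsetSum, ← h1]
    refine Finset.sum_congr rfl fun i _ => ?_
    rw [LinearMap.smul_apply, frobeniusEnd_pow_apply, Algebra.smul_def, eval_mul, eval_C, eval_pow,
      eval_X]
  calc Nat.card (frobeniusKer Fq F g)
      = (frobeniusKer Fq F g : Set F).ncard := rfl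
    _ ≤ (G.roots.toFinset : Set F).ncard := Set.ncard_le_ncard hsub
    _ = G.roots.toFinset.card := Set.ncard_coe_finset _
    _ ≤ G.roots.card := Multiset.toFinset_card_le _
    _ ≤ q ^ g.natDegree := (card_roots' G).trans hdeg

lemma le_index_frobeniusKer {g : Fq[X]} (hg : g ≠ 0)
    (hdeg : g.natDegree + 2 ≤ Module.finrank Fq F) :
    Fintype.card Fq ^ 2 ≤ (frobeniusKer Fq F g).index := by
  have h1 := AddSubgroup.card_mul_index (frobeniusKer Fq F g)
  rw [Nat.card_eq_fintype_card (α := F), Module.card_eq_pow_finrank (K := Fq) (V := F)] at h1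
  have hq0 : 0 < Fintype.card Fq := Fintype.card_pos
  refine Nat.le_of_mul_le_mul_left ?_ (pow_pos hq0 g.natDegree)
  calc Fintype.card Fq ^ g.natDegree * Fintype.card Fq ^ 2
      ≤ Fintype.card Fq ^ Module.finrank Fq F := by
        rw [← pow_add]
        exact Nat.pow_le_pow_right hq0 hdeg
    _ = _ := h1.symm
    _ ≤ _ := Nat.mul_le_mul_right _ (card_frobeniusKer_le hg)

end FrobeniusModule

lemma card_normalizedFactors_le_natDegree {K : Type*} [Field K] [DecidableEq K] {f : K[X]}
    (hf : f ≠ 0) : (UniqueFactorizationMonoid.normalizedFactors f).card ≤ f.natDegree := by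
  have hmem : ∀ P ∈ UniqueFactorizationMonoid.normalizedFactors f, Irreducible P ∧ P.Monic :=
    fun P hP => ⟨((Polynomial.mem_normalizedFactors_iff hf).mp hP).1,
      ((Polynomial.mem_normalizedFactors_iff hf).mp hP).2.1⟩
  have h1 := natDegree_eq_of_degree_eq (degree_eq_degree_of_associated
    (UniqueFactorizationMonoid.prod_normalizedFactors hf))
  rw [natDegree_multiset_prod_of_monic _ fun P hP => (hmem P hP).2] at h1
  rw [← h1]
  have := Multiset.card_nsmul_le_sum (a := 1)
    (s := (UniqueFactorizationMonoid.normalizedFactors f).map natDegree) (fun d hd => by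
      obtain ⟨P, hP, rfl⟩ := Multiset.mem_map.mp hd
      exact (hmem P hP).1.natDegree_pos)
  simpa using this

/-- A unit which is no proper prime power generates the multiplicative group. -/
lemma orderOf_eq_card_sub_one_of_forall_prime {F : Type*} [Field F] [Fintype F] {u : Fˣ}
    (hu : ∀ ℓ : ℕ, ℓ.Prime → ℓ ∣ Fintype.card F - 1 → ∀ v : Fˣ, v ^ ℓ ≠ u) :
    orderOf u = Fintype.card F - 1 := by
  obtain ⟨g, hg⟩ := IsCyclic.exists_generator (α := Fˣ)
  have hcard : orderOf g = Fintype.card F - 1 := by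
    classical
    rw [orderOf_eq_card_of_forall_mem_zpowers hg, Nat.card_eq_fintype_card, Fintype.card_units]
  obtain ⟨k, rfl⟩ := (Submonoid.mem_powers_iff _ _).mp ((mem_powers_iff_mem_zpowers).mpr (hg u))
  have hcop : Nat.gcd (orderOf g) k = 1 := by
    by_contra h
    obtain ⟨ℓ, hℓ, hdvd⟩ := Nat.exists_prime_and_dvd h
    obtain ⟨j, rfl⟩ := hdvd.trans (Nat.gcd_dvd_right _ _)
    exact hu ℓ hℓ (hcard ▸ hdvd.trans (Nat.gcd_dvd_left _ _)) (g ^ j)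
      (by rw [← pow_mul, mul_comm])
  rw [orderOf_pow, hcop, Nat.div_one, hcard]

/-- A sufficient condition for the existence of a primitive element `α` such that `α` and `α⁻¹`
are both `1`-normal, in terms of a partition of the prime divisors of `q ^ n - 1`. -/
theorem exists_primitive_one_normal_pair_of_partition (Fq F : Type*) [Field Fq] [Field F]
    [Fintype Fq] [Fintype F] [Algebra Fq F] {p m a : ℕ} [Fact p.Prime] [CharP Fq p] (hm : m ≠ 0)
    (hn : Module.finrank Fq F = m * p ^ a) (hn2 : 2 ≤ Module.finrank Fq F)
    {L₁ L₂ : Finset ℕ} (hdisj : Disjoint L₁ L₂)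
    (hunion : L₁ ∪ L₂ = (Fintype.card F - 1).primeFactors)
    (hineq : 2 ^ (L₁.card + 1) * (1 + L₂.card + 2 * m) * (Fintype.card Fq : ℝ) ^ 2 *
        Real.sqrt (Fintype.card F) <
      Fintype.card F * (1 - ∑ ℓ ∈ L₂, (ℓ : ℝ)⁻¹ - 2 * m / Fintype.card Fq)) :
    ∃ α : F, α ≠ 0 ∧ orderOf α = Fintype.card F - 1 ∧ orderOf α⁻¹ = Fintype.card F - 1 ∧
      IsKNormal Fq (Fintype.card Fq) (Module.finrank Fq F) 1 α ∧
      IsKNormal Fq (Fintype.card Fq) (Module.finrank Fq F) 1 α⁻¹ := by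
  classical
  set n := Module.finrank Fq F with hndef
  set q := Fintype.card Fq with hq
  have hn0 : n ≠ 0 := by omega
  have hq0 : 0 < q := Fintype.card_pos
  have hXm : (X ^ m - 1 : Fq[X]) ≠ 0 := X_pow_sub_C_ne_zero (Nat.pos_of_ne_zero hm) 1
  set S : Finset Fq[X] := ((UniqueFactorizationMonoid.normalizedFactors
    (X ^ m - 1 : Fq[X])).toFinset).filter (· ∣ geomPoly Fq n) with hS
  have hScard : S.card ≤ m := calc
    S.card ≤ _ := Finset.card_filter_le _ _
    _ ≤ _ := Multiset.toFinset_card_le _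
    _ ≤ _ := card_normalizedFactors_le_natDegree hXm
    _ = m := natDegree_X_pow_sub_C (r := 1)
  have hmemS : ∀ P g : Fq[X], P.Monic → Irreducible P → geomPoly Fq n = P * g → P ∈ S := by
    intro P g hPm hPi hPg
    have hPn : P ∣ (X ^ m - 1 : Fq[X]) ^ p ^ a := by
      rw [sub_pow_char_pow, one_pow, ← pow_mul, ← hn, ← geomPoly_mul, hPg, mul_assoc]
      exact dvd_mul_right _ _
    rw [hS, Finset.mem_filter, Multiset.mem_toFinset, Polynomial.mem_normalizedFactors_iff hXm]
    exact ⟨⟨hPi, hPm, hPi.prime.dvd_of_dvd_pow hPn⟩, ⟨g, hPg⟩⟩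
  have hW : ∀ P ∈ S, q ^ 2 ≤ (frobeniusKer Fq F (geomPoly Fq n / P)).index := by
    intro P hP
    obtain ⟨hP1, g, hPg⟩ := Finset.mem_filter.mp hP
    rw [Multiset.mem_toFinset, Polynomial.mem_normalizedFactors_iff hXm] at hP1
    obtain ⟨hPi, hPm, -⟩ := hP1
    have hg0 : g ≠ 0 := by
      rintro rfl
      exact (monic_geomPoly (K := Fq) hn0).ne_zero (by rw [hPg, mul_zero])
    rw [hPg, mul_div_cancel_left₀ g hPm.ne_zero]
    refine le_index_frobeniusKer hg0 ?_
    have hdeg := natDegree_geomPoly (K := Fq) hn0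
    rw [hPg, natDegree_mul hPm.ne_zero hg0] at hdeg
    have := hPi.natDegree_pos
    omega
  have hsplit : ∀ ℓ, ℓ ∈ L₁ ∨ ℓ ∈ L₂ ↔ ℓ ∈ (Fintype.card F - 1).primeFactors := fun ℓ => by
    rw [← hunion, Finset.mem_union]
  have hfac : ∀ ℓ ∈ (Fintype.card F - 1).primeFactors, ℓ.Prime ∧ ℓ ∣ Fintype.card F - 1 :=
    fun ℓ h => ⟨Nat.prime_of_mem_primeFactors h, Nat.dvd_of_mem_primeFactors h⟩
  have hScard' : (S.card : ℝ) ≤ m := by exact_mod_cast hScard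
  obtain ⟨u, hu, hu', hP, hu₁, hu₂⟩ := exists_unit_of_sieve hq0
    (frobeniusKer Fq F (geomPoly Fq n)) index_frobeniusKer_geomPoly S
    (fun P => frobeniusKer Fq F (geomPoly Fq n / P)) hW L₁ L₂ hdisj
    (fun ℓ h => hfac ℓ ((hsplit ℓ).mp (.inl h))) (fun ℓ h => hfac ℓ ((hsplit ℓ).mp (.inr h))) (by
      refine lt_of_le_of_lt ?_ (hineq.trans_le ?_)
      · gcongr
      · gcongr)
  have hord : orderOf u = Fintype.card F - 1 := by
    refine orderOf_eq_card_sub_one_of_forall_prime fun ℓ hℓ hdvd => ?_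
    have hcard : Fintype.card F - 1 ≠ 0 := by
      have := Fintype.one_lt_card (α := F)
      omega
    rcases (hsplit ℓ).mpr (Nat.mem_primeFactors.mpr ⟨hℓ, hdvd, hcard⟩) with h | h
    exacts [hu₁ ℓ h, hu₂ ℓ h]
  refine ⟨u, u.ne_zero, by rw [orderOf_units, hord], ?_, ?_, ?_⟩
  · rw [← Units.val_inv_eq_inv_val, orderOf_units, orderOf_inv, hord]
  · refine isKNormal_one_of_annihilator hn0 hu fun P g hPm hPi hPg h0 => ?_
    refine (hP P (hmemS P g hPm hPi hPg)).1 ?_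
    rw [hPg, mul_div_cancel_left₀ g hPm.ne_zero]
    exact h0
  · rw [← Units.val_inv_eq_inv_val]
    refine isKNormal_one_of_annihilator hn0 hu' fun P g hPm hPi hPg h0 => ?_
    refine (hP P (hmemS P g hPm hPi hPg)).2 ?_
    rw [hPg, mul_div_cancel_left₀ g hPm.ne_zero]
    exact h0

lemma sieve_inequality_of_nat {q Q m w t t' c : ℕ} (hq : 0 < q) (hc : 0 < c) (ht : t' ≤ t) {S : ℝ}
    (hS : S ≤ t / c)
    (h : 4 ^ (w + 1) * (1 + t + 2 * m) ^ 2 * q ^ 4 * (q * c) ^ 2 <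
      Q * (q * c - t * q - 2 * m * c) ^ 2) :
    2 ^ (w + 1) * (1 + t' + 2 * m) * (q : ℝ) ^ 2 * Real.sqrt Q < Q * (1 - S - 2 * m / q) := by
  set D := q * c - t * q - 2 * m * c with hD
  have hD0 : 0 < D := by
    rcases Nat.eq_zero_or_pos D with h0 | h0
    · rw [h0] at h
      simp at h
    · exact h0
  have hQ0 : 0 < Q := Nat.pos_of_ne_zero fun h0 => by
    rw [h0] at h
    simp at h
  have hDr : (D : ℝ) = q * c - t * q - 2 * m * c := by
    have h1 : D + t * q + 2 * m * c = q * c := by omega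
    have h2 : (D : ℝ) + t * q + 2 * m * c = q * c := by exact_mod_cast h1
    linarith
  have hq' : (0 : ℝ) < q := by exact_mod_cast hq
  have hc' : (0 : ℝ) < c := by exact_mod_cast hc
  have hQ' : (0 : ℝ) < Q := by exact_mod_cast hQ0
  have hD' : (0 : ℝ) < D := by exact_mod_cast hD0
  have ht' : (t' : ℝ) ≤ t := by exact_mod_cast ht
  have hδ : (D : ℝ) / (q * c) ≤ 1 - S - 2 * m / q := by
    have : (D : ℝ) / (q * c) = 1 - t / c - 2 * m / q := by
      rw [hDr]
      field_simp
    linarith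
  have hr : ((2 : ℝ) ^ (w + 1) * (1 + t + 2 * m) * (q : ℝ) ^ 2 * (q * c)) ^ 2 <
      (Real.sqrt Q * D) ^ 2 := by
    rw [mul_pow (Real.sqrt Q), Real.sq_sqrt hQ'.le]
    have h' : ((4 ^ (w + 1) * (1 + t + 2 * m) ^ 2 * q ^ 4 * (q * c) ^ 2 : ℕ) : ℝ) <
      (Q * D ^ 2 : ℕ) := by exact_mod_cast h
    push_cast at h'
    convert h' using 1
    rw [show (4 : ℝ) = 2 ^ 2 by norm_num, ← pow_mul, mul_comm 2 (w + 1), pow_mul]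
    ring
  have hlt := lt_of_pow_lt_pow_left₀ 2 (by positivity) hr
  have hs : (0 : ℝ) < Real.sqrt Q := Real.sqrt_pos.mpr hQ'
  calc (2 : ℝ) ^ (w + 1) * (1 + t' + 2 * m) * (q : ℝ) ^ 2 * Real.sqrt Q
      ≤ 2 ^ (w + 1) * (1 + t + 2 * m) * (q : ℝ) ^ 2 * Real.sqrt Q := by gcongr
    _ < Real.sqrt Q * D / (q * c) * Real.sqrt Q := by
        gcongr
        rwa [lt_div_iff₀ (by positivity)]
    _ = Q * (D / (q * c)) := by
        rw [mul_div_assoc, mul_right_comm, Real.mul_self_sqrt hQ'.le]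
    _ ≤ Q * (1 - S - 2 * m / q) := by gcongr

/-- The primes below `101`. -/
def smallPrimes : List ℕ :=
  [2, 3, 5, 7, 11, 13, 17, 19, 23, 29, 31, 37, 41, 43, 47, 53, 59, 61, 67, 71, 73, 79, 83, 89, 97]

lemma mem_smallPrimes {ℓ : ℕ} (hℓ : ℓ.Prime) (h : ℓ < 101) : ℓ ∈ smallPrimes := by
  interval_cases ℓ <;> first | (exfalso; revert hℓ; norm_num; done) | decide

lemma prime_of_mem_smallPrimes {ℓ : ℕ} (h : ℓ ∈ smallPrimes) : ℓ.Prime := by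
  simp only [smallPrimes, List.mem_cons, List.not_mem_nil, or_false] at h
  rcases h with rfl | rfl | rfl | rfl | rfl | rfl | rfl | rfl | rfl | rfl | rfl | rfl | rfl | rfl |
    rfl | rfl | rfl | rfl | rfl | rfl | rfl | rfl | rfl | rfl | rfl <;> norm_num

/-- The primes below `c` which divide `N`, for `c ≤ 101`. -/
def smallPrimeDivisors (c N : ℕ) : List ℕ := smallPrimes.filter fun ℓ => ℓ < c && N % ℓ == 0

/-- A numerical criterion for the sieve to succeed for `q` and `n`, where `n = m * p ^ a`; the
primes below `c` are kept and at most `t` larger ones are sieved. -/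
def sieveCheck (q n m c t : ℕ) : Bool :=
  let L := smallPrimeDivisors c (q ^ n - 1)
  q ^ n - 1 < L.prod * c ^ (t + 1) &&
    4 ^ (L.length + 1) * (1 + t + 2 * m) ^ 2 * q ^ 4 * (q * c) ^ 2 <
      q ^ n * (q * c - t * q - 2 * m * c) ^ 2

theorem exists_primitive_one_normal_pair_of_sieveCheck (Fq F : Type*) [Field Fq] [Field F]
    [Fintype Fq] [Fintype F] [Algebra Fq F] {p m a : ℕ} [Fact p.Prime] [CharP Fq p] (hm : m ≠ 0)
    (hn : Module.finrank Fq F = m * p ^ a) (hn2 : 2 ≤ Module.finrank Fq F)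
    {c t : ℕ} (hc0 : 0 < c) (hc : c ≤ 101)
    (h : sieveCheck (Fintype.card Fq) (Module.finrank Fq F) m c t = true) :
    ∃ α : F, α ≠ 0 ∧ orderOf α = Fintype.card F - 1 ∧ orderOf α⁻¹ = Fintype.card F - 1 ∧
      IsKNormal Fq (Fintype.card Fq) (Module.finrank Fq F) 1 α ∧
      IsKNormal Fq (Fintype.card Fq) (Module.finrank Fq F) 1 α⁻¹ := by
  classical
  have hQ : Fintype.card F = Fintype.card Fq ^ Module.finrank Fq F :=
    Module.card_eq_pow_finrank (K := Fq) (V := F)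
  have hN : Fintype.card F - 1 ≠ 0 := by
    have := Fintype.one_lt_card (α := F)
    omega
  simp only [sieveCheck, Bool.and_eq_true, decide_eq_true_eq, ← hQ] at h
  obtain ⟨h1, h2⟩ := h
  set N := Fintype.card F - 1 with hNdef
  set L := smallPrimeDivisors c N with hL
  have hnodup : L.Nodup := List.Nodup.filter _ (by decide)
  have hmemL : ∀ ℓ, ℓ ∈ L ↔ ℓ ∈ N.primeFactors ∧ ℓ < c := by
    intro ℓ
    rw [hL, smallPrimeDivisors, List.mem_filter, Bool.and_eq_true, decide_eq_true_eq, beq_iff_eq,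
      ← Nat.dvd_iff_mod_eq_zero, Nat.mem_primeFactors]
    constructor
    · rintro ⟨h, h', h''⟩
      exact ⟨⟨prime_of_mem_smallPrimes h, h'', hN⟩, h'⟩
    · rintro ⟨⟨h, h', -⟩, h''⟩
      exact ⟨mem_smallPrimes h (h''.trans_le hc), h'', h'⟩
  set L₂ := N.primeFactors.filter (fun ℓ => ¬ ℓ < c) with hL₂
  have hL₁ : L.toFinset = N.primeFactors.filter (fun ℓ => ℓ < c) := by
    ext ℓ
    rw [List.mem_toFinset, hmemL, Finset.mem_filter]
  have hc₂ : ∀ ℓ ∈ L₂, c ≤ ℓ := fun ℓ hℓ => not_lt.mp (Finset.mem_filter.mp hℓ).2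
  have hcard : L₂.card ≤ t := by
    have hprod : L.prod * c ^ L₂.card ≤ N := calc
      L.prod * c ^ L₂.card ≤ (∏ ℓ ∈ L.toFinset, ℓ) * ∏ ℓ ∈ L₂, ℓ := by
        rw [List.prod_toFinset _ hnodup, List.map_id']
        exact Nat.mul_le_mul_left _ (Finset.pow_card_le_prod _ _ _ hc₂)
      _ = ∏ ℓ ∈ N.primeFactors, ℓ := by
        rw [hL₁, hL₂, Finset.prod_filter_mul_prod_filter_not]
      _ ≤ N := Nat.le_of_dvd (Nat.pos_of_ne_zero hN) (Nat.prod_primeFactors_dvd N)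
    by_contra! hlt
    have : L.prod * c ^ (t + 1) ≤ L.prod * c ^ L₂.card :=
      Nat.mul_le_mul_left _ (Nat.pow_le_pow_right hc0 hlt)
    omega
  refine exists_primitive_one_normal_pair_of_partition Fq F hm hn hn2 (L₁ := L.toFinset)
    (L₂ := L₂) ?_ ?_ ?_
  · rw [hL₁]
    exact Finset.disjoint_filter_filter_not _ _ _
  · rw [hL₁]
    exact Finset.filter_union_filter_not_eq _ _
  · refine sieve_inequality_of_nat Fintype.card_pos hc0 hcard ?_
      (by rwa [List.toFinset_card_of_nodup hnodup])
    have hc' : (0 : ℝ) < c := by exact_mod_cast hc0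
    calc ∑ ℓ ∈ L₂, (ℓ : ℝ)⁻¹ ≤ ∑ ℓ ∈ L₂, (c : ℝ)⁻¹ := by
          refine Finset.sum_le_sum fun ℓ hℓ => ?_
          have : (c : ℝ) ≤ ℓ := by exact_mod_cast hc₂ ℓ hℓ
          gcongr
      _ = L₂.card / c := by rw [Finset.sum_const, nsmul_eq_mul, div_eq_mul_inv]
      _ ≤ t / c := by gcongr

/-- A bound for the number of prime divisors of `N`. -/
lemma pow_card_primeFactors_le {N : ℕ} (hN : N ≠ 0) :
    (64 : ℝ) ^ N.primeFactors.card ≤ 2 ^ 32 * N := by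
  classical
  set S := smallPrimes.toFinset.filter (· < 64) with hS
  have hpos : ∀ ℓ ∈ N.primeFactors, (0 : ℝ) < ℓ := fun ℓ hℓ => by
    exact_mod_cast Nat.pos_of_mem_primeFactors hℓ
  have h1 : ∏ ℓ ∈ N.primeFactors, (64 / ℓ : ℝ) ≤ ∏ ℓ ∈ N.primeFactors.filter (· < 64),
      (64 / ℓ : ℝ) := by
    rw [← Finset.prod_filter_mul_prod_filter_not N.primeFactors (· < 64)]
    refine mul_le_of_le_one_right (Finset.prod_nonneg fun _ _ => by positivity)
      (Finset.prod_le_one (fun _ _ => by positivity) fun ℓ hℓ => ?_)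
    obtain ⟨h, h'⟩ := Finset.mem_filter.mp hℓ
    rw [div_le_one (hpos ℓ h)]
    exact_mod_cast not_lt.mp h'
  have h2 : ∏ ℓ ∈ N.primeFactors.filter (· < 64), (64 / ℓ : ℝ) ≤ ∏ ℓ ∈ S, (64 / ℓ : ℝ) := by
    refine Finset.prod_le_prod_of_subset_of_one_le ?_ (fun _ _ => by positivity) ?_
    · intro ℓ hℓ
      obtain ⟨h, h'⟩ := Finset.mem_filter.mp hℓ
      exact Finset.mem_filter.mpr ⟨List.mem_toFinset.mpr
        (mem_smallPrimes (Nat.prime_of_mem_primeFactors h) (by omega)), h'⟩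
    · intro ℓ hℓ _
      obtain ⟨h, h'⟩ := Finset.mem_filter.mp hℓ
      have h0 : (0 : ℝ) < ℓ := by
        exact_mod_cast (prime_of_mem_smallPrimes (List.mem_toFinset.mp h)).pos
      rw [one_le_div h0]
      exact_mod_cast h'.le
  have h3 : ∏ ℓ ∈ S, (64 / ℓ : ℝ) ≤ 2 ^ 32 := by
    have : S = {2, 3, 5, 7, 11, 13, 17, 19, 23, 29, 31, 37, 41, 43, 47, 53, 59, 61} := by
      rw [hS]
      decide
    rw [this]
    norm_num
  have h4 : (∏ ℓ ∈ N.primeFactors, (ℓ : ℝ)) ≤ N := by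
    rw [← Nat.cast_prod]
    exact_mod_cast Nat.le_of_dvd (Nat.pos_of_ne_zero hN) (Nat.prod_primeFactors_dvd N)
  calc (64 : ℝ) ^ N.primeFactors.card
      = (∏ ℓ ∈ N.primeFactors, (64 / ℓ : ℝ)) * ∏ ℓ ∈ N.primeFactors, (ℓ : ℝ) := by
        rw [← Finset.prod_mul_distrib, ← Finset.prod_const]
        exact Finset.prod_congr rfl fun ℓ hℓ => (div_mul_cancel₀ _ (hpos ℓ hℓ).ne').symm
    _ ≤ 2 ^ 32 * N := by
        refine mul_le_mul (h1.trans (h2.trans h3)) h4 ?_ (by positivity)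
        exact Finset.prod_nonneg fun _ _ => by positivity

theorem exists_primitive_one_normal_pair_of_large (Fq F : Type*) [Field Fq] [Field F]
    [Fintype Fq] [Fintype F] [Algebra Fq F] {p m a : ℕ} [Fact p.Prime] [CharP Fq p] (hm : m ≠ 0)
    (hn : Module.finrank Fq F = m * p ^ a) (hn2 : 2 ≤ Module.finrank Fq F)
    (hmq : 4 * m ≤ Fintype.card Fq)
    (h : 2 ^ 44 * (1 + 2 * m) ^ 6 * Fintype.card Fq ^ 12 <
      Fintype.card Fq ^ (2 * Module.finrank Fq F)) :
    ∃ α : F, α ≠ 0 ∧ orderOf α = Fintype.card F - 1 ∧ orderOf α⁻¹ = Fintype.card F - 1 ∧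
      IsKNormal Fq (Fintype.card Fq) (Module.finrank Fq F) 1 α ∧
      IsKNormal Fq (Fintype.card Fq) (Module.finrank Fq F) 1 α⁻¹ := by
  have hQ : Fintype.card F = Fintype.card Fq ^ Module.finrank Fq F :=
    Module.card_eq_pow_finrank (K := Fq) (V := F)
  have hQ1 := Fintype.one_lt_card (α := F)
  have hq0 : 0 < Fintype.card Fq := Fintype.card_pos
  refine exists_primitive_one_normal_pair_of_partition Fq F hm hn hn2
    (L₁ := (Fintype.card F - 1).primeFactors) (L₂ := ∅) (Finset.disjoint_empty_right _)
    (Finset.union_empty _) ?_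
  refine sieve_inequality_of_nat (t := 0) (c := 1) hq0 one_pos (by simp) (by simp) ?_
  set w := (Fintype.card F - 1).primeFactors.card
  set q := Fintype.card Fq
  set Q := Fintype.card F
  have hw : 64 ^ w ≤ 2 ^ 32 * Q := by
    have h1 := pow_card_primeFactors_le (N := Q - 1) (by omega)
    have h2 : 64 ^ w ≤ 2 ^ 32 * (Q - 1) := by exact_mod_cast h1
    omega
  have hcube : (4 ^ (w + 2) * (1 + 2 * m) ^ 2 * q ^ 4) ^ 3 < Q ^ 3 := calc
    (4 ^ (w + 2) * (1 + 2 * m) ^ 2 * q ^ 4) ^ 3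
      = 64 ^ w * (2 ^ 12 * (1 + 2 * m) ^ 6 * q ^ 12) := by
        rw [show 64 = 4 ^ 3 by norm_num, ← pow_mul, mul_comm 3 w, pow_mul]
        ring
    _ ≤ 2 ^ 32 * Q * (2 ^ 12 * (1 + 2 * m) ^ 6 * q ^ 12) := Nat.mul_le_mul_right _ hw
    _ = Q * (2 ^ 44 * (1 + 2 * m) ^ 6 * q ^ 12) := by ring
    _ < Q * q ^ (2 * Module.finrank Fq F) := Nat.mul_lt_mul_of_pos_left h (by omega)
    _ = Q ^ 3 := by
        rw [mul_comm 2, pow_mul, ← hQ]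
        ring
  have hlt := lt_of_pow_lt_pow_left₀ 3 (Nat.zero_le _) hcube
  have hD : q ≤ 2 * (q - 2 * m) := by omega
  have hD2 : q ^ 2 ≤ 4 * (q - 2 * m) ^ 2 := by
    calc q ^ 2 ≤ (2 * (q - 2 * m)) ^ 2 := Nat.pow_le_pow_left hD 2
      _ = _ := by ring
  have hq2 : 0 < q ^ 2 := by positivity
  simp only [zero_mul, mul_one, Nat.sub_zero, add_zero]
  refine Nat.lt_of_mul_lt_mul_left (a := 4) ?_
  calc 4 * (4 ^ (w + 1) * (1 + 2 * m) ^ 2 * q ^ 4 * q ^ 2)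
      = (4 ^ (w + 2) * (1 + 2 * m) ^ 2 * q ^ 4) * q ^ 2 := by ring
    _ < Q * q ^ 2 := Nat.mul_lt_mul_of_pos_right hlt hq2
    _ ≤ Q * (4 * (q - 2 * m) ^ 2) := Nat.mul_le_mul_left _ hD2
    _ = 4 * (Q * (q - 2 * m) ^ 2) := by ring

section ListArithmetic

/-- The value at `x` of the polynomial with the given list of coefficients, lowest degree first. -/
def evalList {R : Type*} [CommRing R] (x : R) : List ℕ → R
  | [] => 0
  | c :: l => c + x * evalList x l

/-- Apply `k` to `l` after evaluating all entries of `l`. -/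
def forceList {α : Type*} (l : List ℕ) : (List ℕ → α) → α :=
  List.rec (fun k => k []) (fun c _ ih k => Nat.rec (ih fun l => k (0 :: l))
    (fun d _ => ih fun l => k (Nat.succ d :: l)) c) l

/-- The coefficient list of `c * b + r` modulo `p`. -/
def axpyList (p c : ℕ) (b : List ℕ) : List ℕ → List ℕ :=
  List.rec (fun r => r) (fun d _ ih r => List.rec (Nat.mod (Nat.mul c d) p :: ih [])
    (fun e r _ => Nat.mod (Nat.add e (Nat.mul c d)) p :: ih r) r) b

/-- The coefficient list of `c * b + r` modulo `p`, with a shortcut for `c = 0`. -/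
def axpyListFast (p c : ℕ) (b r : List ℕ) : List ℕ := Nat.rec r (fun _ _ => axpyList p c b r) c

/-- Subtraction of coefficient lists modulo `p`. -/
def subList (p : ℕ) (a b : List ℕ) : List ℕ := axpyList p (p - 1) b a

/-- Multiplication of coefficient lists modulo `p`. -/
def prodList (p : ℕ) (a b : List ℕ) : List ℕ :=
  List.rec [] (fun c _ r => axpyListFast p c b (0 :: r)) a

/-- Apply `k` to the first `n` entries and to the remaining entries of a list. -/
def takeDrop {α : Type*} (n : ℕ) : List ℕ → (List ℕ → List ℕ → α) → α :=
  Nat.rec (fun l k => k [] l) (fun _ ih l k => List.rec (k [] [])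
    (fun c l _ => ih l fun t d => k (c :: t) d) l) n

/-- Multiplication of coefficient lists modulo `p` and modulo `X ^ N - f`, where `N` is the length
of `f`. -/
def mulList (p : ℕ) (f a b : List ℕ) : List ℕ :=
  forceList a fun a => forceList b fun b =>
    List.rec [] (fun c _ r => forceList r fun r => axpyListFast p c b
      (takeDrop f.length (0 :: r) fun t d => List.rec t
        (fun c d _ => axpyList p 1 (0 :: prodList p d f) (axpyListFast p c f t)) d)) a

/-- Exponentiation of coefficient lists by squaring, for exponents `e < 2 ^ i`. -/
def powList (p : ℕ) (f : List ℕ) : ℕ → List ℕ → ℕ → List ℕ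
  | 0, _, _ => [1]
  | i + 1, a, e =>
    bif e == 0 then [1] else
    bif e % 2 == 1 then mulList p f a (powList p f i (mulList p f a a) (e / 2))
    else powList p f i (mulList p f a a) (e / 2)

/-- Are all coefficients divisible by `p`? -/
def isZeroList (p : ℕ) (l : List ℕ) : Bool := l.all fun c => c % p == 0

variable {R : Type*} [CommRing R] {p : ℕ} {x : R}

lemma forceList_eq {α : Type*} (l : List ℕ) (k : List ℕ → α) : forceList l k = k l := by
  induction l generalizing k with
  | nil => rfl
  | cons c l ih =>
    cases c with
    | zero => exact ih _
    | succ c => exact ih _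

lemma takeDrop_eq {α : Type*} (n : ℕ) (l : List ℕ) (k : List ℕ → List ℕ → α) :
    takeDrop n l k = k (l.take n) (l.drop n) := by
  induction n generalizing l k with
  | zero => rfl
  | succ n ih =>
    cases l with
    | nil => rfl
    | cons c l => exact ih _ _

lemma cast_mod_eq (hp : (p : R) = 0) (c : ℕ) : ((c % p : ℕ) : R) = c := by
  conv_rhs => rw [← Nat.mod_add_div c p]
  simp [hp]

lemma evalList_axpyList (hp : (p : R) = 0) (c : ℕ) (b r : List ℕ) :
    evalList x (axpyList p c b r) = c * evalList x b + evalList x r := by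
  induction b generalizing r with
  | nil => simp [axpyList, evalList]
  | cons d b ih =>
    cases r with
    | nil =>
      calc evalList x (axpyList p c (d :: b) [])
          = ((c * d % p : ℕ) : R) + x * evalList x (axpyList p c b []) := rfl
        _ = _ := by
          rw [ih, cast_mod_eq hp]
          simp only [evalList]
          push_cast
          ring
    | cons e r =>
      calc evalList x (axpyList p c (d :: b) (e :: r))
          = (((e + c * d) % p : ℕ) : R) + x * evalList x (axpyList p c b r) := rfl
        _ = _ := by
          rw [ih, cast_mod_eq hp]
          simp only [evalList]
          push_cast
          ring

lemma evalList_axpyListFast (hp : (p : R) = 0) (c : ℕ) (b r : List ℕ) :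
    evalList x (axpyListFast p c b r) = c * evalList x b + evalList x r := by
  cases c with
  | zero => simp [axpyListFast]
  | succ c => exact evalList_axpyList hp (c + 1) b r

lemma evalList_subList (hp0 : 0 < p) (hp : (p : R) = 0) (a b : List ℕ) :
    evalList x (subList p a b) = evalList x a - evalList x b := by
  rw [subList, evalList_axpyList hp, Nat.cast_pred hp0, hp]
  ring

lemma evalList_prodList (hp : (p : R) = 0) (a b : List ℕ) :
    evalList x (prodList p a b) = evalList x a * evalList x b := by
  induction a with
  | nil => simp [prodList, evalList]
  | cons c a ih =>
    calc evalList x (prodList p (c :: a) b)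
        = evalList x (axpyListFast p c b (0 :: prodList p a b)) := rfl
      _ = _ := by
        rw [evalList_axpyListFast hp]
        simp only [evalList, ih]
        push_cast
        ring

lemma evalList_take_add_drop (l : List ℕ) (i : ℕ) :
    evalList x (l.take i) + x ^ i * evalList x (l.drop i) = evalList x l := by
  induction l generalizing i with
  | nil => simp [evalList]
  | cons c l ih =>
    cases i with
    | zero => simp [evalList]
    | succ i =>
      simp only [List.take_succ_cons, List.drop_succ_cons, evalList, ← ih i]
      ring

variable {f : List ℕ}

lemma evalList_mulList (hp : (p : R) = 0) (hf : x ^ f.length = evalList x f) (a b : List ℕ) :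
    evalList x (mulList p f a b) = evalList x a * evalList x b := by
  simp only [mulList, forceList_eq, takeDrop_eq]
  induction a with
  | nil => simp [evalList]
  | cons c a ih =>
    dsimp only
    generalize List.rec (motive := fun _ => List ℕ) _ _ a = r at ih ⊢
    have hred : ∀ t d : List ℕ, evalList x (List.rec (motive := fun _ => List ℕ) t
        (fun c d _ => axpyList p 1 (0 :: prodList p d f) (axpyListFast p c f t)) d) =
        evalList x t + evalList x d * evalList x f := by
      intro t d
      cases d with
      | nil => simp [evalList]
      | cons c d =>
        dsimp only
        rw [evalList_axpyList hp, evalList_axpyListFast hp]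
        simp only [evalList, evalList_prodList hp]
        push_cast
        ring
    rw [evalList_axpyListFast hp, hred, ← hf, mul_comm (evalList x _) (x ^ _),
      evalList_take_add_drop]
    simp only [evalList, ih]
    push_cast
    ring

lemma evalList_powList (hp : (p : R) = 0) (hf : x ^ f.length = evalList x f) (i : ℕ) (a : List ℕ)
    {e : ℕ} (he : e < 2 ^ i) : evalList x (powList p f i a e) = evalList x a ^ e := by
  induction i generalizing a e with
  | zero =>
    obtain rfl : e = 0 := by omega
    simp [powList, evalList]
  | succ i ih =>
    have he' : e / 2 < 2 ^ i := by
      rw [pow_succ] at he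
      omega
    have hdiv := Nat.div_add_mod e 2
    rw [powList, Bool.cond_eq_ite, Bool.cond_eq_ite]
    split_ifs with h0 h1
    · rw [beq_iff_eq] at h0
      simp [h0, evalList]
    · rw [beq_iff_eq] at h1
      rw [evalList_mulList hp hf, ih _ he', evalList_mulList hp hf, ← pow_two, ← pow_mul,
        ← pow_succ', ← h1, hdiv]
    · have h1' : e % 2 = 0 := by
        rw [beq_iff_eq] at h1
        omega
      rw [ih _ he', evalList_mulList hp hf, ← pow_two, ← pow_mul]
      rw [h1', add_zero] at hdiv
      rw [hdiv]

lemma evalList_eq_zero_of_isZeroList (hp : (p : R) = 0) {l : List ℕ} (h : isZeroList p l = true) :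
    evalList x l = 0 := by
  induction l with
  | nil => rfl
  | cons c l ih =>
    simp only [isZeroList, List.all_cons, Bool.and_eq_true, beq_iff_eq] at h ih
    rw [evalList, ih h.2, ← cast_mod_eq hp, h.1]
    simp

/-- The `q`-th power of a coefficient list, for `q < 16`. -/
def frobList (p : ℕ) (f : List ℕ) (q : ℕ) (l : List ℕ) : List ℕ := powList p f 4 l q

/-- The sum of `l ^ q ^ i` over `i < m`. -/
def conjSumList (p : ℕ) (f : List ℕ) (q : ℕ) : ℕ → List ℕ → List ℕ
  | 0, _ => []
  | m + 1, l => axpyList p 1 l (conjSumList p f q m (frobList p f q l))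

variable {q : ℕ}

lemma evalList_iterate_frobList (hp : (p : R) = 0) (hf : x ^ f.length = evalList x f)
    (hq : q < 16) (i : ℕ) (l : List ℕ) :
    evalList x ((frobList p f q)^[i] l) = evalList x l ^ q ^ i := by
  induction i generalizing l with
  | zero => simp
  | succ i ih =>
    rw [Function.iterate_succ_apply, ih, frobList, evalList_powList hp hf 4 l hq, ← pow_mul,
      pow_succ']

lemma evalList_conjSumList (hp : (p : R) = 0) (hf : x ^ f.length = evalList x f)
    (hq : q < 16) (m : ℕ) (l : List ℕ) :
    evalList x (conjSumList p f q m l) = ∑ i ∈ Finset.range m, evalList x l ^ q ^ i := by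
  induction m generalizing l with
  | zero => simp [conjSumList, evalList]
  | succ m ih =>
    rw [conjSumList, evalList_axpyList hp, ih, frobList, evalList_powList hp hf 4 l hq,
      Finset.sum_range_succ', add_comm, Nat.cast_one, one_mul]
    congr 1
    · refine Finset.sum_congr rfl fun i _ => ?_
      rw [← pow_mul, pow_succ']
    · rw [pow_zero, pow_one]

/-- The element obtained from `β` by applying `(X ^ m - 1) ^ (r + 1) / (X - 1)`. -/
def normalPartList (p : ℕ) (f : List ℕ) (q m r : ℕ) (β : List ℕ) : List ℕ :=
  (fun z => subList p ((frobList p f q)^[m] z) z)^[r] (conjSumList p f q m β)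

/-- Does `δ` witness that the element `β` is `1`-normal? -/
def normalCheck (p : ℕ) (f : List ℕ) (q m r : ℕ) (δ β : List ℕ) : Bool :=
  let γ := normalPartList p f q m r β
  isZeroList p (subList p ((frobList p f q)^[m] γ) γ) &&
    (List.range (2 * m - 1)).all fun e => isZeroList p (subList p
      (conjSumList p f q m (mulList p f δ ((frobList p f q)^[e + 1] γ)))
      (bif e + 1 == m then [1] else []))

/-- Does `w` witness that `X` has order `M` modulo `X ^ N - f`, where `L` is the list of prime
divisors of `M`? -/
def orderCheck (p : ℕ) (f : List ℕ) (M : ℕ) (L w : List ℕ) : Bool :=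
  isZeroList p (subList p (L.foldr (fun ℓ r =>
    mulList p f (subList p (powList p f 64 [0, 1] (M / ℓ)) [1]) r) w) [1])

end ListArithmetic

section Certificate

variable {Fq F : Type*} [Field Fq] [Field F] [Fintype Fq] [Algebra Fq F]

/-- A dual element `δ` witnesses that the conjugates of `γ` are linearly independent. -/
lemma aeval_frobeniusEnd_ne_zero_of_dual {m : ℕ} {γ δ : F}
    (h : ∀ e < 2 * m - 1, ∑ i ∈ Finset.range m,
      (δ * γ ^ Fintype.card Fq ^ (e + 1)) ^ Fintype.card Fq ^ i = if e + 1 = m then 1 else 0)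
    {g : Fq[X]} (hg0 : g ≠ 0) (hg : g.natDegree < m) : aeval (frobeniusEnd Fq F) g γ ≠ 0 := by
  intro h0
  set φ := frobeniusEnd Fq F with hφ
  set k := g.natDegree with hk
  set Λ : Module.End Fq F := aeval φ (geomPoly Fq m) * LinearMap.mulLeft Fq δ with hΛ
  have hΛe : ∀ e < 2 * m - 1, Λ ((φ ^ (e + 1)) γ) = if e + 1 = m then 1 else 0 := by
    intro e he
    rw [← h e he, hΛ, Module.End.mul_apply, LinearMap.mulLeft_apply, geomPoly, map_sum,
      LinearMap.sum_apply]
    simp only [map_pow, aeval_X, hφ, frobeniusEnd_pow_apply]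
  have h1 : Λ ((φ ^ (m - k)) (aeval φ g γ)) = algebraMap Fq F (g.coeff k) := by
    rw [aeval_eq_sum_range, LinearMap.sum_apply, map_sum, map_sum]
    rw [Finset.sum_eq_single k]
    · rw [LinearMap.smul_apply, map_smul, map_smul, ← Module.End.mul_apply (φ ^ (m - k)),
        ← pow_add, show m - k + k = (m - 1) + 1 by omega, hΛe _ (by omega), if_pos (by omega),
        Algebra.smul_def, mul_one]
    · intro j hj hjk
      rw [Finset.mem_range] at hj
      rw [LinearMap.smul_apply, map_smul, map_smul, ← Module.End.mul_apply (φ ^ (m - k)),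
        ← pow_add, show m - k + j = (m - k + j - 1) + 1 by omega, hΛe _ (by omega),
        if_neg (by omega), smul_zero]
    · intro hj
      exact absurd (Finset.mem_range.mpr (Nat.lt_succ_self k)) hj
  rw [h0, map_zero, map_zero, eq_comm, map_eq_zero, coeff_natDegree, leadingCoeff_eq_zero] at h1
  exact hg0 h1

lemma geomPoly_eq_mul_of_charP {K : Type*} [Field K] {p m a r : ℕ} [Fact p.Prime] [CharP K p]
    (hr : p ^ a = r + 2) :
    geomPoly K (m * p ^ a) = (X ^ m - 1) * ((X ^ m - 1) ^ r * geomPoly K m) := by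
  have hX : (X - 1 : K[X]) ≠ 0 := X_sub_C_ne_zero 1
  refine mul_right_cancel₀ hX ?_
  calc geomPoly K (m * p ^ a) * (X - 1) = (X ^ m - 1) ^ p ^ a := by
        rw [geomPoly_mul, sub_pow_char_pow, one_pow, ← pow_mul]
    _ = _ := by
        rw [hr, mul_assoc, mul_assoc, geomPoly_mul]
        ring

theorem isKNormal_one_of_dual {p m a r : ℕ} [Fact p.Prime] [CharP Fq p] (hm : m ≠ 0)
    (hr : p ^ a = r + 2) {β γ δ : F}
    (hγ : aeval (frobeniusEnd Fq F) ((X ^ m - 1) ^ r * geomPoly Fq m) β = γ)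
    (hγm : γ ^ Fintype.card Fq ^ m = γ)
    (h : ∀ e < 2 * m - 1, ∑ i ∈ Finset.range m,
      (δ * γ ^ Fintype.card Fq ^ (e + 1)) ^ Fintype.card Fq ^ i = if e + 1 = m then 1 else 0) :
    IsKNormal Fq (Fintype.card Fq) (m * p ^ a) 1 β := by
  have hn : m * p ^ a ≠ 0 := mul_ne_zero hm (by omega)
  have hXm : (X ^ m - 1 : Fq[X]) ≠ 0 := X_pow_sub_C_ne_zero (Nat.pos_of_ne_zero hm) 1
  refine isKNormal_one_of_annihilator hn ?_ fun P g hPm hPi hPg => ?_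
  · rw [geomPoly_eq_mul_of_charP hr, map_mul, Module.End.mul_apply, hγ, map_sub, map_pow, aeval_X,
      LinearMap.sub_apply, frobeniusEnd_pow_apply, hγm, map_one, Module.End.one_apply, sub_self]
  · obtain ⟨h', hh'⟩ : P ∣ (X ^ m - 1 : Fq[X]) := by
      refine hPi.prime.dvd_of_dvd_pow (n := p ^ a) ?_
      rw [sub_pow_char_pow, one_pow, ← pow_mul, ← geomPoly_mul, hPg, mul_assoc]
      exact dvd_mul_right _ _
    have hg : g = h' * ((X ^ m - 1) ^ r * geomPoly Fq m) := by
      refine mul_left_cancel₀ hPm.ne_zero ?_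
      rw [← hPg, geomPoly_eq_mul_of_charP hr, ← mul_assoc P h', ← hh']
    have hh0 : h' ≠ 0 := by
      rintro rfl
      exact hXm (by rw [hh', mul_zero])
    rw [hg, map_mul, Module.End.mul_apply, hγ]
    refine aeval_frobeniusEnd_ne_zero_of_dual h hh0 ?_
    have hdeg : (X ^ m - 1 : Fq[X]).natDegree = m := natDegree_X_pow_sub_C (r := 1)
    rw [hh', natDegree_mul hPm.ne_zero hh0] at hdeg
    have := hPi.natDegree_pos
    omega

theorem isKNormal_one_of_normalCheck {p m a r : ℕ} [Fact p.Prime] [CharP Fq p] (hm : m ≠ 0)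
    (hr : p ^ a = r + 2) (hq : Fintype.card Fq < 16) {f : List ℕ} {x : F}
    (hf : x ^ f.length = evalList x f) {δ β : List ℕ}
    (h : normalCheck p f (Fintype.card Fq) m r δ β = true) :
    IsKNormal Fq (Fintype.card Fq) (m * p ^ a) 1 (evalList x β) := by
  have hp0 : 0 < p := (Fact.out : p.Prime).pos
  have hp : (p : F) = 0 := by
    rw [← map_natCast (algebraMap Fq F), CharP.cast_eq_zero, map_zero]
  simp only [normalCheck, Bool.and_eq_true, List.all_eq_true, List.mem_range] at h
  obtain ⟨h1, h2⟩ := h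
  refine isKNormal_one_of_dual (γ := evalList x (normalPartList p f (Fintype.card Fq) m r β))
    (δ := evalList x δ) hm hr ?_ ?_ ?_
  · have hstep : ∀ i z, evalList x
        ((fun z => subList p ((frobList p f (Fintype.card Fq))^[m] z) z)^[i] z) =
        aeval (frobeniusEnd Fq F) ((X ^ m - 1 : Fq[X]) ^ i) (evalList x z) := by
      intro i
      induction i with
      | zero => simp
      | succ i ih =>
        intro z
        rw [Function.iterate_succ_apply, ih, pow_succ, map_mul, Module.End.mul_apply,
          evalList_subList hp0 hp, evalList_iterate_frobList hp hf hq, map_sub (aeval _) (X ^ m),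
          map_pow (aeval _) X, aeval_X, LinearMap.sub_apply, frobeniusEnd_pow_apply, map_one,
          Module.End.one_apply]
    rw [normalPartList, hstep, map_mul, Module.End.mul_apply, evalList_conjSumList hp hf hq,
      geomPoly, map_sum, LinearMap.sum_apply]
    simp only [map_pow, aeval_X, frobeniusEnd_pow_apply]
  · have h3 := evalList_eq_zero_of_isZeroList (x := x) hp h1
    rwa [evalList_subList hp0 hp, evalList_iterate_frobList hp hf hq, sub_eq_zero] at h3
  · intro e he
    have h3 := evalList_eq_zero_of_isZeroList (x := x) hp (h2 e he)
    rw [evalList_subList hp0 hp, evalList_conjSumList hp hf hq, evalList_mulList hp hf,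
      evalList_iterate_frobList hp hf hq, sub_eq_zero] at h3
    rw [h3, Bool.cond_eq_ite]
    simp only [beq_iff_eq]
    split_ifs <;> simp [evalList]

lemma orderOf_eq_of_orderCheck {p M : ℕ} (hp0 : 0 < p) (hp : (p : F) = 0) {f : List ℕ} {x : F}
    (hf : x ^ f.length = evalList x f) (hM0 : 0 < M) (hM : M < 2 ^ 64) {L w : List ℕ}
    (hL : ∀ ℓ ∈ L, ℓ.Prime) (hML : M ∣ L.prod ^ 64) (hx : x ^ M = 1)
    (h : orderCheck p f M L w = true) : orderOf x = M := by
  have h1 := evalList_eq_zero_of_isZeroList (x := x) hp h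
  rw [evalList_subList hp0 hp, sub_eq_zero] at h1
  have hkey : ∀ L' : List ℕ, evalList x (L'.foldr (fun ℓ r =>
      mulList p f (subList p (powList p f 64 [0, 1] (M / ℓ)) [1]) r) w) =
      (L'.map fun ℓ => x ^ (M / ℓ) - 1).prod * evalList x w := by
    intro L'
    induction L' with
    | nil => simp
    | cons ℓ L' ih =>
      rw [List.foldr_cons, evalList_mulList hp hf, ih, evalList_subList hp0 hp,
        evalList_powList hp hf _ _ ((Nat.div_le_self _ _).trans_lt hM), List.map_cons,
        List.prod_cons]
      simp [evalList, mul_assoc]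
  rw [hkey] at h1
  refine orderOf_eq_of_pow_and_pow_div_prime hM0 hx fun ℓ hℓ hdvd hone => ?_
  have hmem : ℓ ∈ L := by
    obtain ⟨ℓ', hℓ', hd⟩ := (hℓ.prime.dvd_prod_iff).mp
      (hℓ.prime.dvd_of_dvd_pow (hdvd.trans hML))
    rwa [(Nat.prime_dvd_prime_iff_eq hℓ (hL ℓ' hℓ')).mp hd]
  have hzero : (L.map fun ℓ => x ^ (M / ℓ) - 1).prod = 0 :=
    List.prod_eq_zero (List.mem_map.mpr ⟨ℓ, hmem, by rw [hone, sub_self]⟩)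
  rw [hzero, zero_mul] at h1
  simp [evalList] at h1

lemma degree_evalList_lt (f : List ℕ) :
    (evalList (X : F[X]) f).degree < f.length := by
  induction f with
  | nil => simp [evalList]
  | cons c f ih =>
    rw [evalList, List.length_cons]
    refine (degree_add_le _ _).trans_lt (max_lt ?_ ?_)
    · refine (degree_natCast_le c).trans_lt ?_
      exact_mod_cast Nat.succ_pos _
    · rw [mul_comm, degree_mul_X]
      push_cast
      exact WithBot.add_lt_add_right (by simp) ih

lemma evalList_map {R S : Type*} [CommRing R] [CommRing S] (φ : R →+* S) (x : R) (f : List ℕ) :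
    φ (evalList x f) = evalList (φ x) f := by
  induction f with
  | nil => simp [evalList]
  | cons c f ih => simp [evalList, ih]

lemma exists_pow_eq_evalList [Fintype F] {p q n : ℕ} (hp0 : 0 < p) (hp : (p : F) = 0) (hq : q < 16)
    (hcard : Fintype.card F = q ^ n) {f : List ℕ} (hf : f ≠ [])
    (h : isZeroList p (subList p ((frobList p f q)^[n] [0, 1]) [0, 1]) = true) :
    ∃ x : F, x ^ f.length = evalList x f := by
  set P : F[X] := X ^ f.length - evalList X f with hP
  have hdeg : P.degree = f.length := by
    rw [hP, degree_sub_eq_left_of_degree_lt] <;> rw [degree_X_pow]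
    exact degree_evalList_lt f
  have hroot : AdjoinRoot.root P ^ f.length = evalList (AdjoinRoot.root P) f := by
    have := AdjoinRoot.mk_self (f := P)
    rwa [hP, map_sub, map_pow, AdjoinRoot.mk_X, evalList_map, AdjoinRoot.mk_X, sub_eq_zero] at this
  have hpA : (p : AdjoinRoot P) = 0 := by
    rw [← map_natCast (AdjoinRoot.of P), hp, map_zero]
  have h1 := evalList_eq_zero_of_isZeroList (x := AdjoinRoot.root P) hpA h
  rw [evalList_subList hp0 hpA, evalList_iterate_frobList hpA hroot hq, ← hcard] at h1
  have hx : evalList (AdjoinRoot.root P) [0, 1] = AdjoinRoot.root P := by simp [evalList]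
  have hdvd : P ∣ X ^ Fintype.card F - X := by
    rw [← AdjoinRoot.mk_eq_zero, map_sub, map_pow, AdjoinRoot.mk_X, ← h1, hx]
  have hsplit : P.Splits := by
    refine Splits.of_dvd ?_ (FiniteField.X_pow_card_sub_X_ne_zero F Fintype.one_lt_card) hdvd
    simpa using (FiniteField.isSplittingField_sub F F).splits
  obtain ⟨x, hx⟩ := hsplit.exists_eval_eq_zero (by
    rw [hdeg]
    simpa using hf)
  refine ⟨x, ?_⟩
  rw [hP, eval_sub, eval_pow, eval_X, sub_eq_zero] at hx
  rw [hx, ← coe_evalRingHom, evalList_map]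
  simp

/-- All conditions on the data of an explicit primitive element. -/
def certificateCheck (p q n m r : ℕ) (f b w δ δ' L : List ℕ) : Bool :=
  isZeroList p (subList p ((frobList p f q)^[n] [0, 1]) [0, 1]) &&
  isZeroList p (subList p (mulList p f [0, 1] b) [1]) &&
  orderCheck p f (q ^ n - 1) L w &&
  normalCheck p f q m r δ [0, 1] && normalCheck p f q m r δ' b &&
  L.prod ^ 64 % (q ^ n - 1) == 0

theorem exists_primitive_one_normal_pair_of_certificate (Fq F : Type*) [Field Fq] [Field F]
    [Fintype Fq] [Fintype F] [Algebra Fq F] {p m a r : ℕ} [Fact p.Prime] [CharP Fq p] (hm : m ≠ 0)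
    (hr : p ^ a = r + 2) (hn : Module.finrank Fq F = m * p ^ a) {q : ℕ}
    (hq : Fintype.card Fq = q) (hq16 : q < 16) {f b w δ δ' L : List ℕ}
    (hf : f ≠ []) (hL : ∀ ℓ ∈ L, ℓ.Prime) (h64 : q ^ (m * p ^ a) < 2 ^ 64)
    (h : certificateCheck p q (m * p ^ a) m r f b w δ δ' L = true) :
    ∃ α : F, α ≠ 0 ∧ orderOf α = Fintype.card F - 1 ∧ orderOf α⁻¹ = Fintype.card F - 1 ∧
      IsKNormal Fq (Fintype.card Fq) (Module.finrank Fq F) 1 α ∧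
      IsKNormal Fq (Fintype.card Fq) (Module.finrank Fq F) 1 α⁻¹ := by
  subst hq
  have hcard : Fintype.card F = Fintype.card Fq ^ (m * p ^ a) := by
    rw [← hn]
    exact Module.card_eq_pow_finrank (K := Fq) (V := F)
  have hp0 : 0 < p := (Fact.out : p.Prime).pos
  have hp : (p : F) = 0 := by
    rw [← map_natCast (algebraMap Fq F), CharP.cast_eq_zero, map_zero]
  simp only [certificateCheck, Bool.and_eq_true, beq_iff_eq, ← hcard] at h h64
  obtain ⟨⟨⟨⟨⟨h1, h2⟩, h3⟩, h4⟩, h5⟩, h6⟩ := h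
  obtain ⟨x, hx⟩ := exists_pow_eq_evalList hp0 hp hq16 hcard hf h1
  have hxX : evalList x [0, 1] = x := by simp [evalList]
  have hxb : x * evalList x b = 1 := by
    have := evalList_eq_zero_of_isZeroList (x := x) hp h2
    rw [evalList_subList hp0 hp, evalList_mulList hp hx, hxX, sub_eq_zero] at this
    rw [this]
    simp [evalList]
  have hx0 : x ≠ 0 := left_ne_zero_of_mul_eq_one hxb
  have hinv : x⁻¹ = evalList x b := inv_eq_of_mul_eq_one_right hxb
  have hQ1 := Fintype.one_lt_card (α := F)
  have hord : orderOf x = Fintype.card F - 1 :=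
    orderOf_eq_of_orderCheck hp0 hp hx (by omega) (by omega) hL (Nat.dvd_of_mod_eq_zero h6)
      (FiniteField.pow_card_sub_one_eq_one x hx0) h3
  refine ⟨x, hx0, hord, ?_, ?_, ?_⟩
  · rw [← hord, ← Units.val_mk0 hx0, ← Units.val_inv_eq_inv_val, orderOf_units,
      orderOf_units, orderOf_inv]
  · have := isKNormal_one_of_normalCheck (F := F) hm hr hq16 hx h4
    rwa [hxX, ← hn] at this
  · have := isKNormal_one_of_normalCheck (F := F) hm hr hq16 hx h5
    rwa [← hinv, ← hn] at this

end Certificate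

lemma primeFactors_eq_of_prod_dvd {N e : ℕ} (hN : N ≠ 0) {S : Finset ℕ} (hS : ∀ ℓ ∈ S, ℓ.Prime)
    (h₁ : ∏ ℓ ∈ S, ℓ ∣ N) (h₂ : N ∣ (∏ ℓ ∈ S, ℓ) ^ e) : N.primeFactors = S := by
  ext ℓ
  rw [Nat.mem_primeFactors]
  refine ⟨fun ⟨hℓ, hdvd, _⟩ => ?_, fun h => ⟨hS ℓ h, (Finset.dvd_prod_of_mem _ h).trans h₁, hN⟩⟩
  obtain ⟨ℓ', hℓ', hd⟩ := (hℓ.prime.dvd_finsetProd_iff _).mp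
    (hℓ.prime.dvd_of_dvd_pow (hdvd.trans h₂))
  rwa [(Nat.prime_dvd_prime_iff_eq hℓ (hS ℓ' hℓ')).mp hd]

/-- Search for parameters with which the sieve succeeds. -/
def sieveSearch (q n m : ℕ) : Bool :=
  [13, 17, 20, 30, 40, 60].any fun c => (List.range 31).any fun t => sieveCheck q n m c t

theorem exists_primitive_one_normal_pair_of_sieveSearch (Fq F : Type*) [Field Fq] [Field F]
    [Fintype Fq] [Fintype F] [Algebra Fq F] {p m a : ℕ} [Fact p.Prime] [CharP Fq p] (hm : m ≠ 0)
    (hn : Module.finrank Fq F = m * p ^ a) (hn7 : 7 ≤ Module.finrank Fq F) {k : ℕ} (K₀ K : ℕ)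
    (hq : Fintype.card Fq = p ^ k) (hk : K₀ ≤ k) (hmK : 4 * m ≤ p ^ K)
    (hK : 2 ^ 44 * (1 + 2 * m) ^ 6 < (p ^ K) ^ (2 * (m * p ^ a) - 12))
    (h : ∀ k < K, K₀ ≤ k → sieveSearch (p ^ k) (m * p ^ a) m = true) :
    ∃ α : F, α ≠ 0 ∧ orderOf α = Fintype.card F - 1 ∧ orderOf α⁻¹ = Fintype.card F - 1 ∧
      IsKNormal Fq (Fintype.card Fq) (Module.finrank Fq F) 1 α ∧
      IsKNormal Fq (Fintype.card Fq) (Module.finrank Fq F) 1 α⁻¹ := by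
  rcases lt_or_ge k K with hkK | hkK
  · have hs := h k hkK hk
    rw [sieveSearch, List.any_eq_true] at hs
    obtain ⟨c, hc, hs⟩ := hs
    rw [List.any_eq_true] at hs
    obtain ⟨t, -, hs⟩ := hs
    rw [← hq, ← hn] at hs
    have hc' : 0 < c ∧ c ≤ 101 := by
      simp only [List.mem_cons, List.not_mem_nil, or_false] at hc
      omega
    exact exists_primitive_one_normal_pair_of_sieveCheck Fq F hm hn (by omega) hc'.1 hc'.2 hs
  · have hle : p ^ K ≤ Fintype.card Fq := by
      rw [hq]
      exact Nat.pow_le_pow_right (Fact.out : p.Prime).pos hkK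
    refine exists_primitive_one_normal_pair_of_large Fq F hm hn (by omega) (hmK.trans hle) ?_
    calc 2 ^ 44 * (1 + 2 * m) ^ 6 * Fintype.card Fq ^ 12
        < (p ^ K) ^ (2 * (m * p ^ a) - 12) * Fintype.card Fq ^ 12 :=
          Nat.mul_lt_mul_of_pos_right hK (pow_pos Fintype.card_pos _)
      _ ≤ Fintype.card Fq ^ (2 * (m * p ^ a) - 12) * Fintype.card Fq ^ 12 := by gcongr
      _ = Fintype.card Fq ^ (2 * Module.finrank Fq F) := by
          rw [← pow_add, hn, Nat.sub_add_cancel (by omega)]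

theorem exists_primitive_one_normal_pair_of_prod_dvd (Fq F : Type*) [Field Fq] [Field F]
    [Fintype Fq] [Fintype F] [Algebra Fq F] {p m a : ℕ} [Fact p.Prime] [CharP Fq p] (hm : m ≠ 0)
    (hn : Module.finrank Fq F = m * p ^ a) (hn2 : 2 ≤ Module.finrank Fq F) {q : ℕ}
    (hq : Fintype.card Fq = q) {L₁ L₂ : Finset ℕ} (hdisj : Disjoint L₁ L₂)
    (hprime : ∀ ℓ ∈ L₁ ∪ L₂, ℓ.Prime) (e : ℕ) (h₁ : ∏ ℓ ∈ L₁ ∪ L₂, ℓ ∣ q ^ (m * p ^ a) - 1)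
    (h₂ : q ^ (m * p ^ a) - 1 ∣ (∏ ℓ ∈ L₁ ∪ L₂, ℓ) ^ e) (c : ℕ) (hc : 0 < c)
    (hS : ∑ ℓ ∈ L₂, (ℓ : ℝ)⁻¹ ≤ L₂.card / c)
    (h : 4 ^ (L₁.card + 1) * (1 + L₂.card + 2 * m) ^ 2 * q ^ 4 * (q * c) ^ 2 <
      q ^ (m * p ^ a) * (q * c - L₂.card * q - 2 * m * c) ^ 2) :
    ∃ α : F, α ≠ 0 ∧ orderOf α = Fintype.card F - 1 ∧ orderOf α⁻¹ = Fintype.card F - 1 ∧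
      IsKNormal Fq (Fintype.card Fq) (Module.finrank Fq F) 1 α ∧
      IsKNormal Fq (Fintype.card Fq) (Module.finrank Fq F) 1 α⁻¹ := by
  have hQ : Fintype.card F = q ^ (m * p ^ a) := by
    rw [← hn, ← hq]
    exact Module.card_eq_pow_finrank (K := Fq) (V := F)
  have hQ1 := Fintype.one_lt_card (α := F)
  rw [← hQ] at h₁ h₂ h
  refine exists_primitive_one_normal_pair_of_partition Fq F hm hn hn2 hdisj
    (primeFactors_eq_of_prod_dvd (by omega) hprime h₁ h₂).symm ?_
  subst hq
  exact sieve_inequality_of_nat Fintype.card_pos hc le_rfl hS h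

set_option maxRecDepth 10000 in
lemma certificateCheck_7_7 :
    certificateCheck 7 7 7 1 5 [5, 0, 0, 0, 0, 5, 0] [0, 0, 0, 0, 6, 0, 3] [5, 0, 2, 3, 2] [2] [3]
    [2, 3, 29, 4733] = true := by
  decide +kernel

set_option maxRecDepth 10000 in
lemma certificateCheck_8_2 :
    certificateCheck 2 2 8 1 6 [1, 0, 0, 0, 1, 1, 1, 0] [0, 0, 0, 1, 1, 1, 0, 1] [1, 0, 0, 1] [1]
    [1] [3, 5, 17] = true := by
  decide +kernel

set_option maxRecDepth 10000 in
lemma certificateCheck_8_4 :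
    certificateCheck 2 4 8 1 6 [1, 0, 0, 0, 0, 0, 0, 0, 1, 0, 1, 0, 1, 1, 1, 0] [0, 0, 0, 0, 0, 0,
    0, 1, 0, 1, 0, 1, 1, 1, 0, 1] [0, 0, 1, 0, 1, 0, 0, 1, 1, 0, 0, 0, 1, 1] [1] [0, 0, 1, 0, 1,
    0, 0, 1, 0, 1, 0, 0, 1, 1, 1] [3, 5, 17, 257] = true := by
  decide +kernel

set_option maxRecDepth 10000 in
lemma certificateCheck_8_8 :
    certificateCheck 2 8 8 1 6 [1, 0, 0, 0, 0, 0, 0, 0, 0, 0, 0, 0, 0, 0, 0, 0, 1, 1, 0, 1, 1, 0,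
    1, 0] [0, 0, 0, 0, 0, 0, 0, 0, 0, 0, 0, 0, 0, 0, 0, 1, 1, 0, 1, 1, 0, 1, 0, 1] [0, 1, 0, 0, 1,
    1, 0, 0, 1, 1, 1, 1, 0, 1, 1, 1, 1, 1, 0, 0, 1, 1, 0, 1] [1, 0, 1, 1, 0, 0, 0, 1, 1, 0, 1, 1,
    1, 0, 1, 0, 0, 1, 0, 1, 1, 0, 1] [1, 0, 0, 0, 1, 0, 1, 0, 1, 1, 1, 0, 1, 1, 0, 1, 0, 0, 1, 0,
    0, 0, 1] [3, 5, 7, 13, 17, 241] = true := by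
  decide +kernel

set_option maxRecDepth 10000 in
lemma certificateCheck_9_3 :
    certificateCheck 3 3 9 1 7 [2, 0, 0, 0, 0, 2, 0, 2, 0] [0, 0, 0, 0, 2, 0, 2, 0, 2] [2, 0, 2,
    2, 0, 1, 0, 0, 1] [2] [2] [2, 13, 757] = true := by
  decide +kernel

set_option maxRecDepth 10000 in
lemma certificateCheck_10_2 :
    certificateCheck 2 2 10 5 0 [1, 0, 1, 0, 0, 0, 0, 1, 1, 0] [0, 1, 0, 0, 0, 0, 1, 1, 0, 1] [0,
    1, 1, 0, 1, 0, 0, 1, 0, 1] [1, 1, 1, 0, 0, 0, 1, 1, 0, 1] [0, 0, 0, 0, 1, 1, 1, 0, 1] [3, 11,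
    31] = true := by
  decide +kernel

set_option maxRecDepth 10000 in
lemma certificateCheck_10_4 :
    certificateCheck 2 4 10 5 0 [1, 0, 0, 0, 0, 0, 0, 1, 0, 1, 0, 0, 0, 0, 0, 0, 0, 1, 0, 0] [0,
    0, 0, 0, 0, 0, 1, 0, 1, 0, 0, 0, 0, 0, 0, 0, 1, 0, 0, 1] [1, 0, 0, 1, 1, 1, 0, 0, 0, 0, 1, 1,
    1, 0, 1, 0, 0, 1] [0, 0, 1, 1, 0, 0, 0, 0, 1, 1, 0, 1, 0, 0, 0, 1, 0, 1, 0, 1] [1, 1, 1, 0, 0,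
    1, 1, 0, 1, 0, 0, 0, 0, 1, 1, 0, 0, 0, 1, 1] [3, 5, 11, 31, 41] = true := by
  decide +kernel

set_option maxRecDepth 10000 in
lemma certificateCheck_10_8 :
    certificateCheck 2 8 10 5 0 [1, 0, 1, 0, 0, 0, 0, 1, 0, 0, 0, 0, 0, 0, 0, 0, 0, 0, 0, 0, 0, 0,
    0, 0, 0, 0, 1, 0, 0, 0] [0, 1, 0, 0, 0, 0, 1, 0, 0, 0, 0, 0, 0, 0, 0, 0, 0, 0, 0, 0, 0, 0, 0,
    0, 0, 1, 0, 0, 0, 1] [1, 1, 0, 1, 0, 0, 0, 0, 1, 1, 0, 0, 0, 1, 1, 0, 0, 0, 0, 1, 0, 1, 1, 0,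
    0, 1, 1] [0, 1, 0, 0, 1, 1, 1, 1, 1, 1, 1, 0, 0, 0, 0, 1, 1, 0, 0, 1, 0, 0, 1, 0, 1] [0, 0, 1,
    0, 1, 1, 1, 0, 1, 0, 1, 1, 1, 0, 0, 1, 0, 1, 1, 0, 1, 1, 0, 0, 0, 0, 0, 0, 1, 1] [3, 7, 11,
    31, 151, 331] = true := by
  decide +kernel

set_option maxRecDepth 10000 in
lemma certificateCheck_10_5 :
    certificateCheck 5 5 10 2 3 [3, 0, 0, 0, 0, 0, 4, 3, 0, 0] [0, 0, 0, 0, 0, 2, 4, 0, 0, 2] [0,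
    1, 0, 4, 2, 1, 1, 0, 3, 3] [3, 1, 1, 1, 0, 0, 1, 0, 0, 4] [3, 4, 4, 4, 0, 0, 4, 0, 0, 1] [2,
    3, 11, 71, 521] = true := by
  decide +kernel

set_option maxRecDepth 10000 in
lemma certificateCheck_12_2 :
    certificateCheck 2 2 12 3 2 [1, 0, 0, 0, 1, 1, 0, 0, 0, 0, 1, 0] [0, 0, 0, 1, 1, 0, 0, 0, 0,
    1, 0, 1] [1, 0, 0, 0, 1, 1, 1, 0, 1, 1, 1, 1] [1, 1, 0, 0, 1, 0, 1, 1, 0, 0, 0, 1] [0, 0, 0,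
    1, 0, 1, 0, 0, 0, 1, 1, 1] [3, 5, 7, 13] = true := by
  decide +kernel

set_option maxRecDepth 10000 in
lemma certificateCheck_12_4 :
    certificateCheck 2 4 12 3 2 [1, 0, 1, 0, 0, 0, 0, 0, 0, 0, 0, 0, 0, 0, 0, 0, 1, 1, 0, 0, 0, 0,
    0, 0] [0, 1, 0, 0, 0, 0, 0, 0, 0, 0, 0, 0, 0, 0, 0, 1, 1, 0, 0, 0, 0, 0, 0, 1] [1, 1, 1, 0, 1,
    1, 1, 1, 1, 0, 0, 1, 0, 1, 0, 1, 1, 0, 1, 0, 1, 1] [1, 0, 1, 0, 1, 1, 1, 0, 0, 0, 1, 1, 1, 1,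
    1, 0, 1, 1, 0, 1, 0, 1, 1] [0, 0, 0, 0, 0, 1, 0, 1, 0, 0, 1, 1, 1, 1, 1, 0, 1, 0, 1, 0, 1, 0,
    1] [3, 5, 7, 13, 17, 241] = true := by
  decide +kernel

set_option maxRecDepth 10000 in
lemma certificateCheck_12_3 :
    certificateCheck 3 3 12 4 1 [1, 0, 0, 0, 0, 0, 2, 2, 2, 0, 2, 0] [0, 0, 0, 0, 0, 1, 1, 1, 0,
    1, 0, 1] [1, 2, 1, 0, 1, 0, 1, 2, 1, 0, 1, 1] [1, 1, 0, 1, 0, 0, 1, 2, 0, 0, 2, 2] [0, 0, 0,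
    1, 2, 1, 1, 2, 0, 1, 2] [2, 5, 7, 13, 73] = true := by
  decide +kernel

theorem exists_primitive_one_normal_pair_of_card_eq_pow (Fq F : Type*) [Field Fq] [Field F]
    [Fintype Fq] [Fintype F] [Algebra Fq F] {p k : ℕ} [Fact p.Prime] [CharP Fq p] (hk : 1 ≤ k)
    (hq : Fintype.card Fq = p ^ k) (hn7 : 7 ≤ Module.finrank Fq F)
    (hn13 : Module.finrank Fq F ≤ 13) (hp : p ∣ Module.finrank Fq F) :
    ∃ α : F, α ≠ 0 ∧ orderOf α = Fintype.card F - 1 ∧ orderOf α⁻¹ = Fintype.card F - 1 ∧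
      IsKNormal Fq (Fintype.card Fq) (Module.finrank Fq F) 1 α ∧
      IsKNormal Fq (Fintype.card Fq) (Module.finrank Fq F) 1 α⁻¹ := by
  have hpp : p.Prime := Fact.out
  generalize hn : Module.finrank Fq F = n at hn7 hn13 hp
  have hp2 := hpp.two_le
  have hple : p ≤ n := Nat.le_of_dvd (by omega) hp
  rw [← hn]
  have hcases : (n = 7 ∧ p = 7) ∨ (n = 8 ∧ p = 2) ∨ (n = 9 ∧ p = 3) ∨ (n = 10 ∧ p = 2) ∨
      (n = 10 ∧ p = 5) ∨ (n = 11 ∧ p = 11) ∨ (n = 12 ∧ p = 2) ∨ (n = 12 ∧ p = 3) ∨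
      (n = 13 ∧ p = 13) := by
    have hprimes : p = 2 ∨ p = 3 ∨ p = 5 ∨ p = 7 ∨ p = 11 ∨ p = 13 := by
      have : p ≤ 13 := by omega
      clear hp hple hn hq hn7 hn13
      interval_cases p <;> first | omega | (exfalso; revert hpp; norm_num)
    rcases hprimes with rfl | rfl | rfl | rfl | rfl | rfl <;> omega
  rcases hcases with ⟨rfl, rfl⟩ | ⟨rfl, rfl⟩ | ⟨rfl, rfl⟩ | ⟨rfl, rfl⟩ | ⟨rfl, rfl⟩ | ⟨rfl, rfl⟩ |
    ⟨rfl, rfl⟩ | ⟨rfl, rfl⟩ | ⟨rfl, rfl⟩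
  · obtain rfl | hk : k = 1 ∨ 2 ≤ k := by omega
    · exact exists_primitive_one_normal_pair_of_certificate Fq F (m := 1) (a := 1) one_ne_zero rfl
        hn hq (by norm_num) (List.cons_ne_nil _ _) (by norm_num) (by norm_num)
        certificateCheck_7_7
    · exact exists_primitive_one_normal_pair_of_sieveSearch Fq F (m := 1) (a := 1) one_ne_zero hn
        hn.ge 2 10 hq hk (by norm_num) (by norm_num) (by decide +kernel)
  · obtain rfl | rfl | rfl | hk : k = 1 ∨ k = 2 ∨ k = 3 ∨ 4 ≤ k := by omega
    · exact exists_primitive_one_normal_pair_of_certificate Fq F (m := 1) (a := 3) one_ne_zero rfl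
        hn hq (by norm_num) (List.cons_ne_nil _ _) (by norm_num) (by norm_num)
        certificateCheck_8_2
    · exact exists_primitive_one_normal_pair_of_certificate Fq F (m := 1) (a := 3) one_ne_zero rfl
        hn hq (by norm_num) (List.cons_ne_nil _ _) (by norm_num) (by norm_num)
        certificateCheck_8_4
    · exact exists_primitive_one_normal_pair_of_certificate Fq F (m := 1) (a := 3) one_ne_zero rfl
        hn hq (by norm_num) (List.cons_ne_nil _ _) (by norm_num) (by norm_num)
        certificateCheck_8_8
    · exact exists_primitive_one_normal_pair_of_sieveSearch Fq F (m := 1) (a := 3) one_ne_zero hn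
        (by omega) 4 17 hq hk (by norm_num) (by norm_num) (by decide +kernel)
  · obtain rfl | hk : k = 1 ∨ 2 ≤ k := by omega
    · exact exists_primitive_one_normal_pair_of_certificate Fq F (m := 1) (a := 2) one_ne_zero rfl
        hn hq (by norm_num) (List.cons_ne_nil _ _) (by norm_num) (by norm_num)
        certificateCheck_9_3
    · exact exists_primitive_one_normal_pair_of_sieveSearch Fq F (m := 1) (a := 2) one_ne_zero hn
        (by omega) 2 11 hq hk (by norm_num) (by norm_num) (by decide +kernel)
  · obtain rfl | rfl | rfl | hk : k = 1 ∨ k = 2 ∨ k = 3 ∨ 4 ≤ k := by omega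
    · exact exists_primitive_one_normal_pair_of_certificate Fq F (m := 5) (a := 1) (by norm_num) rfl
        hn hq (by norm_num) (List.cons_ne_nil _ _) (by norm_num) (by norm_num)
        certificateCheck_10_2
    · exact exists_primitive_one_normal_pair_of_certificate Fq F (m := 5) (a := 1) (by norm_num) rfl
        hn hq (by norm_num) (List.cons_ne_nil _ _) (by norm_num) (by norm_num)
        certificateCheck_10_4
    · exact exists_primitive_one_normal_pair_of_certificate Fq F (m := 5) (a := 1) (by norm_num) rfl
        hn hq (by norm_num) (List.cons_ne_nil _ _) (by norm_num) (by norm_num)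
        certificateCheck_10_8
    · exact exists_primitive_one_normal_pair_of_sieveSearch Fq F (m := 5) (a := 1) (by norm_num) hn
        (by omega) 4 17 hq hk (by norm_num) (by norm_num) (by decide +kernel)
  · obtain rfl | hk : k = 1 ∨ 2 ≤ k := by omega
    · exact exists_primitive_one_normal_pair_of_certificate Fq F (m := 2) (a := 1) two_ne_zero rfl
        hn hq (by norm_num) (List.cons_ne_nil _ _) (by norm_num) (by norm_num)
        certificateCheck_10_5
    · exact exists_primitive_one_normal_pair_of_sieveSearch Fq F (m := 2) (a := 1) two_ne_zero hn
        (by omega) 2 8 hq hk (by norm_num) (by norm_num) (by decide +kernel)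
  · exact exists_primitive_one_normal_pair_of_sieveSearch Fq F (m := 1) (a := 1) one_ne_zero hn
      (by omega) 1 5 hq hk (by norm_num) (by norm_num) (by decide +kernel)
  · obtain rfl | rfl | rfl | hk : k = 1 ∨ k = 2 ∨ k = 3 ∨ 4 ≤ k := by omega
    · exact exists_primitive_one_normal_pair_of_certificate Fq F (m := 3) (a := 2) (by norm_num) rfl
        hn hq (by norm_num) (List.cons_ne_nil _ _) (by norm_num) (by norm_num)
        certificateCheck_12_2
    · exact exists_primitive_one_normal_pair_of_certificate Fq F (m := 3) (a := 2) (by norm_num) rfl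
        hn hq (by norm_num) (List.cons_ne_nil _ _) (by norm_num) (by norm_num)
        certificateCheck_12_4
    · exact exists_primitive_one_normal_pair_of_prod_dvd Fq F (m := 3) (a := 2) (by norm_num) hn
        (by omega) (L₁ := {3, 5, 7}) (L₂ := {13, 19, 37, 73, 109}) hq (by decide)
        (by norm_num [or_imp, forall_and]) 3
        (by decide +kernel) (by decide +kernel) 27 (by norm_num) (by norm_num) (by decide +kernel)
    · exact exists_primitive_one_normal_pair_of_sieveSearch Fq F (m := 3) (a := 2) (by norm_num) hn
        (by omega) 4 17 hq hk (by norm_num) (by norm_num) (by decide +kernel)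
  · obtain rfl | rfl | hk : k = 1 ∨ k = 2 ∨ 3 ≤ k := by omega
    · exact exists_primitive_one_normal_pair_of_certificate Fq F (m := 4) (a := 1) (by norm_num) rfl
        hn hq (by norm_num) (List.cons_ne_nil _ _) (by norm_num) (by norm_num)
        certificateCheck_12_3
    · exact exists_primitive_one_normal_pair_of_prod_dvd Fq F (m := 4) (a := 1) (by norm_num) hn
        (by omega) (L₁ := {2, 5, 7, 13}) (L₂ := {41, 73, 6481}) hq (by decide)
        (by norm_num [or_imp, forall_and]) 5
        (by decide +kernel) (by decide +kernel) 78 (by norm_num) (by norm_num) (by decide +kernel)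
    · exact exists_primitive_one_normal_pair_of_sieveSearch Fq F (m := 4) (a := 1) (by norm_num) hn
        (by omega) 3 11 hq hk (by norm_num) (by norm_num) (by decide +kernel)
  · exact exists_primitive_one_normal_pair_of_sieveSearch Fq F (m := 1) (a := 1) one_ne_zero hn
      (by omega) 1 5 hq hk (by norm_num) (by norm_num) (by decide +kernel)

/-- For `7 ≤ n ≤ 13` and any prime power `q` with `gcd(q, n) ≠ 1` there is
`α ∈ F_{q^n}^*` such that both `α` and `α⁻¹` are simultaneously primitive and
`1`-normal over `F_q`. -/
theorem exists_primitive_one_normal_pair_of_not_coprime_of_le_thirteen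
    (q n : ℕ) (hq : IsPrimePow q) (hn7 : 7 ≤ n) (hn13 : n ≤ 13)
    (hgcd : Nat.gcd q n ≠ 1)
    (Fq F : Type*) [Field Fq] [Field F] [Fintype Fq] [Fintype F] [Algebra Fq F]
    (hcard : Fintype.card Fq = q) (hdim : Module.finrank Fq F = n) :
    ∃ α : F, α ≠ 0 ∧ orderOf α = q ^ n - 1 ∧ orderOf α⁻¹ = q ^ n - 1 ∧
      IsKNormal Fq q n 1 α ∧ IsKNormal Fq q n 1 α⁻¹ := by
  obtain ⟨p, k, hp, hk, rfl⟩ := hq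
  have hpp : p.Prime := hp.nat_prime
  have : Fact p.Prime := ⟨hpp⟩
  have : CharP Fq p := by
    obtain ⟨p', hp'⟩ := CharP.exists Fq
    have hprime : p'.Prime := CharP.char_is_prime Fq p'
    have hdvd : p' ∣ p ^ k := by
      rw [← hcard, ← CharP.cast_eq_zero_iff Fq p', FiniteField.cast_card_eq_zero]
    rwa [← (Nat.prime_dvd_prime_iff_eq hprime hpp).mp (hprime.dvd_of_dvd_pow hdvd)]
  have hpn : p ∣ n := by
    by_contra hndvd
    exact hgcd (Nat.Coprime.pow_left k ((Nat.Prime.coprime_iff_not_dvd hpp).mpr hndvd))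
  subst hdim
  have hF : Fintype.card F = (p ^ k) ^ Module.finrank Fq F := by
    rw [← hcard]
    exact Module.card_eq_pow_finrank (K := Fq) (V := F)
  rw [← hF, ← hcard]
  exact exists_primitive_one_normal_pair_of_card_eq_pow Fq F hk hcard hn7 hn13 hpn

end
end

section
/- Let n = 3 and let q >= 2 be any prime power. Then there does not exist any element α in F_{q^3}* such that both α and α^{-1} are simultaneously primitive and 1-normal over F_q. -/
open Polynomial

noncomputable section

/-- A monic quadratic divisor of `X ^ 3 - 1` is `X ^ 2 + c X + c ^ 2` with `c ^ 3 = 1`. -/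
theorem exists_coeff_of_monic_dvd_X_pow_three_sub_one {K : Type*} [Field K] {h : K[X]}
    (hm : h.Monic) (hd : h ∣ X ^ 3 - 1) (h2 : h.natDegree = 2) :
    ∃ c : K, c ^ 3 = 1 ∧ h.coeff 0 = c ^ 2 ∧ h.coeff 1 = c ∧ h.coeff 2 = 1 := by
  obtain ⟨g, hg⟩ := hd
  have hmon : (X ^ 3 - 1 : K[X]).Monic := monic_X_pow_sub_C (1 : K) (by norm_num)
  have hgm : g.Monic := hm.of_mul_monic_left (hg ▸ hmon)
  have hdeg : (X ^ 3 - 1 : K[X]).natDegree = 3 := natDegree_X_pow_sub_C (r := (1 : K))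
  have hg1 : g.natDegree = 1 := by
    have := hm.natDegree_mul hgm
    rw [← hg, hdeg, h2] at this
    omega
  have hc2 : h.coeff 2 = 1 := by rw [← h2]; exact hm
  have hgc : g.coeff 1 = 1 := by rw [← hg1]; exact hgm
  have hgc2 : g.coeff 2 = 0 := coeff_eq_zero_of_natDegree_lt (by omega)
  have e0 := congrArg (fun p => coeff p 0) hg
  have e1 := congrArg (fun p => coeff p 1) hg
  have e2 := congrArg (fun p => coeff p 2) hg
  simp [coeff_mul, Finset.Nat.antidiagonal_succ, coeff_X_pow, coeff_one,
    hc2, hgc, hgc2] at e0 e1 e2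
  refine ⟨h.coeff 1, ?_, ?_, rfl, hc2⟩ <;> grind

/-- The relation between the conjugates of a `1`-normal element of a cubic extension. -/
theorem IsKNormal.exists_cube_root_relation {K F : Type*} [Field K] [Field F] [Algebra K F]
    {q : ℕ} {α : F} (hα : IsKNormal K q 3 1 α) :
    ∃ c : K, c ^ 3 = 1 ∧
      algebraMap K F c ^ 2 * α + algebraMap K F c * α ^ q + α ^ q ^ 2 = 0 := by
  obtain ⟨h, ⟨hm, hd, h0, -⟩, hdeg⟩ := hα
  obtain ⟨c, hc, e0, e1, e2⟩ := exists_coeff_of_monic_dvd_X_pow_three_sub_one hm hd hdeg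
  refine ⟨c, hc, ?_⟩
  rw [polyAct, sum_over_range' h (by simp) 3 (by omega)] at h0
  simpa [Finset.sum_range_succ, e0, e1, e2] using h0

/-- In a cubic extension, a root of a monic quadratic over the base lies in the base. -/
theorem mem_range_algebraMap_of_quadratic_of_finrank_three {K F : Type*} [Field K] [Field F]
    [Algebra K F] (hdim : Module.finrank K F = 3) {t : F} (a b : K)
    (ht : t ^ 2 + algebraMap K F a * t + algebraMap K F b = 0) :
    t ∈ (algebraMap K F).range := by
  have : FiniteDimensional K F := Module.finite_of_finrank_pos (by omega)
  have hint : IsIntegral K t := .of_finite K t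
  rw [← minpoly.natDegree_eq_one_iff]
  have hdvd : (minpoly K t).natDegree ∣ 3 := hdim ▸ minpoly.degree_dvd hint
  have hp : (X ^ 2 + C a * X + C b : K[X]).natDegree = 2 := by compute_degree!
  have hle : (minpoly K t).natDegree ≤ 2 := by
    rw [← hp]
    refine natDegree_le_of_dvd (minpoly.dvd K t (by simpa using ht)) ?_
    rintro h
    simp [h] at hp
  have := (Nat.dvd_prime Nat.prime_three).1 hdvd
  omega

/-- For `n = 3` and any prime power `q` there is no `α ∈ F_{q^3}^*` such that
both `α` and `α⁻¹` are simultaneously primitive and `1`-normal over `F_q`. -/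
theorem not_exists_primitive_one_normal_pair_of_n_three
    (q : ℕ) (hq : IsPrimePow q)
    (Fq F : Type*) [Field Fq] [Field F] [Fintype Fq] [Fintype F] [Algebra Fq F]
    (hcard : Fintype.card Fq = q) (hdim : Module.finrank Fq F = 3) :
    ¬ ∃ α : F, α ≠ 0 ∧ orderOf α = q ^ 3 - 1 ∧ orderOf α⁻¹ = q ^ 3 - 1 ∧
      IsKNormal Fq q 3 1 α ∧ IsKNormal Fq q 3 1 α⁻¹ := by
  rintro ⟨α, hα, hord, -, h₁, h₂⟩
  obtain ⟨c, hc, hcα⟩ := h₁.exists_cube_root_relation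
  obtain ⟨d, -, hdα⟩ := h₂.exists_cube_root_relation
  have hq2 : 2 ≤ q := hq.two_le
  have hy : α ^ q ≠ 0 := pow_ne_zero _ hα
  have hz : α ^ q ^ 2 ≠ 0 := pow_ne_zero _ hα
  have hc0 : c ≠ 0 := by rintro rfl; simp at hc
  have hyz : α ^ q ^ 2 = (α ^ q) ^ q := by rw [← pow_mul, sq]
  have hmem : algebraMap Fq F c * α ^ q / α ^ q ^ 2 ∈ (algebraMap Fq F).range := by
    refine mem_range_algebraMap_of_quadratic_of_finrank_three hdim
      (1 + d * c - (d * c) ^ 2) (d * c) ?_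
    simp only [inv_pow, map_add, map_sub, map_mul, map_pow, map_one] at hdα ⊢
    generalize algebraMap Fq F c = c at *
    generalize algebraMap Fq F d = d at *
    generalize α ^ q ^ 2 = z at *
    generalize α ^ q = y at *
    have hprod : d ^ 2 * (y * z) + d * (α * z) + α * y = 0 := by
      field_simp at hdα
      linear_combination hdα
    field_simp
    linear_combination (-c ^ 3) * hprod + c * (d * z + y) * hcα
  obtain ⟨s, hs⟩ := hmem
  have hs0 : s ≠ 0 := by
    rintro rfl
    rw [map_zero] at hs
    exact div_ne_zero (mul_ne_zero ((_root_.map_ne_zero _).2 hc0) hy) hz hs.symm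
  have hu : α ^ q = algebraMap Fq F (s / c) * (α ^ q) ^ q := by
    have := (map_ne_zero (algebraMap Fq F)).2 hc0
    rw [← hyz, map_div₀, hs]
    field_simp
  have hone : ((α ^ q) ^ (q - 1)) ^ (q - 1) = 1 := by
    have hsplit : (α ^ q) ^ q = (α ^ q) ^ (q - 1) * α ^ q := by
      rw [← pow_succ, Nat.sub_add_cancel (by omega)]
    have hinv : algebraMap Fq F (s / c) * (α ^ q) ^ (q - 1) = 1 := by
      apply mul_right_cancel₀ hy
      rw [mul_assoc, ← hsplit, ← hu, one_mul]
    have hr : (s / c) ^ (q - 1) = 1 := by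
      rw [← hcard]
      exact FiniteField.pow_card_sub_one_eq_one _ (div_ne_zero hs0 hc0)
    have := congrArg (· ^ (q - 1)) hinv
    simpa [mul_pow, ← map_pow, hr, -map_div₀] using this
  rw [← pow_mul, ← pow_mul] at hone
  have hdvd := orderOf_dvd_of_pow_eq_one hone
  rw [hord] at hdvd
  obtain ⟨m, rfl⟩ : ∃ m, q = m + 2 := ⟨q - 2, by omega⟩
  have hle := Nat.le_of_dvd (by simp) hdvd
  rw [show m + 2 - 1 = m + 1 by omega, Nat.sub_le_iff_le_add] at hle
  nlinarith

end
end

section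
/- Let q be a prime power. If there exists an element α in F_{q^4}* such that both α and α^{-1} are simultaneously primitive and 1-normal over F_q, then q ≡ 1 (mod 4). -/
open Polynomial

noncomputable section

/-- A common value of two powers of `α` forces the order of `α` to be at most the difference
of the exponents. -/
theorem orderOf_le_sub_of_pow_eq_pow {F : Type*} [Field F] {α : F} (hα : α ≠ 0) {m n : ℕ}
    (hmn : m < n) (h : α ^ m = α ^ n) : orderOf α ≤ n - m := by
  refine orderOf_le_of_pow_eq_one (by omega) (mul_left_cancel₀ (pow_ne_zero m hα) ?_)
  rw [← pow_add, Nat.add_sub_cancel' hmn.le, h, mul_one]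

/-- In a finite field whose order is not `1` modulo `4`, a fourth root of unity is a square root
of unity. -/
theorem sq_eq_one_of_pow_four_eq_one {K : Type*} [Field K] [Fintype K]
    (hK : Fintype.card K % 4 ≠ 1) {ζ : K} (hζ : ζ ^ 4 = 1) : ζ ^ 2 = 1 := by
  have hζ0 : ζ ≠ 0 := by rintro rfl; simp at hζ
  have hgcd : ζ ^ Nat.gcd 4 (Fintype.card K - 1) = 1 :=
    pow_gcd_eq_one.mpr ⟨hζ, FiniteField.pow_card_sub_one_eq_one ζ hζ0⟩
  suffices hdvd : Nat.gcd 4 (Fintype.card K - 1) ∣ 2 by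
    obtain ⟨k, hk⟩ := hdvd
    rw [hk, pow_mul, hgcd, one_pow]
  clear hgcd
  have hpos : 1 < Fintype.card K := Fintype.one_lt_card
  have h4 : Nat.gcd 4 (Fintype.card K - 1) ≤ 4 := Nat.gcd_le_left _ (by norm_num)
  have hl := Nat.gcd_dvd_left 4 (Fintype.card K - 1)
  have hr := Nat.gcd_dvd_right 4 (Fintype.card K - 1)
  generalize Nat.gcd 4 (Fintype.card K - 1) = g at *
  interval_cases g <;> omega

/-- If `q` is not `1` modulo `4`, the `F_q`-order of a `1`-normal element of `F_{q^4}` is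
`X ^ 3 + ζ X ^ 2 + X + ζ` with `ζ ^ 2 = 1`. -/
theorem IsKNormal.exists_sq_eq_one {K F : Type*} [Field K] [Fintype K] [Field F] [Algebra K F]
    (hK : Fintype.card K % 4 ≠ 1) {q : ℕ} {β : F} (hβ : IsKNormal K q 4 1 β) :
    ∃ e : F, e ^ 2 = 1 ∧ β ^ q ^ 3 + e * β ^ q ^ 2 + β ^ q + e * β = 0 := by
  obtain ⟨h, ⟨hmonic, ⟨g, hg⟩, hact, -⟩, hdeg⟩ := hβ
  have hX : (X ^ 4 - 1 : K[X]).Monic := monic_X_pow_sub_C 1 (by norm_num)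
  have hgmonic : g.Monic := hmonic.of_mul_monic_left (hg ▸ hX)
  have hgdeg : g.natDegree = 1 := by
    have hdegX : (X ^ 4 - 1 : K[X]).natDegree = 4 := natDegree_X_pow_sub_C (r := (1 : K))
    rw [hg, hmonic.natDegree_mul hgmonic] at hdegX
    omega
  obtain ⟨ζ, rfl⟩ : ∃ ζ : K, g = X - C ζ := by
    refine ⟨-g.coeff 0, ?_⟩
    rw [C_neg, sub_neg_eq_add]
    exact hgmonic.eq_X_add_C hgdeg
  have hζ : ζ ^ 2 = 1 := by
    refine sq_eq_one_of_pow_four_eq_one hK ?_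
    have := congrArg (eval ζ) hg
    simpa [sub_eq_zero] using this
  have hC : (C ζ : K[X]) ^ 2 = 1 := by rw [← C_pow, hζ, C_1]
  have hh : h = X ^ 3 + C ζ * X ^ 2 + X + C ζ := by
    refine mul_right_cancel₀ (X_sub_C_ne_zero ζ) ?_
    rw [← hg]
    linear_combination (X ^ 2 + 1) * hC
  refine ⟨algebraMap K F ζ, by rw [← map_pow, hζ, map_one], ?_⟩
  rw [polyAct, sum_over_range' _ (by simp) 4 (by omega)] at hact
  simp [hh, Finset.sum_range_succ, coeff_X, coeff_C] at hact
  linear_combination hact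

/-- If there is `α ∈ F_{q^4}^*` such that both `α` and `α⁻¹` are simultaneously
primitive and `1`-normal over `F_q`, then `q ≡ 1 (mod 4)`. -/
theorem q_mod_four_eq_one_of_exists_primitive_one_normal_pair
    (q : ℕ) (hq : IsPrimePow q)
    (Fq F : Type*) [Field Fq] [Field F] [Fintype Fq] [Fintype F] [Algebra Fq F]
    (hcard : Fintype.card Fq = q) (hdim : Module.finrank Fq F = 4)
    (hex : ∃ α : F, α ≠ 0 ∧ orderOf α = q ^ 4 - 1 ∧ orderOf α⁻¹ = q ^ 4 - 1 ∧
      IsKNormal Fq q 4 1 α ∧ IsKNormal Fq q 4 1 α⁻¹) :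
    q % 4 = 1 := by
  by_contra hq4
  obtain ⟨α, hα, hord, -, h₁, h₂⟩ := hex
  have hq2 : 2 ≤ q := hq.two_le
  obtain ⟨e, he, h₁⟩ := h₁.exists_sq_eq_one (hcard ▸ hq4)
  obtain ⟨f, hf, h₂⟩ := h₂.exists_sq_eq_one (hcard ▸ hq4)
  simp only [inv_pow] at h₂
  by_cases hac : α + α ^ q ^ 2 = 0
  · have hpow : α ^ 2 = α ^ (2 * q ^ 2) := by
      rw [mul_comm, pow_mul]
      linear_combination (α - α ^ q ^ 2) * hac
    have hle := orderOf_le_sub_of_pow_eq_pow hα (by nlinarith) hpow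
    rw [hord] at hle
    have hsq : 4 ≤ q ^ 2 := by nlinarith
    have hfour : 4 * q ^ 2 ≤ q ^ 4 := by nlinarith
    omega
  · have hprod : e * (α * α ^ q ^ 2) = f * (α ^ q * α ^ q ^ 3) := by
      have hb : α ^ q ≠ 0 := pow_ne_zero _ hα
      have hc : α ^ q ^ 2 ≠ 0 := pow_ne_zero _ hα
      have hd : α ^ q ^ 3 ≠ 0 := pow_ne_zero _ hα
      generalize α ^ q = b at *
      generalize α ^ q ^ 2 = c at *
      generalize α ^ q ^ 3 = d at *
      field_simp at h₂
      refine mul_left_cancel₀ hac ?_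
      linear_combination α * c * h₁ - h₂
    have hpow : α ^ (2 * (1 + q ^ 2)) = α ^ (2 * (q + q ^ 3)) := by
      rw [mul_comm 2, mul_comm 2, pow_mul, pow_mul, pow_add, pow_add, pow_one]
      have := congrArg (· ^ 2) hprod
      simpa only [mul_pow _ (_ * _), he, hf, one_mul] using this
    have hlt : 2 * (1 + q ^ 2) < 2 * (q + q ^ 3) := by nlinarith [sq_nonneg q]
    have hle := orderOf_le_sub_of_pow_eq_pow hα hlt hpow
    rw [hord] at hle
    have hpos : 1 ≤ q ^ 4 := Nat.one_le_pow _ _ (by omega)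
    zify [hlt.le, hpos] at hle
    zify at hq2
    nlinarith [mul_pos (mul_pos (by linarith : (0 : ℤ) < q - 1) (by linarith : (0 : ℤ) < q - 1))
      (by positivity : (0 : ℤ) < q ^ 2 + 1)]

end
end

section
/- Let q be a prime power, n a positive integer, and k an integer with 0 <= k < n. Let g(x) = Σ_{i=0}^{k} a_i x^i in F_q[x] be monic of degree k dividing x^n - 1, and let (g∘X) = Σ_{i=0}^{k} a_i X^{q^i} denote the associated linearized polynomial in F_{q^n}[X]. Let F be an algebraic closure of F_{q^n} and let y_1, y_2 in F_{q^n}. If the rational function y_1·X + y_2·(g∘X)^{-1} in F(X) equals L(X)^{q^n} - L(X) for some rational function L(X) in F(X), then y_1 = 0 and y_2 = 0. -/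
open Polynomial

noncomputable section

/-- If `G` has a simple zero at `0` and `(u·X·G + v)·b^Q = G·(a^Q − a·b^(Q−1))` with `a`, `b`
coprime and `Q ≥ 2`, then `v = 0`: otherwise `0` would be a pole of `a/b`, whose `Q`-th power
has a pole of order at least `Q` there. -/
theorem eq_zero_of_simple_zero_of_isCoprime {K : Type*} [Field K] {G a b : K[X]} {u v : K} {Q : ℕ}
    (hQ : 2 ≤ Q) (hG0 : G.coeff 0 = 0) (hG1 : G.coeff 1 ≠ 0) (hab : IsCoprime a b)
    (h : (C u * X * G + C v) * b ^ Q = G * (a ^ Q - a * b ^ (Q - 1))) : v = 0 := by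
  by_contra hv
  have hXG : X ∣ G := X_dvd_iff.2 hG0
  have hnum : ¬ X ∣ C u * X * G + C v := by
    rw [X_dvd_iff]
    simpa [mul_coeff_zero, hG0] using hv
  have hXb : X ∣ b := by
    have hdvd : X ∣ (C u * X * G + C v) * b ^ Q := h ▸ hXG.mul_right _
    exact prime_X.dvd_of_dvd_pow ((prime_X.dvd_or_dvd hdvd).resolve_left hnum)
  have hXa : ¬ X ∣ a := fun hXa => prime_X.not_isUnit (hab.isUnit_of_dvd' hXa hXb)
  have hden : ¬ X ∣ a ^ Q - a * b ^ (Q - 1) := by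
    intro hd
    have hXab : X ∣ a * b ^ (Q - 1) := (hXb.trans (dvd_pow_self b (by omega))).mul_left a
    exact hXa (prime_X.dvd_of_dvd_pow ((dvd_sub_left hXab).1 hd))
  have hpow : X ^ 2 ∣ G * (a ^ Q - a * b ^ (Q - 1)) :=
    h ▸ ((pow_dvd_pow X hQ).trans (pow_dvd_pow_of_dvd hXb Q)).mul_left _
  exact hG1 (X_pow_dvd_iff.1 (prime_X.pow_dvd_of_dvd_mul_right 2 hden hpow) 1 (by norm_num))

/-- A nonzero multiple of `X` is not of the form `L^Q − L` with `L = a/b` and `Q ≥ 2`,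
for degree reasons. -/
theorem eq_zero_of_linear_mul_pow_eq {K : Type*} [Field K] {a b : K[X]} {u : K} {Q : ℕ}
    (hQ : 2 ≤ Q) (hb : b ≠ 0) (h : C u * X * b ^ Q = a ^ Q - a * b ^ (Q - 1)) : u = 0 := by
  by_contra hu
  have hleft : (C u * X * b ^ Q).natDegree = 1 + Q * b.natDegree := by
    rw [natDegree_mul (mul_ne_zero (C_ne_zero.2 hu) X_ne_zero) (pow_ne_zero _ hb),
      natDegree_C_mul_X _ hu, natDegree_pow]
  obtain ⟨m, rfl⟩ : ∃ m, Q = m + 1 := ⟨Q - 1, by omega⟩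
  rw [Nat.add_sub_cancel] at h
  have hmul : (a * b ^ m).natDegree ≤ a.natDegree + m * b.natDegree :=
    natDegree_mul_le.trans (by rw [natDegree_pow])
  rcases le_or_gt a.natDegree b.natDegree with hle | hlt
  · have hright : (a ^ (m + 1) - a * b ^ m).natDegree ≤ (m + 1) * b.natDegree := by
      refine (natDegree_sub_le _ _).trans (max_le ?_ (hmul.trans ?_))
      · rw [natDegree_pow]
        gcongr
      · linarith
    rw [← h, hleft] at hright
    omega
  · have hright : (a ^ (m + 1) - a * b ^ m).natDegree = (m + 1) * a.natDegree := by
      rw [natDegree_sub_eq_left_of_natDegree_lt, natDegree_pow]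
      rw [natDegree_pow]
      refine hmul.trans_lt ?_
      have : m * b.natDegree < m * a.natDegree := Nat.mul_lt_mul_of_pos_left hlt (by omega)
      linarith
    rw [← h, hleft] at hright
    have : (m + 1) * (b.natDegree + 1) ≤ (m + 1) * a.natDegree := Nat.mul_le_mul_left _ hlt
    linarith

/-- The coefficient of `X` in the linearized polynomial `∑ cᵢ X^(q^i)` is `c₀`. -/
theorem coeff_one_sum_C_mul_X_pow_pow {R : Type*} [Semiring R] (c : ℕ → R) {q : ℕ} (hq : 1 < q)
    (k : ℕ) : (∑ i ∈ Finset.range (k + 1), C (c i) * X ^ q ^ i).coeff 1 = c 0 := by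
  rw [finsetSum_coeff, Finset.sum_eq_single 0]
  · simp
  · intro i _ hi
    rw [coeff_C_mul_X_pow, if_neg (Nat.one_lt_pow hi hq).ne]
  · simp

/-- A linearized polynomial `∑ cᵢ X^(q^i)` has no constant term. -/
theorem coeff_zero_sum_C_mul_X_pow_pow {R : Type*} [Semiring R] (c : ℕ → R) {q : ℕ} (hq : 1 < q)
    (k : ℕ) : (∑ i ∈ Finset.range (k + 1), C (c i) * X ^ q ^ i).coeff 0 = 0 := by
  rw [finsetSum_coeff]
  refine Finset.sum_eq_zero fun i _ => ?_
  rw [coeff_C_mul_X_pow, if_neg (pow_pos (by omega) i).ne]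

/-- A divisor of `X^n − 1` with `n > 0` has nonzero constant term. -/
theorem coeff_zero_ne_zero_of_dvd_X_pow_sub_one {R : Type*} [CommRing R] [Nontrivial R] {g : R[X]}
    {n : ℕ} (hn : 0 < n) (hg : g ∣ X ^ n - 1) : g.coeff 0 ≠ 0 := by
  intro h0
  have := X_dvd_iff.1 ((X_dvd_iff.2 h0).trans hg)
  simp [coeff_X_pow, hn.ne] at this

/-- If the rational function `y₁·X + y₂·(g∘X)⁻¹` over the algebraic closure of
`F_{q^n}` — where `g∘X = Σ_{i=0}^{k} a_i X^{q^i}` is the linearized polynomial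
associated to a monic degree-`k` divisor `g = Σ_{i=0}^{k} a_i x^i` of `x^n − 1` —
equals `L(X)^{q^n} − L(X)` for some rational function `L`, then `y₁ = y₂ = 0`. -/
theorem eq_zero_of_linearized_rational_eq_pow_sub
    (q n k : ℕ) (hq : IsPrimePow q) (hn : 0 < n) (hk : k < n)
    (Fq F K : Type*) [Field Fq] [Field F] [Field K]
    [Fintype Fq] [Fintype F] [Algebra Fq F] [Algebra F K] [IsAlgClosure F K]
    (hcard : Fintype.card Fq = q) (hdim : Module.finrank Fq F = n)
    (g : Fq[X]) (hgm : g.Monic) (hgd : g.natDegree = k)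
    (hgdvd : g ∣ (X ^ n - 1 : Fq[X]))
    (y₁ y₂ : F)
    (hL : ∃ L : RatFunc K,
      RatFunc.C (algebraMap F K y₁) * RatFunc.X +
        RatFunc.C (algebraMap F K y₂) /
          algebraMap K[X] (RatFunc K)
            (∑ i ∈ Finset.range (k + 1),
              C (algebraMap F K (algebraMap Fq F (g.coeff i))) * X ^ q ^ i) =
      L ^ q ^ n - L) :
    y₁ = 0 ∧ y₂ = 0 := by
  have hq1 : 1 < q := hq.one_lt
  have hQ : 2 ≤ q ^ n := Nat.one_lt_pow hn.ne' hq1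
  obtain ⟨L, hL⟩ := hL
  set c : ℕ → K := fun i => algebraMap F K (algebraMap Fq F (g.coeff i)) with hc
  set G : K[X] := ∑ i ∈ Finset.range (k + 1), C (c i) * X ^ q ^ i with hGdef
  have hG0 : G.coeff 0 = 0 := coeff_zero_sum_C_mul_X_pow_pow c hq1 k
  have hG1 : G.coeff 1 ≠ 0 := by
    rw [hGdef, coeff_one_sum_C_mul_X_pow_pow c hq1 k, hc]
    simpa using coeff_zero_ne_zero_of_dvd_X_pow_sub_one hn hgdvd
  have hG : G ≠ 0 := fun h => hG1 (by simp [h])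
  have hb : L.denom ≠ 0 := L.denom_ne_zero
  have key : (C (algebraMap F K y₁) * X * G + C (algebraMap F K y₂)) * L.denom ^ q ^ n =
      G * (L.num ^ q ^ n - L.num * L.denom ^ (q ^ n - 1)) := by
    apply RatFunc.algebraMap_injective K
    have hG' : algebraMap K[X] (RatFunc K) G ≠ 0 := RatFunc.algebraMap_ne_zero hG
    have hb' : algebraMap K[X] (RatFunc K) L.denom ≠ 0 := RatFunc.algebraMap_ne_zero hb
    rw [← RatFunc.num_div_denom L] at hL
    obtain ⟨m, hm⟩ : ∃ m, q ^ n = m + 1 := ⟨q ^ n - 1, by omega⟩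
    simp only [hm, div_pow, Nat.add_sub_cancel, map_mul, map_add, map_sub, map_pow,
      RatFunc.algebraMap_C, RatFunc.algebraMap_X] at hL ⊢
    field_simp at hL
    refine mul_right_cancel₀ hb' ?_
    linear_combination hL
  have hy₂ : algebraMap F K y₂ = 0 :=
    eq_zero_of_simple_zero_of_isCoprime hQ hG0 hG1 L.isCoprime_num_denom key
  have hy₁ : algebraMap F K y₁ = 0 := by
    refine eq_zero_of_linear_mul_pow_eq (a := L.num) hQ hb (mul_left_cancel₀ hG ?_)
    rw [← key, hy₂, C_0]
    ring
  simpa using And.intro hy₁ hy₂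

end
end
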